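/- Let I = (a,b] be a bounded interval and let A(t), t ∈ I, be a Kato-stable family of generators with constants (M, ω) on a separable, reflexive Banach space X such that (i) t ↦ R(λ, A(t)) and t ↦ R(λ, A(t)*) are strongly continuous for some λ ≥ 0; (ii) there are Banach spaces Y and Y' densely embedded in X and X* respectively with Y ↪ D(A(t)) and Y' ↪ D(A(t)*), the embeddings uniformly bounded in t; (iii) t ↦ A(t)y and t ↦ A(t)*y* are strongly continuous for all y ∈ Y and y* ∈ Y'. Then there exists a family of bounded operators U(t,s), (t,s) ∈ D_I, with ‖U(t,s)‖ ≤ M e^{ω(t−s)}, U(s,s) = 1, satisfying the causal factorization U(t,r)U(r,s) = U(t,s) for all (t,s) ∈ D_I and all r ∈ [s,t] outside a fixed null set N. Moreover: (t,s) ↦ U(t,s) is weakly continuous and strongly measurable on D_I; s ↦ U(t,s) is strongly continuous uniformly in t; U(t,s) → 1 strongly as (t,s) → (r,r); ∂/∂s U(t,s)y = −U(t,s)A(s)y and the right derivative of t ↦ U(t,s)y at t = s equals A(s)y for y ∈ Y; the U(t,s) arise as weak limits of the propagators U_{n_l}(t,s) generated by a subsequence of an admissible bounded approximation A_n(t) of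 A(t); and the operator G₀ = −d/dt + A(·) on W^{1}_0(I,X) ∩ L²(I,Y) has an extension G which generates a strongly continuous semigroup T(·) on L²(I,X) given by (T(σ)f)(t) = U(t,t−σ)f(t−σ) for t, t−σ ∈ I and 0 otherwise. -/

import Mathlib

open MeasureTheory Set Real Filter
open scoped ENNReal Topology Classical

/-- A minimal compact subset whose closed convex hull together with `L` is all of `C`. -/
theorem exists_minimal_compact_generator {E : Type*} [NormedAddCommGroup E] [NormedSpace ℝ E]
    {C L : Set E} (hC : IsCompact C) (hCc : Convex ℝ C) (hL : L ⊆ C) :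
    ∃ D : Set E, Minimal (fun D : Set E => IsCompact D ∧ D ⊆ C ∧
      closedConvexHull ℝ (D ∪ L) = C) D := by
  have hCcl : IsClosed C := hC.isClosed
  obtain ⟨D, -, hD⟩ := zorn_superset_nonempty
    {D : Set E | IsCompact D ∧ D ⊆ C ∧ closedConvexHull ℝ (D ∪ L) = C} (by
    intro c hc hchain hne
    have hdir : DirectedOn (fun x1 x2 : Set E => x1 ⊇ x2) c := by
      intro x hx y hy
      rcases hchain.total hx hy with h | h
      · exact ⟨x, hx, subset_rfl, h⟩
      · exact ⟨y, hy, h, subset_rfl⟩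
    obtain ⟨d0, hd0⟩ := hne
    refine ⟨⋂₀ c, ⟨?_, ?_, ?_⟩, fun s hs => sInter_subset_of_mem hs⟩
    · exact (hc hd0).1.of_isClosed_subset
        (isClosed_sInter fun s hs => (hc hs).1.isClosed) (sInter_subset_of_mem hd0)
    · exact (sInter_subset_of_mem hd0).trans (hc hd0).2.1
    · refine subset_antisymm (closedConvexHull_min (union_subset
        ((sInter_subset_of_mem hd0).trans (hc hd0).2.1) hL) hCc hCcl) ?_
      intro x hx
      by_contra hxn
      obtain ⟨f, u, hfu, hux⟩ := geometric_hahn_banach_closed_point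
        (convex_closedConvexHull (𝕜 := ℝ) (s := ⋂₀ c ∪ L)) isClosed_closedConvexHull hxn
      have hempty : ∃ d ∈ c, ∀ y ∈ d, f y < u := by
        by_contra hcon
        push Not at hcon
        have : (⋂₀ ((fun d => d ∩ {y | u ≤ f y}) '' c)).Nonempty := by
          have : Nonempty ((fun d : Set E => d ∩ {y | u ≤ f y}) '' c) :=
            ⟨⟨_, mem_image_of_mem _ hd0⟩⟩
          refine IsCompact.nonempty_sInter_of_directed_nonempty_isCompact_isClosed ?_ ?_ ?_ ?_
          · rintro _ ⟨x, hx, rfl⟩ _ ⟨y, hy, rfl⟩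
            obtain ⟨z, hz, h1, h2⟩ := hdir x hx y hy
            exact ⟨_, mem_image_of_mem _ hz, inter_subset_inter_left _ h1,
              inter_subset_inter_left _ h2⟩
          · rintro _ ⟨d, hd, rfl⟩
            obtain ⟨y, hy, hy2⟩ := hcon d hd
            exact ⟨y, hy, hy2⟩
          · rintro _ ⟨d, hd, rfl⟩
            exact (hc hd).1.inter_right (isClosed_le continuous_const f.continuous)
          · rintro _ ⟨d, hd, rfl⟩
            exact (hc hd).1.isClosed.inter (isClosed_le continuous_const f.continuous)
        obtain ⟨y, hy⟩ := this
        have hyc : y ∈ ⋂₀ c := fun d hd => (hy _ (mem_image_of_mem _ hd)).1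
        have hyu : u ≤ f y := (hy _ (mem_image_of_mem _ hd0)).2
        exact absurd (hfu y (subset_closedConvexHull (Or.inl hyc))) (not_lt.2 hyu)
      obtain ⟨d, hd, hdu⟩ := hempty
      have hsub : closedConvexHull ℝ (d ∪ L) ⊆ {y | f y ≤ u} := by
        refine closedConvexHull_min ?_ (convex_halfSpace_le f.toLinearMap.isLinear u)
          (isClosed_le f.continuous continuous_const)
        rintro y (hy | hy)
        · exact (hdu y hy).le
        · exact (hfu y (subset_closedConvexHull (Or.inr hy))).le
      rw [(hc hd).2.2] at hsub
      exact absurd (hsub hx) (not_le.2 hux)) C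
    ⟨hC, subset_rfl, subset_antisymm (closedConvexHull_min (union_subset subset_rfl hL) hCc hCcl)
      (subset_union_left.trans subset_closedConvexHull)⟩
  exact ⟨D, hD⟩

theorem IsCompact.convexJoin_of_isCompact {E : Type*} [NormedAddCommGroup E] [NormedSpace ℝ E]
    {A B : Set E} (hA : IsCompact A) (hB : IsCompact B) : IsCompact (convexJoin ℝ A B) := by
  have : convexJoin ℝ A B =
      (fun q : ℝ × E × E => (1 - q.1) • q.2.1 + q.1 • q.2.2) '' (Icc 0 1 ×ˢ A ×ˢ B) := by
    ext x
    simp only [mem_convexJoin, segment_eq_image, mem_image, Prod.exists, mem_prod]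
    constructor
    · rintro ⟨p, hp, q, hq, t, ht, rfl⟩
      exact ⟨t, p, q, ⟨ht, hp, hq⟩, rfl⟩
    · rintro ⟨t, p, q, ⟨ht, hp, hq⟩, rfl⟩
      exact ⟨p, hp, q, hq, t, ht, rfl⟩
  rw [this]
  exact (isCompact_Icc.prod (hA.prod hB)).image (by fun_prop)

/-- **Dentability.**  Let `T` be an affine bounded map with separable range on a compact convex
set `C`, such that the preimages of closed balls are closed.  Then every nonempty open slice of
`C` contains a nonempty open slice on which `T` has small oscillation. -/
theorem exists_slice_small_oscillation {E F : Type*} [NormedAddCommGroup E] [NormedSpace ℝ E]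
    [NormedAddCommGroup F] [NormedSpace ℝ F]
    {C : Set E} (hC : IsCompact C) (hCc : Convex ℝ C) (T : E → F)
    (hT : ∀ x ∈ C, ∀ y ∈ C, ∀ s t : ℝ, 0 ≤ s → 0 ≤ t → s + t = 1 →
      T (s • x + t • y) = s • T x + t • T y)
    (hTs : TopologicalSpace.IsSeparable (T '' C)) {R : ℝ} (hTb : ∀ x ∈ C, ‖T x‖ ≤ R)
    (hTc : ∀ z : F, ∀ δ : ℝ, IsClosed (C ∩ {x | ‖T x - z‖ ≤ δ}))
    (l : E →L[ℝ] ℝ) (c : ℝ) (hne : (C ∩ {x | c < l x}).Nonempty) {ε : ℝ} (hε : 0 < ε) :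
    ∃ (l' : E →L[ℝ] ℝ) (c' : ℝ), (C ∩ {x | c' < l' x}).Nonempty ∧
      C ∩ {x | c' < l' x} ⊆ {x | c < l x} ∧
      ∀ x ∈ C ∩ {x | c' < l' x}, ∀ y ∈ C ∩ {x | c' < l' x}, ‖T x - T y‖ ≤ ε := by
  set L : Set E := C ∩ {x | l x ≤ c} with hLdef
  have hLC : L ⊆ C := inter_subset_left
  obtain ⟨x0, hx0C, hx0⟩ := hne
  have hR : 0 ≤ R := (norm_nonneg _).trans (hTb x0 hx0C)
  obtain ⟨D, hD⟩ := exists_minimal_compact_generator hC hCc hLC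
  obtain ⟨hDk, hDC, hDL⟩ := hD.prop
  have hLconv : Convex ℝ L := hCc.inter (convex_halfSpace_le l.toLinearMap.isLinear c)
  have hLcl : IsClosed L := hC.isClosed.inter (isClosed_le l.continuous continuous_const)
  have hDne : D.Nonempty := by
    by_contra h
    rw [not_nonempty_iff_eq_empty] at h
    rw [h, empty_union] at hDL
    have : C ⊆ L := by rw [← hDL]; exact closedConvexHull_min subset_rfl hLconv hLcl
    exact absurd (show l x0 ≤ c from (this hx0C).2) (not_le.2 hx0)
  have : CompactSpace D := isCompact_iff_compactSpace.1 hDk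
  have : Nonempty D := hDne.to_subtype
  -- Baire: a relatively open piece of `D` on which `T` is almost constant
  obtain ⟨Z, hZc, hZd⟩ := hTs
  have hZne : Z.Nonempty := by
    by_contra h
    rw [not_nonempty_iff_eq_empty] at h
    rw [h, closure_empty] at hZd
    exact hZd (mem_image_of_mem T hx0C)
  obtain ⟨z, hz⟩ := hZc.exists_eq_range hZne
  obtain ⟨n, hn⟩ := nonempty_interior_of_iUnion_of_closed
    (X := D) (f := fun n : ℕ => {x : D | ‖T x - z n‖ ≤ ε / 8}) (by
      intro n
      have h := (hTc (z n) (ε / 8)).preimage (continuous_subtype_val (p := fun x => x ∈ D))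
      convert h using 1
      ext x
      simp [hDC x.2]) (by
      refine eq_univ_of_forall fun x => ?_
      have hx := hZd (mem_image_of_mem T (hDC x.2))
      rw [Metric.mem_closure_iff] at hx
      obtain ⟨w, hw, hwx⟩ := hx (ε / 8) (by positivity)
      rw [hz] at hw
      obtain ⟨n, rfl⟩ := hw
      rw [dist_eq_norm] at hwx
      exact mem_iUnion.2 ⟨n, hwx.le⟩)
  obtain ⟨x1, hx1⟩ := hn
  obtain ⟨W0, hW0sub, hW0open, hx1W0⟩ := mem_interior.1 hx1
  obtain ⟨W, hWo, rfl⟩ := isOpen_induced_iff.1 hW0open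
  set B : Set E := C ∩ {x | ‖T x - z n‖ ≤ ε / 8} with hBdef
  have hBconv : Convex ℝ B := by
    rintro x ⟨hxC, hx⟩ y ⟨hyC, hy⟩ s t hs ht hst
    refine ⟨hCc hxC hyC hs ht hst, ?_⟩
    have hzz : z n = s • z n + t • z n := by rw [← add_smul, hst, one_smul]
    have : T (s • x + t • y) - z n = s • (T x - z n) + t • (T y - z n) := by
      rw [hT x hxC y hyC s t hs ht hst]
      nth_rewrite 1 [hzz]
      simp only [smul_sub]
      abel
    simp only [mem_ofPred_eq] at hx hy ⊢
    rw [this]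
    calc ‖s • (T x - z n) + t • (T y - z n)‖
        ≤ s * ‖T x - z n‖ + t * ‖T y - z n‖ := by
          refine (norm_add_le _ _).trans ?_
          rw [norm_smul, norm_smul, Real.norm_of_nonneg hs, Real.norm_of_nonneg ht]
      _ ≤ s * (ε / 8) + t * (ε / 8) := by gcongr
      _ = ε / 8 := by rw [← add_mul, hst, one_mul]
  have hBk : IsCompact B := hC.of_isClosed_subset (hTc _ _) inter_subset_left
  have hDWB : D ∩ W ⊆ B := fun x hx =>
    ⟨hDC hx.1, hW0sub (show (⟨x, hx.1⟩ : D) ∈ Subtype.val ⁻¹' W from hx.2)⟩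
  set A : Set E := closedConvexHull ℝ (D \ W ∪ L) with hAdef
  have hAC : A ⊆ C := closedConvexHull_min
    (union_subset (sdiff_subset.trans hDC) hLC) hCc hC.isClosed
  have hAk : IsCompact A := hC.of_isClosed_subset isClosed_closedConvexHull hAC
  have hAconv : Convex ℝ A := convex_closedConvexHull
  have hLA : L ⊆ A := subset_union_right.trans subset_closedConvexHull
  have hAne : A ≠ C := by
    intro h
    have hle := hD.le_of_le (y := D \ W) ⟨hDk.diff hWo, sdiff_subset.trans hDC, h⟩ sdiff_subset
    exact (hle x1.2).2 hx1W0
  have hBne : B.Nonempty := ⟨x1, hDWB ⟨x1.2, hx1W0⟩⟩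
  have hcov : ∀ x ∈ C, A.Nonempty → x ∈ convexJoin ℝ A B := by
    intro x hx hAn
    rw [← hDL] at hx
    refine closedConvexHull_min (t := convexJoin ℝ A B) ?_ (hAconv.convexJoin hBconv)
      (hAk.convexJoin_of_isCompact hBk).isClosed hx
    rintro y (hy | hy)
    · by_cases hyW : y ∈ W
      · exact subset_convexJoin_right hAn (hDWB ⟨hy, hyW⟩)
      · exact subset_convexJoin_left hBne (subset_closedConvexHull (Or.inl ⟨hy, hyW⟩))
    · exact subset_convexJoin_left hBne (hLA hy)
  by_cases hAn : A.Nonempty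
  · obtain ⟨p, hpC, hpA⟩ : ∃ p ∈ C, p ∉ A := by
      by_contra h
      push Not at h
      exact hAne (subset_antisymm hAC h)
    obtain ⟨f, u, hfu, hup⟩ := geometric_hahn_banach_closed_point hAconv hAk.isClosed hpA
    obtain ⟨q, hqC, hq⟩ := hC.exists_isMaxOn ⟨p, hpC⟩ f.continuous.continuousOn
    have hqmax : ∀ x ∈ C, f x ≤ f q := fun x hx => hq hx
    have hum : u < f q := hup.trans_le (hqmax p hpC)
    set δ : ℝ := min 1 (ε / (8 * (R + 1))) with hδ
    have hδ0 : 0 < δ := lt_min one_pos (by positivity)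
    have hδ1 : δ ≤ 1 := min_le_left _ _
    have hδ2 : δ * (2 * R) ≤ ε / 4 := by
      calc δ * (2 * R) ≤ (ε / (8 * (R + 1))) * (2 * (R + 1)) := by
            gcongr
            · exact min_le_right _ _
            · linarith
        _ = ε / 4 := by field_simp; norm_num
    refine ⟨f, f q - δ * (f q - u), ⟨q, hqC, ?_⟩, ?_, ?_⟩
    · have : 0 < δ * (f q - u) := mul_pos hδ0 (sub_pos.2 hum)
      simp only [mem_ofPred_eq]; linarith
    · rintro x ⟨hxC, hx⟩
      by_contra hxl
      have hxA : x ∈ A := hLA ⟨hxC, show l x ≤ c from not_lt.1 hxl⟩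
      have h1 := hfu x hxA
      simp only [mem_ofPred_eq] at hx
      nlinarith [mul_nonneg (sub_nonneg.2 hδ1) (sub_pos.2 hum).le]
    · have key : ∀ x ∈ C ∩ {x | f q - δ * (f q - u) < f x}, ‖T x - z n‖ ≤ ε / 2 := by
        rintro x ⟨hxC, hx⟩
        obtain ⟨a1, ha1, a2, ha2, hseg⟩ := mem_convexJoin.1 (hcov x hxC hAn)
        obtain ⟨s, t, hs, ht, hst, rfl⟩ := hseg
        simp only [mem_ofPred_eq, map_add, map_smul, smul_eq_mul] at hx
        have h1 := hfu a1 ha1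
        have h2 := hqmax a2 ha2.1
        have hsδ : s ≤ δ := by
          have ht' : t = 1 - s := by linarith
          subst ht'
          have h3 : s * f a1 ≤ s * u := by gcongr
          have h4 : (1 - s) * f a2 ≤ (1 - s) * f q := by gcongr
          have h5 : s * (f q - u) < δ * (f q - u) := by nlinarith
          exact (lt_of_mul_lt_mul_right h5 (sub_pos.2 hum).le).le
        have hTx : T (s • a1 + t • a2) - z n = s • (T a1 - T a2) + (T a2 - z n) := by
          rw [hT a1 (hAC ha1) a2 ha2.1 s t hs ht hst]
          have ht' : t = 1 - s := by linarith
          subst ht'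
          rw [sub_smul, one_smul, smul_sub]
          abel
        rw [hTx]
        calc ‖s • (T a1 - T a2) + (T a2 - z n)‖ ≤ s * ‖T a1 - T a2‖ + ‖T a2 - z n‖ := by
              refine (norm_add_le _ _).trans ?_
              rw [norm_smul, Real.norm_of_nonneg hs]
          _ ≤ δ * (2 * R) + ε / 8 := by
              have h6 : ‖T a1 - T a2‖ ≤ 2 * R := by
                refine (norm_sub_le _ _).trans ?_
                linarith [hTb a1 (hAC ha1), hTb a2 ha2.1]
              have h7 : ‖T a2 - z n‖ ≤ ε / 8 := ha2.2
              gcongr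
          _ ≤ ε / 2 := by linarith
      intro x hx y hy
      calc ‖T x - T y‖ = ‖(T x - z n) - (T y - z n)‖ := by congr 1; abel
        _ ≤ ‖T x - z n‖ + ‖T y - z n‖ := norm_sub_le _ _
        _ ≤ ε := by linarith [key x hx, key y hy]
  · rw [not_nonempty_iff_eq_empty] at hAn
    have hCB : C ⊆ B := by
      rw [← hDL]
      refine closedConvexHull_min ?_ hBconv hBk.isClosed
      rintro y (hy | hy)
      · by_cases hyW : y ∈ W
        · exact hDWB ⟨hy, hyW⟩
        · have hyA : y ∈ A := subset_closedConvexHull (Or.inl ⟨hy, hyW⟩)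
          rw [hAn] at hyA
          exact absurd hyA (notMem_empty y)
      · exact absurd (hLA hy) (by rw [hAn]; exact notMem_empty y)
    refine ⟨l, c, ⟨x0, hx0C, hx0⟩, inter_subset_right, ?_⟩
    intro x hx y hy
    have h1 : ‖T x - z n‖ ≤ ε / 8 := (hCB hx.1).2
    have h2 : ‖T y - z n‖ ≤ ε / 8 := (hCB hy.1).2
    calc ‖T x - T y‖ = ‖(T x - z n) - (T y - z n)‖ := by congr 1; abel
      _ ≤ ‖T x - z n‖ + ‖T y - z n‖ := norm_sub_le _ _
      _ ≤ ε := by linarith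

/-- `g` respects binary convex combinations of points of `P`. -/
def AffineOn {E F : Type*} [AddCommGroup E] [Module ℝ E] [AddCommGroup F] [Module ℝ F]
    (P : Set E) (g : E → F) : Prop :=
  ∀ x ∈ P, ∀ y ∈ P, ∀ s t : ℝ, 0 ≤ s → 0 ≤ t → s + t = 1 →
    g (s • x + t • y) = s • g x + t • g y

theorem AffineOn.sub_eq {E F : Type*} [AddCommGroup E] [Module ℝ E] [AddCommGroup F] [Module ℝ F]
    {P : Set E} {g : E → F} (hg : AffineOn P g) {x y u v : E} (hx : x ∈ P) (hy : y ∈ P)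
    (hu : u ∈ P) (hv : v ∈ P) {s : ℝ} (hs : 0 ≤ s) (h : x - y = s • (u - v)) :
    g x - g y = s • (g u - g v) := by
  have h1 : (0 : ℝ) < 1 + s := by linarith
  have e1 : (1 / (1 + s)) • x + (s / (1 + s)) • v = (1 / (1 + s)) • y + (s / (1 + s)) • u := by
    have : x = y + s • (u - v) := by rw [← h]; abel
    rw [this]
    simp only [smul_add, smul_sub, smul_smul, div_eq_inv_mul, mul_one]
    abel
  have e2 := congrArg g e1
  have hst : 1 / (1 + s) + s / (1 + s) = 1 := by field_simp
  rw [hg x hx v hv _ _ (by positivity) (by positivity) hst,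
    hg y hy u hu _ _ (by positivity) (by positivity) hst] at e2
  have e3 := congrArg (fun z => (1 + s) • z) e2
  simp only [smul_add, smul_smul] at e3
  have a1 : (1 + s) * (1 / (1 + s)) = 1 := by field_simp
  have a2 : (1 + s) * (s / (1 + s)) = s := by field_simp
  rw [a1, a2, one_smul, one_smul] at e3
  rw [smul_sub, sub_eq_sub_iff_add_eq_add, e3]
  abel

section

variable {E : Type*} [NormedAddCommGroup E] [NormedSpace ℝ E] [CompleteSpace E]

theorem IsCompact.integrable_of_mem {P : Set E} (hP : IsCompact P) {ρ : Measure ℝ}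
    [IsFiniteMeasure ρ] {h : ℝ → E} (hm : AEStronglyMeasurable h ρ) (hh : ∀ r, h r ∈ P) :
    Integrable h ρ := by
  obtain ⟨R, hR⟩ := hP.isBounded.exists_norm_le
  exact Integrable.of_bound hm R (Eventually.of_forall fun r => hR _ (hh r))

/-- A continuous affine map on a compact convex set commutes with averages. -/
theorem AffineOn.map_integral {F : Type*} [NormedAddCommGroup F] [NormedSpace ℝ F]
    [CompleteSpace F] {P : Set E} (hP : IsCompact P) (hPc : Convex ℝ P) {g : E → F}
    (hg : AffineOn P g) (hgc : ContinuousOn g P) {ρ : Measure ℝ} [IsProbabilityMeasure ρ]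
    {h : ℝ → E} (hm : StronglyMeasurable h) (hh : ∀ r, h r ∈ P) :
    g (∫ r, h r ∂ρ) = ∫ r, g (h r) ∂ρ ∧ StronglyMeasurable fun r => g (h r) := by
  have h_int := hP.integrable_of_mem (ρ := ρ) hm.aestronglyMeasurable hh
  have hgm : StronglyMeasurable fun r => g (h r) := by
    have h1 : StronglyMeasurable (fun r => (⟨h r, hh r⟩ : P)) := by
      have hsep : TopologicalSpace.IsSeparable (range (fun r => (⟨h r, hh r⟩ : P))) := by
        have : CompactSpace P := isCompact_iff_compactSpace.1 hP
        exact (TopologicalSpace.IsSeparable.of_separableSpace _)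
      borelize E
      refine stronglyMeasurable_iff_measurable_separable.2 ⟨?_, hsep⟩
      exact hm.measurable.subtype_mk
    exact (continuousOn_iff_continuous_restrict.1 hgc).comp_stronglyMeasurable h1
  refine ⟨?_, hgm⟩
  have hcomp : IsCompact (g '' P) := hP.image_of_continuousOn hgc
  have hgint : Integrable (fun r => g (h r)) ρ :=  by
    obtain ⟨R, hR⟩ := hcomp.isBounded.exists_norm_le
    exact Integrable.of_bound hgm.aestronglyMeasurable R
      (Eventually.of_forall fun r => hR _ (mem_image_of_mem _ (hh r)))
  have key : ∀ f : StrongDual ℝ F, f (g (∫ r, h r ∂ρ)) ≤ f (∫ r, g (h r) ∂ρ) := by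
    intro f
    rw [← ContinuousLinearMap.integral_comp_comm f hgint]
    refine ConvexOn.map_integral_le (g := fun x => f (g x)) (s := P) ⟨hPc, ?_⟩
      (f.continuous.comp_continuousOn hgc) hP.isClosed (Eventually.of_forall hh) h_int
      (f.integrable_comp hgint)
    intro x hx y hy s t hs ht hst
    simp only
    rw [hg x hx y hy s t hs ht hst, map_add, map_smul, map_smul]
  refine (SeparatingDual.eq_iff_forall_dual_eq (R := ℝ)).2 fun f => le_antisymm (key f) ?_
  have := key (-f)
  simpa using this

/-- For an affine continuous self-map of a compact convex set, `σ = ½ν + ½ g σ` is solvable. -/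
theorem exists_half_fixedPoint {P : Set E} (hP : IsCompact P) (hPc : Convex ℝ P) {g : E → E}
    (hg : AffineOn P g) (hgc : ContinuousOn g P) (hgP : ∀ x ∈ P, g x ∈ P) {ν : E} (hν : ν ∈ P) :
    ∃ σ ∈ P, σ = (1 / 2 : ℝ) • ν + (1 / 2 : ℝ) • g σ := by
  set Φ : E → E := fun x => (1 / 2 : ℝ) • ν + (1 / 2 : ℝ) • g x with hΦ
  have hΦP : ∀ x ∈ P, Φ x ∈ P := fun x hx =>
    hPc hν (hgP x hx) (by norm_num) (by norm_num) (by norm_num)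
  set x : ℕ → E := fun n => Φ^[n] ν with hx
  have hxP : ∀ n, x n ∈ P := by
    intro n
    induction n with
    | zero => exact hν
    | succ n ih => simp only [hx, Function.iterate_succ_apply']; exact hΦP _ ih
  have hstep : ∀ n, x (n + 1) = Φ (x n) := fun n => Function.iterate_succ_apply' Φ n ν
  obtain ⟨R, hR⟩ := hP.isBounded.exists_norm_le
  have hdiff : ∀ n : ℕ, ∃ u ∈ P, ∃ v ∈ P, x (n + 1) - x n = ((1 / 2 : ℝ) ^ n) • (u - v) := by
    intro n
    induction n with
    | zero => exact ⟨x 1, hxP 1, x 0, hxP 0, by simp⟩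
    | succ n ih =>
      obtain ⟨u, hu, v, hv, huv⟩ := ih
      refine ⟨g u, hgP u hu, g v, hgP v hv, ?_⟩
      have := hg.sub_eq (hxP (n + 1)) (hxP n) hu hv (by positivity) huv
      have e : x (n + 1 + 1) - x (n + 1) = (1 / 2 : ℝ) • (g (x (n + 1)) - g (x n)) := by
        rw [smul_sub, ← add_sub_add_left_eq_sub ((1 / 2 : ℝ) • g (x (n + 1)))
          ((1 / 2 : ℝ) • g (x n)) ((1 / 2 : ℝ) • ν)]
        exact congrArg₂ _ (hstep (n + 1)) (hstep n)
      rw [e, this, smul_smul, pow_succ, mul_comm]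
  have hcau : CauchySeq x := by
    refine cauchySeq_of_le_geometric (1 / 2) (2 * R) (by norm_num) fun n => ?_
    obtain ⟨u, hu, v, hv, huv⟩ := hdiff n
    rw [dist_comm, dist_eq_norm, huv, norm_smul, norm_pow, mul_comm, Real.norm_of_nonneg (by norm_num)]
    gcongr
    refine (norm_sub_le _ _).trans ?_
    linarith [hR u hu, hR v hv]
  obtain ⟨σ, hσ⟩ := cauchySeq_tendsto_of_complete hcau
  have hσP : σ ∈ P := hP.isClosed.mem_of_tendsto hσ (Eventually.of_forall hxP)
  refine ⟨σ, hσP, ?_⟩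
  have h1 : Tendsto (fun n => g (x n)) atTop (𝓝 (g σ)) :=
    (hgc σ hσP).tendsto.comp (tendsto_nhdsWithin_iff.2 ⟨hσ, Eventually.of_forall hxP⟩)
  have h2 : Tendsto (fun n => x (n + 1)) atTop (𝓝 ((1 / 2 : ℝ) • ν + (1 / 2 : ℝ) • g σ)) := by
    have := (h1.const_smul (1 / 2 : ℝ)).const_add ((1 / 2 : ℝ) • ν)
    refine this.congr fun n => ?_
    rw [hstep n]
  exact tendsto_nhds_unique ((tendsto_add_atTop_iff_nat 1).2 hσ) h2

theorem half_fixedPoint_unique {P : Set E} (hP : IsCompact P) {g : E → E}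
    (hg : AffineOn P g) (hgP : ∀ x ∈ P, g x ∈ P) {ν σ σ' : E} (hσ : σ ∈ P) (hσ' : σ' ∈ P)
    (h : σ = (1 / 2 : ℝ) • ν + (1 / 2 : ℝ) • g σ)
    (h' : σ' = (1 / 2 : ℝ) • ν + (1 / 2 : ℝ) • g σ') : σ = σ' := by
  obtain ⟨R, hR⟩ := hP.isBounded.exists_norm_le
  have hd : ∀ n : ℕ, ∃ u ∈ P, ∃ v ∈ P, σ - σ' = ((1 / 2 : ℝ) ^ n) • (u - v) := by
    intro n
    induction n with
    | zero => exact ⟨σ, hσ, σ', hσ', by simp⟩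
    | succ n ih =>
      obtain ⟨u, hu, v, hv, huv⟩ := ih
      refine ⟨g u, hgP u hu, g v, hgP v hv, ?_⟩
      have := hg.sub_eq hσ hσ' hu hv (by positivity) huv
      nth_rewrite 1 [h, h']
      rw [add_sub_add_left_eq_sub, ← smul_sub, this, smul_smul, pow_succ, mul_comm]
  have hle : ∀ n : ℕ, ‖σ - σ'‖ ≤ (1 / 2 : ℝ) ^ n * (2 * R) := by
    intro n
    obtain ⟨u, hu, v, hv, huv⟩ := hd n
    rw [huv, norm_smul, norm_pow, Real.norm_of_nonneg (by norm_num : (0 : ℝ) ≤ 1 / 2)]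
    gcongr
    refine (norm_sub_le _ _).trans ?_
    linarith [hR u hu, hR v hv]
  have hlim : Tendsto (fun n : ℕ => (1 / 2 : ℝ) ^ n * (2 * R)) atTop (𝓝 0) := by
    simpa using (tendsto_pow_atTop_nhds_zero_of_lt_one (by norm_num : (0 : ℝ) ≤ 1 / 2)
      (by norm_num)).mul_const (2 * R)
  have : ‖σ - σ'‖ ≤ 0 := ge_of_tendsto hlim (Eventually.of_forall hle)
  exact sub_eq_zero.1 (norm_le_zero_iff.1 this)

end

/-- A family of biaffine products on a compact convex set, indexed by cut times, satisfying the
algebraic rules of concatenation. -/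
structure CutAlgebra {E : Type*} [NormedAddCommGroup E] [NormedSpace ℝ E]
    (P : Set E) (c : ℝ → E → E → E) : Prop where
  compact : IsCompact P
  convex : Convex ℝ P
  nonempty : P.Nonempty
  mem : ∀ r, ∀ x ∈ P, ∀ y ∈ P, c r x y ∈ P
  affine_left : ∀ r, ∀ y ∈ P, AffineOn P fun x => c r x y
  affine_right : ∀ r, ∀ x ∈ P, AffineOn P fun y => c r x y
  cont_left : ∀ r, ∀ y ∈ P, ContinuousOn (fun x => c r x y) P
  cont_right : ∀ r, ∀ x ∈ P, ContinuousOn (fun y => c r x y) P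
  meas : ∀ x ∈ P, ∀ y ∈ P, StronglyMeasurable fun r => c r x y
  assoc : ∀ r r', r < r' → ∀ x ∈ P, ∀ y ∈ P, ∀ z ∈ P, c r' (c r x y) z = c r x (c r' y z)
  absorb_left : ∀ r r', r' < r → ∀ x ∈ P, ∀ y ∈ P, ∀ z ∈ P, c r' (c r x y) z = c r' x z
  absorb_right : ∀ r r', r < r' → ∀ x ∈ P, ∀ y ∈ P, ∀ z ∈ P, c r' x (c r y z) = c r' x z

namespace CutAlgebra

variable {E : Type*} [NormedAddCommGroup E] [NormedSpace ℝ E] [CompleteSpace E]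
  {P : Set E} {c : ℝ → E → E → E}

/-- The product averaged over the cut time. -/
noncomputable def avg (c : ℝ → E → E → E) (ρ : Measure ℝ) (x y : E) : E := ∫ r, c r x y ∂ρ

theorem integrable (h : CutAlgebra P c) (ρ : Measure ℝ) [IsFiniteMeasure ρ] {x y : E} (hx : x ∈ P)
    (hy : y ∈ P) : Integrable (fun r => c r x y) ρ := by
  obtain ⟨R, hR⟩ := h.compact.isBounded.exists_norm_le
  exact Integrable.of_bound (h.meas x hx y hy).aestronglyMeasurable R
    (Eventually.of_forall fun r => hR _ (h.mem r x hx y hy))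

theorem avg_mem (h : CutAlgebra P c) (ρ : Measure ℝ) [IsProbabilityMeasure ρ] {D : Set E}
    (hDP : D ⊆ P) (hDc : Convex ℝ D) (hDcl : IsClosed D)
    (hD : ∀ r, ∀ x ∈ D, ∀ y ∈ D, c r x y ∈ D) {x y : E} (hx : x ∈ D)
    (hy : y ∈ D) : avg c ρ x y ∈ D :=
  hDc.integral_mem hDcl (Eventually.of_forall fun r => hD r x hx y hy)
    (h.integrable ρ (hDP hx) (hDP hy))

theorem avg_affine_left (h : CutAlgebra P c) (ρ : Measure ℝ) [IsFiniteMeasure ρ] {y : E}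
    (hy : y ∈ P) : AffineOn P fun x => avg c ρ x y := by
  intro x hx x' hx' s t hs ht hst
  simp only [avg]
  rw [← integral_smul, ← integral_smul, ← integral_add]
  · exact integral_congr_ae (Eventually.of_forall fun r =>
      h.affine_left r y hy x hx x' hx' s t hs ht hst)
  · exact (h.integrable ρ hx hy).smul s
  · exact (h.integrable ρ hx' hy).smul t

theorem avg_affine_right (h : CutAlgebra P c) (ρ : Measure ℝ) [IsFiniteMeasure ρ] {x : E}
    (hx : x ∈ P) : AffineOn P fun y => avg c ρ x y := by
  intro y hy y' hy' s t hs ht hst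
  simp only [avg]
  rw [← integral_smul, ← integral_smul, ← integral_add]
  · exact integral_congr_ae (Eventually.of_forall fun r =>
      h.affine_right r x hx y hy y' hy' s t hs ht hst)
  · exact (h.integrable ρ hx hy).smul s
  · exact (h.integrable ρ hx hy').smul t

theorem avg_cont_left (h : CutAlgebra P c) (ρ : Measure ℝ) [IsFiniteMeasure ρ] {y : E}
    (hy : y ∈ P) : ContinuousOn (fun x => avg c ρ x y) P := by
  obtain ⟨R, hR⟩ := h.compact.isBounded.exists_norm_le
  intro x hx
  refine tendsto_integral_filter_of_dominated_convergence (fun _ => R) ?_ ?_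
    (integrable_const R) ?_
  · filter_upwards [self_mem_nhdsWithin] with x' hx'
    exact (h.meas x' hx' y hy).aestronglyMeasurable
  · filter_upwards [self_mem_nhdsWithin] with x' hx'
    exact Eventually.of_forall fun r => hR _ (h.mem r x' hx' y hy)
  · exact Eventually.of_forall fun r => h.cont_left r y hy x hx

theorem avg_cont_right (h : CutAlgebra P c) (ρ : Measure ℝ) [IsFiniteMeasure ρ] {x : E}
    (hx : x ∈ P) : ContinuousOn (fun y => avg c ρ x y) P := by
  obtain ⟨R, hR⟩ := h.compact.isBounded.exists_norm_le
  intro y hy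
  refine tendsto_integral_filter_of_dominated_convergence (fun _ => R) ?_ ?_
    (integrable_const R) ?_
  · filter_upwards [self_mem_nhdsWithin] with y' hy'
    exact (h.meas x hx y' hy').aestronglyMeasurable
  · filter_upwards [self_mem_nhdsWithin] with y' hy'
    exact Eventually.of_forall fun r => hR _ (h.mem r x hx y' hy')
  · exact Eventually.of_forall fun r => h.cont_right r x hx y hy

theorem exists_smoothing (h : CutAlgebra P c) (ρ : Measure ℝ) [IsProbabilityMeasure ρ] :
    ∃ S : E → E, ∀ ν ∈ P, S ν ∈ P ∧ S ν = (1 / 2 : ℝ) • ν + (1 / 2 : ℝ) • avg c ρ ν (S ν) := by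
  choose! S hS using fun (ν : E) (hν : ν ∈ P) =>
    exists_half_fixedPoint h.compact h.convex (h.avg_affine_right ρ hν) (h.avg_cont_right ρ hν)
      (fun x hx => h.avg_mem ρ subset_rfl h.convex h.compact.isClosed h.mem hν hx) hν
  exact ⟨S, hS⟩

/-- The random-cut smoothing: the unique solution `σ` of `σ = ½ν + ½ avg ν σ`. -/
noncomputable def smoothing (h : CutAlgebra P c) (ρ : Measure ℝ) [IsProbabilityMeasure ρ] : E → E :=
  (h.exists_smoothing ρ).choose

theorem smoothing_mem (h : CutAlgebra P c) (ρ : Measure ℝ) [IsProbabilityMeasure ρ] {ν : E}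
    (hν : ν ∈ P) : h.smoothing ρ ν ∈ P := ((h.exists_smoothing ρ).choose_spec ν hν).1

theorem smoothing_eq (h : CutAlgebra P c) (ρ : Measure ℝ) [IsProbabilityMeasure ρ] {ν : E}
    (hν : ν ∈ P) : h.smoothing ρ ν =
      (1 / 2 : ℝ) • ν + (1 / 2 : ℝ) • avg c ρ ν (h.smoothing ρ ν) :=
  ((h.exists_smoothing ρ).choose_spec ν hν).2

theorem smoothing_unique (h : CutAlgebra P c) (ρ : Measure ℝ) [IsProbabilityMeasure ρ] {ν σ : E}
    (hν : ν ∈ P) (hσ : σ ∈ P) (he : σ = (1 / 2 : ℝ) • ν + (1 / 2 : ℝ) • avg c ρ ν σ) :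
    h.smoothing ρ ν = σ :=
  half_fixedPoint_unique h.compact (h.avg_affine_right ρ hν)
    (fun _ hx => h.avg_mem ρ subset_rfl h.convex h.compact.isClosed h.mem hν hx)
    (h.smoothing_mem ρ hν) hσ (h.smoothing_eq ρ hν) he

theorem smoothing_mem_of_closed (h : CutAlgebra P c) (ρ : Measure ℝ) [IsProbabilityMeasure ρ]
    {D : Set E} (hDP : D ⊆ P) (hDc : Convex ℝ D) (hDcl : IsClosed D)
    (hD : ∀ r, ∀ x ∈ D, ∀ y ∈ D, c r x y ∈ D) {ν : E} (hν : ν ∈ D) :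
    h.smoothing ρ ν ∈ D := by
  have hDk : IsCompact D := h.compact.of_isClosed_subset hDcl hDP
  obtain ⟨σ, hσ, he⟩ := exists_half_fixedPoint hDk hDc (g := fun y => avg c ρ ν y)
    (fun x hx y hy => h.avg_affine_right ρ (hDP hν) x (hDP hx) y (hDP hy))
    ((h.avg_cont_right ρ (hDP hν)).mono hDP)
    (fun x hx => h.avg_mem ρ hDP hDc hDcl hD hν hx) hν
  rw [h.smoothing_unique ρ (hDP hν) (hDP hσ) he]
  exact hσ

/-- The smoothing is multiplicative for all the sharp products. -/
theorem smoothing_mul (h : CutAlgebra P c) (ρ : Measure ℝ) [IsProbabilityMeasure ρ]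
    [NullSingletonClass ρ] (r' : ℝ) {ν ν' : E} (hν : ν ∈ P) (hν' : ν' ∈ P) :
    h.smoothing ρ (c r' ν ν') = c r' (h.smoothing ρ ν) (h.smoothing ρ ν') := by
  set σ := h.smoothing ρ ν with hσdef
  set σ' := h.smoothing ρ ν' with hσ'def
  have hσ : σ ∈ P := h.smoothing_mem ρ hν
  have hσ' : σ' ∈ P := h.smoothing_mem ρ hν'
  have hσσ' := h.mem r' σ hσ σ' hσ'
  have hνν' := h.mem r' ν hν ν' hν'
  refine h.smoothing_unique ρ hνν' hσσ' ?_
  have hlt : MeasurableSet (Iio r') := measurableSet_Iio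
  have hcompl : ρ.restrict (Iio r')ᶜ = ρ.restrict (Ioi r') := by
    rw [compl_Iio]
    exact Measure.restrict_congr_set Ioi_ae_eq_Ici.symm
  -- split an average at the time `r'`
  have hsplit : ∀ f : ℝ → E, Integrable f ρ →
      ∫ r, f r ∂ρ = (∫ r in Iio r', f r ∂ρ) + ∫ r in Ioi r', f r ∂ρ := by
    intro f hf
    rw [← hcompl, integral_add_compl hlt hf]
  set p : ℝ := ρ.real (Iio r') with hp
  set q : ℝ := ρ.real (Ioi r') with hq
  have hpq : p + q = 1 := by
    have h1 : ρ.real (Iio r') + ρ.real (Iio r')ᶜ = 1 := probReal_add_probReal_compl hlt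
    have h2 : ρ.real (Iio r')ᶜ = ρ.real (Ioi r') := by
      rw [compl_Iio]
      exact measureReal_congr Ioi_ae_eq_Ici.symm
    rw [hp, hq, ← h2, h1]
  have e1 : avg c ρ (c r' ν ν') (c r' σ σ') =
      (∫ r in Iio r', c r' (c r ν σ) σ' ∂ρ) + ∫ r in Ioi r', c r' ν (c r ν' σ') ∂ρ := by
    rw [avg, hsplit _ (h.integrable ρ hνν' hσσ')]
    congr 1
    · refine setIntegral_congr_fun hlt fun r hr => ?_
      rw [h.absorb_left r' r hr ν hν ν' hν' _ hσσ', h.assoc r r' hr ν hν σ hσ σ' hσ']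
    · refine setIntegral_congr_fun measurableSet_Ioi fun r hr => ?_
      rw [h.absorb_right r' r hr _ hνν' σ hσ σ' hσ', h.assoc r' r hr ν hν ν' hν' σ' hσ']
  have e2 : c r' σ σ' = (1 / 2 : ℝ) • c r' ν σ' +
      (1 / 2 : ℝ) • ((∫ r in Iio r', c r' (c r ν σ) σ' ∂ρ) + q • c r' ν σ') := by
    have a1 : c r' σ σ' = (1 / 2 : ℝ) • c r' ν σ' + (1 / 2 : ℝ) • c r' (avg c ρ ν σ) σ' := by
      have := h.affine_left r' σ' hσ' ν hν (avg c ρ ν σ)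
        (h.avg_mem ρ subset_rfl h.convex h.compact.isClosed h.mem hν hσ) (1 / 2) (1 / 2)
        (by norm_num) (by norm_num) (by norm_num)
      rw [← h.smoothing_eq ρ hν] at this
      exact this
    have a2 := (AffineOn.map_integral h.compact h.convex (h.affine_left r' σ' hσ')
      (h.cont_left r' σ' hσ') (ρ := ρ) (h.meas ν hν σ hσ) (fun r => h.mem r ν hν σ hσ))
    have a3 : Integrable (fun r => c r' (c r ν σ) σ') ρ :=
      h.compact.integrable_of_mem a2.2.aestronglyMeasurable
        fun r => h.mem r' _ (h.mem r ν hν σ hσ) σ' hσ'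
    have a4 : ∫ r in Ioi r', c r' (c r ν σ) σ' ∂ρ = q • c r' ν σ' := by
      rw [← setIntegral_const]
      exact setIntegral_congr_fun measurableSet_Ioi fun r hr =>
        h.absorb_left r r' hr ν hν σ hσ σ' hσ'
    rw [a1, avg, a2.1, hsplit _ a3, a4]
  have e3 : c r' ν σ' = (1 / 2 : ℝ) • c r' ν ν' +
      (1 / 2 : ℝ) • (p • c r' ν σ' + ∫ r in Ioi r', c r' ν (c r ν' σ') ∂ρ) := by
    have a1 : c r' ν σ' = (1 / 2 : ℝ) • c r' ν ν' + (1 / 2 : ℝ) • c r' ν (avg c ρ ν' σ') := by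
      have := h.affine_right r' ν hν ν' hν' (avg c ρ ν' σ')
        (h.avg_mem ρ subset_rfl h.convex h.compact.isClosed h.mem hν' hσ') (1 / 2) (1 / 2)
        (by norm_num) (by norm_num) (by norm_num)
      rw [← h.smoothing_eq ρ hν'] at this
      exact this
    have a2 := (AffineOn.map_integral h.compact h.convex (h.affine_right r' ν hν)
      (h.cont_right r' ν hν) (ρ := ρ) (h.meas ν' hν' σ' hσ') (fun r => h.mem r ν' hν' σ' hσ'))
    have a3 : Integrable (fun r => c r' ν (c r ν' σ')) ρ :=
      h.compact.integrable_of_mem a2.2.aestronglyMeasurable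
        fun r => h.mem r' ν hν _ (h.mem r ν' hν' σ' hσ')
    have a4 : ∫ r in Iio r', c r' ν (c r ν' σ') ∂ρ = p • c r' ν σ' := by
      rw [← setIntegral_const]
      exact setIntegral_congr_fun hlt fun r hr =>
        h.absorb_right r r' hr ν hν ν' hν' σ' hσ'
    nth_rewrite 1 [a1]
    rw [avg, a2.1, hsplit _ a3, a4]
  rw [e1, smul_add]
  have hq' : q = 1 - p := by linarith
  have f2 : (1 / 2 : ℝ) • (∫ r in Iio r', c r' (c r ν σ) σ' ∂ρ) =
      c r' σ σ' - (1 / 2 : ℝ) • c r' ν σ' - (1 / 2 : ℝ) • (q • c r' ν σ') := by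
    nth_rewrite 1 [e2]
    rw [smul_add]
    abel
  have f3 : (1 / 2 : ℝ) • (∫ r in Ioi r', c r' ν (c r ν' σ') ∂ρ) =
      c r' ν σ' - (1 / 2 : ℝ) • c r' ν ν' - (1 / 2 : ℝ) • (p • c r' ν σ') := by
    nth_rewrite 1 [e3]
    rw [smul_add]
    abel
  rw [f2, f3, hq']
  module

end CutAlgebra

namespace CutAlgebra

variable {E : Type*} [NormedAddCommGroup E] [NormedSpace ℝ E] [CompleteSpace E]
  {P : Set E} {c : ℝ → E → E → E}

/-- Nonempty closed convex subsets stable under all the sharp products. -/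
structure IsStableConvex (P : Set E) (c : ℝ → E → E → E) (D : Set E) : Prop where
  nonempty : D.Nonempty
  subset : D ⊆ P
  convex : Convex ℝ D
  closed : IsClosed D
  mul_mem : ∀ r, ∀ x ∈ D, ∀ y ∈ D, c r x y ∈ D

theorem exists_minimal_stable (h : CutAlgebra P c) :
    ∃ D, Minimal (IsStableConvex P c) D := by
  obtain ⟨D, -, hD⟩ := zorn_superset_nonempty {D | IsStableConvex P c D} (by
    intro C hC hchain hne
    have hdir : DirectedOn (fun x1 x2 : Set E => x1 ⊇ x2) C := by
      intro x hx y hy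
      rcases hchain.total hx hy with h | h
      · exact ⟨x, hx, subset_rfl, h⟩
      · exact ⟨y, hy, h, subset_rfl⟩
    obtain ⟨d0, hd0⟩ := hne
    have : Nonempty C := ⟨⟨d0, hd0⟩⟩
    refine ⟨⋂₀ C, ⟨?_, ?_, ?_, ?_, ?_⟩, fun s hs => sInter_subset_of_mem hs⟩
    · exact IsCompact.nonempty_sInter_of_directed_nonempty_isCompact_isClosed hdir
        (fun U hU => (hC hU).nonempty)
        (fun U hU => h.compact.of_isClosed_subset (hC hU).closed (hC hU).subset)
        (fun U hU => (hC hU).closed)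
    · exact (sInter_subset_of_mem hd0).trans (hC hd0).subset
    · exact convex_sInter fun s hs => (hC hs).convex
    · exact isClosed_sInter fun s hs => (hC hs).closed
    · intro r x hx y hy s hs
      exact (hC hs).mul_mem r x (hx s hs) y (hy s hs)) P
    ⟨h.nonempty, subset_rfl, h.convex, h.compact.isClosed, h.mem⟩
  exact ⟨D, hD⟩

/-- On a minimal stable set, the smoothed points have the whole set as closed convex hull. -/
theorem closedConvexHull_smoothing (h : CutAlgebra P c) (ρ : Measure ℝ) [IsProbabilityMeasure ρ]
    [NullSingletonClass ρ] {D : Set E} (hD : Minimal (IsStableConvex P c) D) :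
    closedConvexHull ℝ (h.smoothing ρ '' D) = D := by
  have hDp := hD.prop
  have hSD : h.smoothing ρ '' D ⊆ D := by
    rintro _ ⟨ν, hν, rfl⟩
    exact h.smoothing_mem_of_closed ρ hDp.subset hDp.convex hDp.closed hDp.mul_mem hν
  set H := closedConvexHull ℝ (h.smoothing ρ '' D) with hH
  have hHD : H ⊆ D := closedConvexHull_min hSD hDp.convex hDp.closed
  have hHP : H ⊆ P := hHD.trans hDp.subset
  have hHcl : IsClosed H := isClosed_closedConvexHull
  have hHc : Convex ℝ H := convex_closedConvexHull
  have hmul0 : ∀ r, ∀ x ∈ h.smoothing ρ '' D, ∀ y ∈ h.smoothing ρ '' D, c r x y ∈ H := by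
    rintro r _ ⟨ν, hν, rfl⟩ _ ⟨ν', hν', rfl⟩
    rw [← h.smoothing_mul ρ r (hDp.subset hν) (hDp.subset hν')]
    exact subset_closedConvexHull (mem_image_of_mem _ (hDp.mul_mem r ν hν ν' hν'))
  have hmul1 : ∀ r, ∀ x ∈ H, ∀ y ∈ h.smoothing ρ '' D, c r x y ∈ H := by
    intro r x hx y hy
    have hyP : y ∈ P := hDp.subset (hSD hy)
    have hcl : IsClosed (H ∩ (fun x => c r x y) ⁻¹' H) :=
      ((h.cont_left r y hyP).mono hHP).preimage_isClosed_of_isClosed hHcl hHcl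
    refine (closedConvexHull_min (t := H ∩ (fun x => c r x y) ⁻¹' H) ?_ ?_ hcl hx).2
    · exact fun x hx => ⟨subset_closedConvexHull hx, hmul0 r x hx y hy⟩
    · rintro x ⟨hx1, hx2⟩ x' ⟨hx1', hx2'⟩ s t hs ht hst
      refine ⟨hHc hx1 hx1' hs ht hst, ?_⟩
      have := h.affine_left r y hyP x (hHP hx1) x' (hHP hx1') s t hs ht hst
      simp only [mem_preimage] at this hx2 hx2' ⊢
      rw [this]
      exact hHc hx2 hx2' hs ht hst
  have hmul2 : ∀ r, ∀ x ∈ H, ∀ y ∈ H, c r x y ∈ H := by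
    intro r x hx y hy
    have hxP : x ∈ P := hHP hx
    have hcl : IsClosed (H ∩ (fun y => c r x y) ⁻¹' H) :=
      ((h.cont_right r x hxP).mono hHP).preimage_isClosed_of_isClosed hHcl hHcl
    refine (closedConvexHull_min (t := H ∩ (fun y => c r x y) ⁻¹' H) ?_ ?_ hcl hy).2
    · exact fun y hy => ⟨subset_closedConvexHull hy, hmul1 r x hx y hy⟩
    · rintro y ⟨hy1, hy2⟩ y' ⟨hy1', hy2'⟩ s t hs ht hst
      refine ⟨hHc hy1 hy1' hs ht hst, ?_⟩
      have := h.affine_right r x hxP y (hHP hy1) y' (hHP hy1') s t hs ht hst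
      simp only [mem_preimage] at this hy2 hy2' ⊢
      rw [this]
      exact hHc hy2 hy2' hs ht hst
  obtain ⟨ν, hν⟩ := hDp.nonempty
  have hHne : H.Nonempty := ⟨_, subset_closedConvexHull (mem_image_of_mem _ hν)⟩
  exact hD.eq_of_subset ⟨hHne, hHP, hHc, hHcl, hmul2⟩ hHD

/-- Every open slice of a minimal stable set contains `ν`, its smoothing `σ` and `avg ν σ`. -/
theorem exists_mem_slice (h : CutAlgebra P c) (ρ : Measure ℝ) [IsProbabilityMeasure ρ]
    [NullSingletonClass ρ] {D : Set E} (hD : Minimal (IsStableConvex P c) D) (l : E →L[ℝ] ℝ) (a : ℝ)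
    (hne : (D ∩ {x | a < l x}).Nonempty) :
    ∃ ν ∈ D ∩ {x | a < l x}, ∃ σ ∈ D ∩ {x | a < l x}, avg c ρ ν σ ∈ D ∩ {x | a < l x} := by
  have hDp := hD.prop
  have hDk : IsCompact D := h.compact.of_isClosed_subset hDp.closed hDp.subset
  obtain ⟨q, hqD, hq⟩ := hDk.exists_isMaxOn hDp.nonempty l.continuous.continuousOn
  have hmax : ∀ x ∈ D, l x ≤ l q := fun x hx => hq hx
  obtain ⟨x0, hx0D, hx0⟩ := hne
  have hqa : a < l q := lt_of_lt_of_le hx0 (hmax x0 hx0D)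
  obtain ⟨ν, hν, hlν⟩ : ∃ ν ∈ D, (a + l q) / 2 < l (h.smoothing ρ ν) := by
    by_contra hcon
    push Not at hcon
    have hsub : closedConvexHull ℝ (h.smoothing ρ '' D) ⊆ {x | l x ≤ (a + l q) / 2} := by
      refine closedConvexHull_min ?_ (convex_halfSpace_le l.toLinearMap.isLinear _)
        (isClosed_le l.continuous continuous_const)
      rintro _ ⟨ν, hν, rfl⟩
      exact hcon ν hν
    rw [h.closedConvexHull_smoothing ρ hD] at hsub
    have : l q ≤ (a + l q) / 2 := hsub hqD
    linarith
  have hσD : h.smoothing ρ ν ∈ D :=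
    h.smoothing_mem_of_closed ρ hDp.subset hDp.convex hDp.closed hDp.mul_mem hν
  have hτD : avg c ρ ν (h.smoothing ρ ν) ∈ D :=
    h.avg_mem ρ hDp.subset hDp.convex hDp.closed hDp.mul_mem hν hσD
  have he := congrArg l (h.smoothing_eq ρ (hDp.subset hν))
  simp only [map_add, map_smul, smul_eq_mul] at he
  have h1 := hmax _ hν
  have h2 := hmax _ hτD
  refine ⟨ν, ⟨hν, ?_⟩, h.smoothing ρ ν, ⟨hσD, ?_⟩, hτD, ?_⟩ <;>
    simp only [mem_ofPred_eq] <;> linarith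

end CutAlgebra

/-- A bounded measurable function with vanishing integrals over all rational intervals vanishes
almost everywhere. -/
theorem ae_eq_zero_of_setIntegral_rat_eq_zero {E : Type*} [NormedAddCommGroup E] [NormedSpace ℝ E]
    [CompleteSpace E] {f : ℝ → E} (hf : StronglyMeasurable f) {R : ℝ} (hR : ∀ r, ‖f r‖ ≤ R)
    (h : ∀ p q : ℚ, p < q → ∫ r in Ioc (p:ℝ) q, f r = 0) : ∀ᵐ r, f r = 0 := by
  have hloc : LocallyIntegrable f := by
    refine (locallyIntegrable_const (μ := volume) (R : ℝ)).mono hf.aestronglyMeasurable ?_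
    exact Eventually.of_forall fun r => (hR r).trans (le_abs_self R)
  have h_int : ∀ p q, IntervalIntegrable f volume p q := fun p q =>
    (hloc.integrableOn_isCompact isCompact_uIcc).intervalIntegrable
  have hcont : Continuous fun x => ∫ r in (0:ℝ)..x, f r :=
    intervalIntegral.continuous_primitive h_int 0
  have hzero : ∀ q : ℚ, ∫ r in (0:ℝ)..q, f r = 0 := by
    intro q
    rcases lt_trichotomy 0 q with hq | hq | hq
    · have := h 0 q hq
      rw [intervalIntegral.integral_of_le (by exact_mod_cast hq.le)]
      simpa using this
    · simp [← hq]
    · have := h q 0 hq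
      rw [intervalIntegral.integral_of_ge (by exact_mod_cast hq.le)]
      simpa using this
  have hall : ∀ x, ∫ r in (0:ℝ)..x, f r = 0 := by
    have : (fun x => ∫ r in (0:ℝ)..x, f r) = fun _ => 0 :=
      Continuous.ext_on Rat.denseRange_cast hcont continuous_const (by
        rintro _ ⟨q, rfl⟩; exact hzero q)
    exact fun x => congrFun this x
  filter_upwards [LocallyIntegrable.ae_hasDerivAt_integral hloc] with r hr
  have h1 := hr 0
  simp only [hall] at h1
  exact h1.unique (hasDerivAt_const r 0)

namespace CutAlgebra

variable {E : Type*} [NormedAddCommGroup E] [NormedSpace ℝ E] [CompleteSpace E]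
  {P : Set E} {c : ℝ → E → E → E}

theorem exists_seq_slices {F : Type*} [NormedAddCommGroup F] [NormedSpace ℝ F]
    {C : Set E} (hC : IsCompact C) (hCc : Convex ℝ C) (hCn : C.Nonempty) (T : ℕ → E → F)
    (hT : ∀ i, AffineOn C (T i))
    (hTs : ∀ i, TopologicalSpace.IsSeparable (T i '' C)) {R : ℝ} (hTb : ∀ i, ∀ x ∈ C, ‖T i x‖ ≤ R)
    (hTc : ∀ i, ∀ z : F, ∀ δ : ℝ, IsClosed (C ∩ {x | ‖T i x - z‖ ≤ δ})) :
    ∃ x ∈ C, ∀ i j, ∀ ε > 0, ∃ (l : E →L[ℝ] ℝ) (a : ℝ), (C ∩ {x | a < l x}).Nonempty ∧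
      ∀ y ∈ C ∩ {x | a < l x}, ‖T i y - T i x‖ ≤ ε ∧ ‖T j y - T j x‖ ≤ ε := by
  let S := {p : (E →L[ℝ] ℝ) × ℝ // (C ∩ {x | p.2 < p.1 x}).Nonempty}
  let O : S → Set E := fun p => C ∩ {x | p.1.2 < p.1.1 x}
  have hstep : ∀ (p : S) (n : ℕ), ∃ p' : S, O p' ⊆ O p ∧
      ∀ x ∈ O p', ∀ y ∈ O p', ‖T n.unpair.1 x - T n.unpair.1 y‖ ≤ 1 / ((n.unpair.2 : ℝ) + 1) := by
    intro p n
    obtain ⟨l', c', h1, h2, h3⟩ := exists_slice_small_oscillation hC hCc (T n.unpair.1)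
      (hT n.unpair.1) (hTs _) (hTb _) (hTc _) p.1.1 p.1.2 p.2 (ε := 1 / ((n.unpair.2 : ℝ) + 1))
      (by positivity)
    exact ⟨⟨(l', c'), h1⟩, fun x hx => ⟨hx.1, h2 hx⟩, h3⟩
  choose g hg1 hg2 using hstep
  let p0 : S := ⟨(0, -1), by obtain ⟨x, hx⟩ := hCn; exact ⟨x, hx, by simp⟩⟩
  let q : ℕ → S := fun n => Nat.rec p0 (fun n p => g p n) n
  have hq : ∀ n, q (n + 1) = g (q n) n := fun n => rfl
  clear_value q
  have hanti : Antitone fun n => O (q n) :=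
    antitone_nat_of_succ_le fun n => by rw [hq]; exact hg1 _ _
  have hcl : ∀ n, closure (O (q n)) ⊆ C := fun n =>
    closure_minimal inter_subset_left hC.isClosed
  obtain ⟨x, hx⟩ : (⋂ n, closure (O (q n))).Nonempty := by
    refine IsCompact.nonempty_iInter_of_sequence_nonempty_isCompact_isClosed _
      (fun n => closure_mono (hanti n.le_succ)) (fun n => (q n).2.closure)
      (hC.of_isClosed_subset isClosed_closure (hcl 0)) (fun n => isClosed_closure)
  rw [mem_iInter] at hx
  have hosc : ∀ i n, ∀ y ∈ O (q (Nat.pair i n + 1)), ‖T i y - T i x‖ ≤ 1 / ((n:ℝ) + 1) := by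
    intro i n y hy
    have hsub : O (q (Nat.pair i n + 1)) ⊆ C ∩ {x | ‖T i x - T i y‖ ≤ 1 / ((n:ℝ) + 1)} := by
      intro z hz
      refine ⟨hz.1, ?_⟩
      rw [hq] at hz hy
      have := hg2 _ _ z hz y hy
      rw [Nat.unpair_pair] at this
      exact this
    have := closure_minimal hsub (hTc i _ _) (hx (Nat.pair i n + 1))
    rw [norm_sub_rev]
    exact this.2
  refine ⟨x, hcl 0 (hx 0), fun i j ε hε => ?_⟩
  obtain ⟨n, hn⟩ := exists_nat_one_div_lt hε
  have hosci := hosc i n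
  have hoscj := hosc j n
  generalize hki : Nat.pair i n + 1 = ki at hosci
  generalize hkj : Nat.pair j n + 1 = kj at hoscj
  refine ⟨(q (max ki kj)).1.1, (q (max ki kj)).1.2, (q (max ki kj)).2, fun y hy => ⟨?_, ?_⟩⟩
  · exact (hosci y (hanti (le_max_left ki kj) hy)).trans hn.le
  · exact (hoscj y (hanti (le_max_right ki kj) hy)).trans hn.le

/-- A cut algebra contains a point which is idempotent for almost every sharp product. -/
theorem exists_ae_idempotent (h : CutAlgebra P c) : ∃ x ∈ P, ∀ᵐ r, c r x x = x := by
  obtain ⟨D, hD⟩ := exists_minimal_stable h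
  have hDp := hD.prop
  have hDk : IsCompact D := h.compact.of_isClosed_subset hDp.closed hDp.subset
  have hPk : CompactSpace P := isCompact_iff_compactSpace.mp h.compact
  have hPne : Nonempty P := h.nonempty.to_subtype
  obtain ⟨R, hR⟩ := h.compact.isBounded.exists_norm_le
  have hR0 : 0 ≤ R := by
    obtain ⟨x, hx⟩ := h.nonempty
    exact (norm_nonneg _).trans (hR x hx)
  let ι := {p : ℚ × ℚ // p.1 < p.2}
  have : Nonempty ι := ⟨⟨(0, 1), by norm_num⟩⟩
  obtain ⟨e, he⟩ := exists_surjective_nat ι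
  let ρ : ℕ → Measure ℝ := fun i => ProbabilityTheory.cond volume (Ioc ((e i).1.1 : ℝ) (e i).1.2)
  have hvol : ∀ i, volume (Ioc ((e i).1.1 : ℝ) (e i).1.2) ≠ 0 := by
    intro i
    have := (e i).2
    simpa [Real.volume_Ioc] using this
  have hρp : ∀ i, IsProbabilityMeasure (ρ i) := fun i =>
    ProbabilityTheory.cond_isProbabilityMeasure_of_finite (hvol i) (by simp [Real.volume_Ioc])
  have hρa : ∀ i, NullSingletonClass (ρ i) := by
    intro i
    constructor
    intro x
    exact ProbabilityTheory.cond_absolutelyContinuous (measure_singleton x)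
  let T : ℕ → E → C(P, E) := fun i x => match i with
    | 0 => ContinuousMap.const P x
    | i + 1 => if hx : x ∈ P then
        ⟨fun y => avg c (ρ i) x y, (h.avg_cont_right (ρ i) hx).restrict⟩ else 0
  have hT0 : ∀ x y, T 0 x y = x := fun x y => rfl
  have hTi : ∀ i x, x ∈ P → ∀ y, T (i + 1) x y = avg c (ρ i) x y := by
    intro i x hx y
    simp only [T, hx, dif_pos]
    rfl
  have hTP : ∀ i, ∀ x ∈ P, ∀ y, T i x y ∈ P := by
    intro i x hx y
    cases i with
    | zero => rwa [hT0]
    | succ i =>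
      rw [hTi _ _ hx]
      exact h.avg_mem (ρ i) subset_rfl h.convex h.compact.isClosed h.mem hx y.2
  have hTaff : ∀ i y, AffineOn P fun x => T i x y := by
    intro i y
    cases i with
    | zero => intro x hx x' hx' s t hs ht hst; simp only [hT0]
    | succ i =>
      intro x hx x' hx' s t hs ht hst
      have := h.avg_affine_left (ρ i) y.2 x hx x' hx' s t hs ht hst
      simp only [hTi _ _ hx, hTi _ _ hx', hTi _ _ (h.convex hx hx' hs ht hst)]
      exact this
  have hTcont : ∀ i y, ContinuousOn (fun x => T i x y) P := by
    intro i y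
    cases i with
    | zero => exact continuousOn_id
    | succ i => exact (h.avg_cont_left (ρ i) y.2).congr fun x hx => hTi _ _ hx _
  obtain ⟨x, hxD, hx⟩ := exists_seq_slices hDk hDp.convex hDp.nonempty T
    (fun i x hx x' hx' s t hs ht hst => by
      ext y
      exact hTaff i y x (hDp.subset hx) x' (hDp.subset hx') s t hs ht hst)
    (fun i => by
      have hc : Continuous fun f : C(P, P) => (ContinuousMap.mk (Subtype.val : P → E)
        continuous_subtype_val).comp f := ContinuousMap.continuous_postcomp _
      refine (TopologicalSpace.isSeparable_range hc).mono ?_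
      rintro _ ⟨x, hx, rfl⟩
      refine ⟨⟨fun y => ⟨T i x y, hTP i x (hDp.subset hx) y⟩, ?_⟩, ?_⟩
      · exact (T i x).continuous.subtype_mk _
      · ext y; rfl)
    (R := R)
    (fun i x hx => (ContinuousMap.norm_le _ hR0).mpr fun y => hR _ (hTP i x (hDp.subset hx) y))
    (fun i z δ => by
      rcases lt_or_ge δ 0 with hδ | hδ
      · convert isClosed_empty
        ext x
        simp only [mem_inter_iff, mem_empty_iff_false, iff_false, not_and]
        intro _ hx
        exact absurd (hx : ‖T i x - z‖ ≤ δ) (not_le.mpr (hδ.trans_le (norm_nonneg _)))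
      · have : D ∩ {x | ‖T i x - z‖ ≤ δ} =
            ⋂ y, D ∩ (fun x => T i x y) ⁻¹' Metric.closedBall (z y) δ := by
          rw [← inter_iInter]
          congr 1
          ext x
          simp only [mem_iInter, mem_preimage, mem_closedBall_iff_norm]
          exact ContinuousMap.norm_le _ hδ
        rw [this]
        exact isClosed_iInter fun y => ((hTcont i y).mono hDp.subset).preimage_isClosed_of_isClosed
          hDp.closed Metric.isClosed_closedBall)
  have hxP := hDp.subset hxD
  have hfix : ∀ i, avg c (ρ i) x x = x := by
    intro i
    have hcw : ContinuousWithinAt (fun y => avg c (ρ i) x y) P x :=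
      h.avg_cont_right (ρ i) hxP x hxP
    by_contra hne
    rw [← sub_eq_zero, ← norm_eq_zero] at hne
    have hpos : 0 < ‖avg c (ρ i) x x - x‖ := lt_of_le_of_ne (norm_nonneg _) (Ne.symm hne)
    set η := ‖avg c (ρ i) x x - x‖ with hη
    rw [Metric.continuousWithinAt_iff] at hcw
    obtain ⟨δ, hδ, hcw⟩ := hcw (η / 4) (by positivity)
    obtain ⟨l, a, hne', hO⟩ := hx 0 (i + 1) (min (δ / 2) (η / 4)) (by positivity)
    obtain ⟨ν, hν, σ, hσ, hνσ⟩ := exists_mem_slice h (ρ i) hD l a hne'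
    have y0 : P := hPne.some
    have hσP := hDp.subset hσ.1
    have e1 : ‖σ - x‖ ≤ min (δ / 2) (η / 4) :=
      (ContinuousMap.norm_coe_le_norm (T 0 σ - T 0 x) y0).trans (hO σ hσ).1
    have e2 : ‖avg c (ρ i) ν σ - x‖ ≤ min (δ / 2) (η / 4) :=
      (ContinuousMap.norm_coe_le_norm (T 0 (avg c (ρ i) ν σ) - T 0 x) y0).trans (hO _ hνσ).1
    have e3 : ‖avg c (ρ i) ν σ - avg c (ρ i) x σ‖ ≤ min (δ / 2) (η / 4) := by
      have := (ContinuousMap.norm_coe_le_norm (T (i+1) ν - T (i+1) x) ⟨σ, hσP⟩).trans (hO _ hν).2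
      rw [ContinuousMap.sub_apply, hTi _ _ (hDp.subset hν.1), hTi _ _ hxP] at this
      exact this
    have e4 : ‖avg c (ρ i) x σ - avg c (ρ i) x x‖ < η / 4 := by
      rw [← dist_eq_norm]
      refine hcw hσP ?_
      rw [dist_eq_norm]
      exact (e1.trans (min_le_left _ _)).trans_lt (by linarith)
    have e5 : avg c (ρ i) x x - x = (avg c (ρ i) ν σ - x) - (avg c (ρ i) ν σ - avg c (ρ i) x σ)
      - (avg c (ρ i) x σ - avg c (ρ i) x x) := by abel
    have e6 := min_le_right (δ / 2) (η / 4)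
    have : η ≤ η / 4 + η / 4 + η / 4 := by
      calc η = ‖(avg c (ρ i) ν σ - x) - (avg c (ρ i) ν σ - avg c (ρ i) x σ)
          - (avg c (ρ i) x σ - avg c (ρ i) x x)‖ := by rw [hη, e5]
        _ ≤ _ := (norm_sub_le _ _).trans (add_le_add ((norm_sub_le _ _).trans
          (add_le_add (e2.trans e6) (e3.trans e6))) e4.le)
    linarith
  refine ⟨x, hxP, ?_⟩
  have hmeas := h.meas x hxP x hxP
  have := ae_eq_zero_of_setIntegral_rat_eq_zero (f := fun r => c r x x - x)
    (hmeas.sub stronglyMeasurable_const) (R := R + R)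
    (fun r => (norm_sub_le _ _).trans (add_le_add (hR _ (h.mem r x hxP x hxP)) (hR _ hxP)))
    (fun p q hpq => by
      obtain ⟨i, hi⟩ := he ⟨(p, q), hpq⟩
      have h1 := hfix i
      have hi1 : ρ i = ProbabilityTheory.cond volume (Ioc (p:ℝ) q) := by
        simp only [ρ, hi]
      have h2 : ∫ r, (c r x x - x) ∂(ρ i) = 0 := by
        rw [integral_sub (h.integrable (ρ i) hxP hxP) (integrable_const _)]
        have : ∫ r, c r x x ∂(ρ i) = x := h1
        simp [this]
      rw [hi1, ProbabilityTheory.cond, integral_smul_measure] at h2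
      rcases smul_eq_zero.mp h2 with h3 | h3
      · exfalso
        have := hpq
        simp only [Real.volume_Ioc, ENNReal.toReal_inv, inv_eq_zero] at h3
        rw [ENNReal.toReal_ofReal (by have : (p:ℝ) < q := by exact_mod_cast hpq
                                      linarith)] at h3
        have : (p:ℝ) < q := by exact_mod_cast hpq
        linarith
      · exact h3)
  filter_upwards [this] with r hr
  exact sub_eq_zero.mp hr

end CutAlgebra

/-- The rules satisfied by the concatenations, at the cut time `r`, of the elements of a compact
space of evolution families. -/
structure CutSystem {K : Type*} [TopologicalSpace K] [MeasurableSpace K]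
    (m : ℝ → K → K → K) : Prop where
  measurable : Measurable fun p : ℝ × K × K => m p.1 p.2.1 p.2.2
  cont_left : ∀ r W, Continuous fun V => m r V W
  cont_right : ∀ r V, Continuous fun W => m r V W
  assoc : ∀ r r', r < r' → ∀ V W Z, m r' (m r V W) Z = m r V (m r' W Z)
  absorb_left : ∀ r r', r' < r → ∀ V W Z, m r' (m r V W) Z = m r' V Z
  absorb_right : ∀ r r', r < r' → ∀ V W Z, m r' V (m r W Z) = m r' V Z
  idem : ∀ r V W, m r (m r V W) (m r V W) = m r V W

namespace CutSystem

variable {K : Type*} [TopologicalSpace K] [CompactSpace K] [TopologicalSpace.MetrizableSpace K]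
  [MeasurableSpace K] [BorelSpace K] {m : ℝ → K → K → K}

theorem measurable_apply (h : CutSystem m) (r : ℝ) : Measurable fun p : K × K => m r p.1 p.2 :=
  h.measurable.comp (measurable_const.prodMk measurable_id)

/-- The product of probability measures induced by the concatenation at `r`. -/
noncomputable def conv (h : CutSystem m) (r : ℝ) (ν ν' : ProbabilityMeasure K) :
    ProbabilityMeasure K :=
  (ν.prod ν').map (h.measurable_apply r).aemeasurable

theorem lintegral_conv (h : CutSystem m) (r : ℝ) (ν ν' : ProbabilityMeasure K) {f : K → ℝ≥0∞}
    (hf : Measurable f) :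
    ∫⁻ x, f x ∂(h.conv r ν ν' : Measure K) =
      ∫⁻ x, ∫⁻ y, f (m r x y) ∂(ν' : Measure K) ∂(ν : Measure K) := by
  rw [conv, ProbabilityMeasure.toMeasure_map, lintegral_map hf (h.measurable_apply r)]
  exact lintegral_prod _ (hf.comp (h.measurable_apply r)).aemeasurable

theorem integral_conv (h : CutSystem m) (r : ℝ) (ν ν' : ProbabilityMeasure K) (f : C(K, ℝ)) :
    ∫ x, f x ∂(h.conv r ν ν' : Measure K) =
      ∫ p, f (m r p.1 p.2) ∂((ν : Measure K).prod (ν' : Measure K)) := by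
  rw [conv, ProbabilityMeasure.toMeasure_map, integral_map (h.measurable_apply r).aemeasurable
    f.continuous.aestronglyMeasurable]
  rfl

theorem integrable_comp (h : CutSystem m) (r : ℝ) (ν : Measure (K × K)) [IsFiniteMeasure ν]
    (f : C(K, ℝ)) : Integrable (fun p => f (m r p.1 p.2)) ν :=
  Integrable.of_bound (f.continuous.measurable.comp
    (h.measurable_apply r)).aestronglyMeasurable ‖f‖
    (Eventually.of_forall fun p => f.norm_coe_le_norm _)

theorem measurable_triple (h : CutSystem m) {f : K → ℝ≥0∞} (hf : Measurable f) (r : ℝ) :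
    Measurable fun p : K × K => f (m r p.1 p.2) := hf.comp (h.measurable_apply r)

theorem conv_assoc (h : CutSystem m) {r r' : ℝ} (hr : r < r') (x y z : ProbabilityMeasure K) :
    h.conv r' (h.conv r x y) z = h.conv r x (h.conv r' y z) := by
  apply Subtype.ext
  refine Measure.ext_of_lintegral _ fun f hf => ?_
  change ∫⁻ q, f q ∂(h.conv r' (h.conv r x y) z : Measure K) =
    ∫⁻ q, f q ∂(h.conv r x (h.conv r' y z) : Measure K)
  rw [h.lintegral_conv _ _ _ hf, h.lintegral_conv _ _ _ hf,
    h.lintegral_conv _ _ _ (h.measurable_triple hf r').lintegral_prod_right']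
  refine lintegral_congr fun V => ?_
  rw [h.lintegral_conv _ _ _ (f := fun q => f (m r V q))
    ((h.measurable_triple hf r).comp measurable_prodMk_left)]
  simp only [h.assoc r r' hr]

theorem conv_absorb_left (h : CutSystem m) {r r' : ℝ} (hr : r' < r)
    (x y z : ProbabilityMeasure K) :
    h.conv r' (h.conv r x y) z = h.conv r' x z := by
  apply Subtype.ext
  refine Measure.ext_of_lintegral _ fun f hf => ?_
  change ∫⁻ q, f q ∂(h.conv r' (h.conv r x y) z : Measure K) =
    ∫⁻ q, f q ∂(h.conv r' x z : Measure K)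
  rw [h.lintegral_conv _ _ _ hf, h.lintegral_conv _ _ _ hf,
    h.lintegral_conv _ _ _ (h.measurable_triple hf r').lintegral_prod_right']
  refine lintegral_congr fun V => ?_
  simp [h.absorb_left r r' hr]

theorem conv_absorb_right (h : CutSystem m) {r r' : ℝ} (hr : r < r')
    (x y z : ProbabilityMeasure K) :
    h.conv r' x (h.conv r y z) = h.conv r' x z := by
  apply Subtype.ext
  refine Measure.ext_of_lintegral _ fun f hf => ?_
  change ∫⁻ q, f q ∂(h.conv r' x (h.conv r y z) : Measure K) =
    ∫⁻ q, f q ∂(h.conv r' x z : Measure K)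
  rw [h.lintegral_conv _ _ _ hf, h.lintegral_conv _ _ _ hf]
  refine lintegral_congr fun V => ?_
  rw [h.lintegral_conv _ _ _ (f := fun q => f (m r' V q))
    ((h.measurable_triple hf r').comp measurable_prodMk_left)]
  simp [h.absorb_right r r' hr]

theorem ae_idem_of_conv_eq (h : CutSystem m) {r : ℝ} {ν : ProbabilityMeasure K}
    (hν : h.conv r ν ν = ν) : ∀ᵐ V ∂(ν : Measure K), m r V V = V := by
  have h1 : ∀ᵐ V ∂(h.conv r ν ν : Measure K), m r V V = V := by
    rw [conv, ProbabilityMeasure.toMeasure_map, ae_map_iff (h.measurable_apply r).aemeasurable]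
    · exact Eventually.of_forall fun p => h.idem r p.1 p.2
    · exact measurableSet_eq_fun
        ((h.measurable_apply r).comp (measurable_id.prodMk measurable_id)) measurable_id
  rwa [hν] at h1

theorem continuous_conv_left (h : CutSystem m) (r : ℝ) (ν' : ProbabilityMeasure K) :
    Continuous fun ν => h.conv r ν ν' := by
  rw [continuous_iff_continuousAt]
  intro ν
  rw [ContinuousAt, ProbabilityMeasure.tendsto_iff_forall_integral_tendsto]
  intro f
  have hc : Continuous fun V => ∫ W, f (m r V W) ∂(ν' : Measure K) := by
    refine continuous_of_dominated (bound := fun _ => ‖f‖) (fun V => ?_) (fun V => ?_)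
      (integrable_const _) ?_
    · exact (f.continuous.comp (h.cont_right r V)).aestronglyMeasurable
    · exact Eventually.of_forall fun W => f.norm_coe_le_norm _
    · exact Eventually.of_forall fun W => f.continuous.comp (h.cont_left r W)
  have key : ∀ ν : ProbabilityMeasure K, ∫ x, f x ∂(h.conv r ν ν' : Measure K) =
      ∫ V, (BoundedContinuousFunction.mkOfCompact ⟨_, hc⟩) V ∂(ν : Measure K) := fun ν => by
    exact (h.integral_conv r ν ν' f.toContinuousMap).trans
      (integral_prod _ (h.integrable_comp r _ f.toContinuousMap))
  simp only [key]
  exact ProbabilityMeasure.tendsto_iff_forall_integral_tendsto.mp tendsto_id _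

theorem continuous_conv_right (h : CutSystem m) (r : ℝ) (ν : ProbabilityMeasure K) :
    Continuous fun ν' => h.conv r ν ν' := by
  rw [continuous_iff_continuousAt]
  intro ν'
  rw [ContinuousAt, ProbabilityMeasure.tendsto_iff_forall_integral_tendsto]
  intro f
  have hc : Continuous fun W => ∫ V, f (m r V W) ∂(ν : Measure K) := by
    refine continuous_of_dominated (bound := fun _ => ‖f‖) (fun W => ?_) (fun W => ?_)
      (integrable_const _) ?_
    · exact (f.continuous.comp (h.cont_left r W)).aestronglyMeasurable
    · exact Eventually.of_forall fun V => f.norm_coe_le_norm _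
    · exact Eventually.of_forall fun V => f.continuous.comp (h.cont_right r V)
  have key : ∀ ν' : ProbabilityMeasure K, ∫ x, f x ∂(h.conv r ν ν' : Measure K) =
      ∫ V, (BoundedContinuousFunction.mkOfCompact ⟨_, hc⟩) V ∂(ν' : Measure K) := fun ν' => by
    exact (h.integral_conv r ν ν' f.toContinuousMap).trans
      (integral_prod_symm _ (h.integrable_comp r _ f.toContinuousMap))
  simp only [key]
  exact ProbabilityMeasure.tendsto_iff_forall_integral_tendsto.mp tendsto_id _

end CutSystem

section Embedding

variable {K : Type*} [TopologicalSpace K] [CompactSpace K] [TopologicalSpace.MetrizableSpace K]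
  [MeasurableSpace K] [BorelSpace K]

/-- Unit vectors in the Banach space of bounded sequences. -/
noncomputable def unitSeq (n : ℕ) : BoundedContinuousFunction ℕ ℝ :=
  BoundedContinuousFunction.ofNormedAddCommGroup (fun k => if k = n then (1:ℝ) else 0)
    continuous_of_discreteTopology 1 (fun k => by split_ifs <;> simp)

theorem norm_unitSeq_le (n : ℕ) : ‖unitSeq n‖ ≤ 1 :=
  BoundedContinuousFunction.norm_ofNormedAddCommGroup_le _ zero_le_one _

/-- Normalized integrals of a dense sequence of test functions. -/
noncomputable def testWeight (K : Type*) [TopologicalSpace K] [CompactSpace K]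
    [TopologicalSpace.MetrizableSpace K] (n : ℕ) : ℝ :=
  (1 / 2) ^ n / (1 + ‖TopologicalSpace.denseSeq C(K, ℝ) n‖)

theorem testWeight_pos (n : ℕ) : 0 < testWeight K n := by
  unfold testWeight; positivity

/-- The embedding of the probability measures on a compact metrizable space into a Banach space. -/
noncomputable def measureEmb (ν : Measure K) : BoundedContinuousFunction ℕ ℝ :=
  ∑' n, (testWeight K n * ∫ x, TopologicalSpace.denseSeq C(K, ℝ) n x ∂ν) • unitSeq n

theorem norm_coeff_le {α : Type*} [MeasurableSpace α] (ν : Measure α) [IsProbabilityMeasure ν]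
    (g : α → K) (n : ℕ) :
    ‖(testWeight K n * ∫ x, TopologicalSpace.denseSeq C(K, ℝ) n (g x) ∂ν) • unitSeq n‖ ≤
      (1 / 2 : ℝ) ^ n := by
  set f := TopologicalSpace.denseSeq C(K, ℝ) n with hf
  have h1 : ‖∫ x, f (g x) ∂ν‖ ≤ ‖f‖ := by
    have := norm_integral_le_of_norm_le_const (μ := ν) (f := fun x => f (g x)) (C := ‖f‖)
      (Eventually.of_forall fun x => f.norm_coe_le_norm _)
    simpa using this
  have hw := testWeight_pos (K := K) n
  rw [norm_smul, norm_mul, Real.norm_of_nonneg hw.le]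
  calc testWeight K n * ‖∫ x, f (g x) ∂ν‖ * ‖unitSeq n‖ ≤ testWeight K n * ‖f‖ * 1 := by
        gcongr
        exact norm_unitSeq_le n
    _ ≤ testWeight K n * (1 + ‖f‖) := by nlinarith
    _ = (1 / 2 : ℝ) ^ n := by
        rw [testWeight, ← hf]
        field_simp

theorem summable_coeff {α : Type*} [MeasurableSpace α] (ν : Measure α) [IsProbabilityMeasure ν]
    (g : α → K) :
    Summable fun n => (testWeight K n * ∫ x, TopologicalSpace.denseSeq C(K, ℝ) n (g x) ∂ν) •
      unitSeq n :=
  Summable.of_norm_bounded (summable_geometric_of_lt_one (by norm_num) (by norm_num))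
    (norm_coeff_le ν g)

theorem measureEmb_apply (ν : Measure K) [IsProbabilityMeasure ν] (k : ℕ) :
    measureEmb ν k = testWeight K k * ∫ x, TopologicalSpace.denseSeq C(K, ℝ) k x ∂ν := by
  have := (BoundedContinuousFunction.evalCLM ℝ k : BoundedContinuousFunction ℕ ℝ →L[ℝ] ℝ).map_tsum (summable_coeff (K := K) ν id)
  simp only [id] at this
  change (BoundedContinuousFunction.evalCLM ℝ k : BoundedContinuousFunction ℕ ℝ →L[ℝ] ℝ)
    (measureEmb ν) = _
  rw [measureEmb, this, tsum_eq_single k]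
  · simp [unitSeq]
  · intro n hn
    simp [unitSeq, hn.symm]

theorem continuous_measureEmb :
    Continuous fun ν : ProbabilityMeasure K => measureEmb (ν : Measure K) := by
  refine continuous_tsum (fun n => ?_)
    (summable_geometric_of_lt_one (by norm_num) (by norm_num : (1 / 2 : ℝ) < 1))
    (fun n (ν : ProbabilityMeasure K) => norm_coeff_le (ν : Measure K) id n)
  have hc : Continuous fun ν : ProbabilityMeasure K =>
      ∫ x, TopologicalSpace.denseSeq C(K, ℝ) n x ∂(ν : Measure K) := by
    rw [continuous_iff_continuousAt]
    intro ν
    exact ProbabilityMeasure.tendsto_iff_forall_integral_tendsto.mp tendsto_id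
      (BoundedContinuousFunction.mkOfCompact (TopologicalSpace.denseSeq C(K, ℝ) n))
  exact (continuous_const.mul hc).smul continuous_const

theorem measureEmb_injective :
    Function.Injective fun ν : ProbabilityMeasure K => measureEmb (ν : Measure K) := by
  intro ν ν' h
  apply Subtype.ext
  have h1 : ∀ n, ∫ x, TopologicalSpace.denseSeq C(K, ℝ) n x ∂(ν : Measure K) =
      ∫ x, TopologicalSpace.denseSeq C(K, ℝ) n x ∂(ν' : Measure K) := fun n => by
    have := DFunLike.congr_fun h n
    simp only [measureEmb_apply] at this
    exact mul_left_cancel₀ (testWeight_pos n).ne' this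
  have hc : ∀ ν : ProbabilityMeasure K, Continuous fun f : C(K, ℝ) => ∫ x, f x ∂(ν : Measure K) := by
    intro ν
    refine (LipschitzWith.of_dist_le_mul (K := 1) fun f g => ?_).continuous
    have hi : ∀ f : C(K, ℝ), Integrable (fun x => f x) (ν : Measure K) := fun f =>
      Integrable.of_bound f.continuous.aestronglyMeasurable ‖f‖
        (Eventually.of_forall fun x => f.norm_coe_le_norm _)
    rw [dist_eq_norm, dist_eq_norm, ← integral_sub (hi f) (hi g)]
    have := norm_integral_le_of_norm_le_const (μ := (ν : Measure K)) (f := fun x => f x - g x)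
      (C := ‖f - g‖) (Eventually.of_forall fun x => (f - g).norm_coe_le_norm _)
    simpa using this
  have h2 : (fun f : C(K, ℝ) => ∫ x, f x ∂(ν : Measure K)) =
      fun f : C(K, ℝ) => ∫ x, f x ∂(ν' : Measure K) :=
    Continuous.ext_on (TopologicalSpace.denseRange_denseSeq _) (hc ν) (hc ν') (by
      rintro _ ⟨n, rfl⟩; exact h1 n)
  change (ν : Measure K) = ν'
  exact ext_of_forall_integral_eq_of_IsFiniteMeasure fun f => congrFun h2 f.toContinuousMap

/-- Convex combinations of probability measures. -/
noncomputable def convexCombo (ν ν' : ProbabilityMeasure K) (s t : ℝ) (hs : 0 ≤ s) (ht : 0 ≤ t)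
    (hst : s + t = 1) : ProbabilityMeasure K :=
  ⟨ENNReal.ofReal s • (ν : Measure K) + ENNReal.ofReal t • (ν' : Measure K), ⟨by
    simp [← ENNReal.ofReal_add hs ht, hst]⟩⟩

theorem integral_convexCombo (ν ν' : ProbabilityMeasure K) {s t : ℝ} (hs : 0 ≤ s) (ht : 0 ≤ t)
    (hst : s + t = 1) {f : K → ℝ} (hf : Measurable f) {R : ℝ} (hR : ∀ x, ‖f x‖ ≤ R) :
    ∫ x, f x ∂(convexCombo ν ν' s t hs ht hst : Measure K) =
      s * ∫ x, f x ∂(ν : Measure K) + t * ∫ x, f x ∂(ν' : Measure K) := by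
  have hi : ∀ ν : ProbabilityMeasure K, Integrable f (ν : Measure K) := fun ν =>
    Integrable.of_bound hf.aestronglyMeasurable R (Eventually.of_forall hR)
  change ∫ x, f x ∂(ENNReal.ofReal s • (ν : Measure K) + ENNReal.ofReal t • (ν' : Measure K)) = _
  rw [integral_add_measure ((hi ν).smul_measure ENNReal.ofReal_ne_top)
    ((hi ν').smul_measure ENNReal.ofReal_ne_top), integral_smul_measure, integral_smul_measure,
    ENNReal.toReal_ofReal hs, ENNReal.toReal_ofReal ht, smul_eq_mul, smul_eq_mul]

theorem measureEmb_convexCombo (ν ν' : ProbabilityMeasure K) {s t : ℝ} (hs : 0 ≤ s) (ht : 0 ≤ t)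
    (hst : s + t = 1) :
    measureEmb (convexCombo ν ν' s t hs ht hst : Measure K) =
      s • measureEmb (ν : Measure K) + t • measureEmb (ν' : Measure K) := by
  ext k
  simp only [BoundedContinuousFunction.coe_add, BoundedContinuousFunction.coe_smul, Pi.add_apply,
    measureEmb_apply, smul_eq_mul]
  rw [integral_convexCombo ν ν' hs ht hst (ContinuousMap.continuous _).measurable
    (fun x => ContinuousMap.norm_coe_le_norm _ x)]
  ring

end Embedding

namespace CutSystem

variable {K : Type*} [TopologicalSpace K] [CompactSpace K] [TopologicalSpace.MetrizableSpace K]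
  [MeasurableSpace K] [BorelSpace K] {m : ℝ → K → K → K}

theorem conv_convexCombo_left (h : CutSystem m) (r : ℝ) (x x' y : ProbabilityMeasure K) {s t : ℝ}
    (hs : 0 ≤ s) (ht : 0 ≤ t) (hst : s + t = 1) :
    h.conv r (convexCombo x x' s t hs ht hst) y =
      convexCombo (h.conv r x y) (h.conv r x' y) s t hs ht hst := by
  apply Subtype.ext
  refine Measure.ext_of_lintegral _ fun f hf => ?_
  change ∫⁻ q, f q ∂(h.conv r (convexCombo x x' s t hs ht hst) y : Measure K) =
    ∫⁻ q, f q ∂(ENNReal.ofReal s • (h.conv r x y : Measure K) +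
      ENNReal.ofReal t • (h.conv r x' y : Measure K))
  rw [h.lintegral_conv _ _ _ hf, lintegral_add_measure, lintegral_smul_measure,
    lintegral_smul_measure, h.lintegral_conv _ _ _ hf, h.lintegral_conv _ _ _ hf]
  change ∫⁻ q, _ ∂(ENNReal.ofReal s • (x : Measure K) + ENNReal.ofReal t • (x' : Measure K)) = _
  rw [lintegral_add_measure, lintegral_smul_measure, lintegral_smul_measure]

theorem conv_convexCombo_right (h : CutSystem m) (r : ℝ) (x y y' : ProbabilityMeasure K) {s t : ℝ}
    (hs : 0 ≤ s) (ht : 0 ≤ t) (hst : s + t = 1) :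
    h.conv r x (convexCombo y y' s t hs ht hst) =
      convexCombo (h.conv r x y) (h.conv r x y') s t hs ht hst := by
  apply Subtype.ext
  refine Measure.ext_of_lintegral _ fun f hf => ?_
  change ∫⁻ q, f q ∂(h.conv r x (convexCombo y y' s t hs ht hst) : Measure K) =
    ∫⁻ q, f q ∂(ENNReal.ofReal s • (h.conv r x y : Measure K) +
      ENNReal.ofReal t • (h.conv r x y' : Measure K))
  have hm := fun ν : ProbabilityMeasure K =>
    (h.measurable_triple hf r).lintegral_prod_right' (ν := (ν : Measure K))
  rw [h.lintegral_conv _ _ _ hf, lintegral_add_measure, lintegral_smul_measure,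
    lintegral_smul_measure, h.lintegral_conv _ _ _ hf, h.lintegral_conv _ _ _ hf,
    smul_eq_mul, smul_eq_mul, ← lintegral_const_mul _ (hm y), ← lintegral_const_mul _ (hm y'),
    ← lintegral_add_left ((hm y).const_mul _)]
  refine lintegral_congr fun V => ?_
  change ∫⁻ q, _ ∂(ENNReal.ofReal s • (y : Measure K) + ENNReal.ofReal t • (y' : Measure K)) = _
  rw [lintegral_add_measure, lintegral_smul_measure, lintegral_smul_measure]
  rfl

theorem stronglyMeasurable_measureEmb_conv (h : CutSystem m) (x y : ProbabilityMeasure K) :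
    StronglyMeasurable fun r => measureEmb (h.conv r x y : Measure K) := by
  have key : ∀ n, StronglyMeasurable fun r => (testWeight K n *
      ∫ q, TopologicalSpace.denseSeq C(K, ℝ) n q ∂(h.conv r x y : Measure K)) • unitSeq n := by
    intro n
    have h1 : StronglyMeasurable fun r =>
        ∫ p, TopologicalSpace.denseSeq C(K, ℝ) n (m r p.1 p.2)
          ∂((x : Measure K).prod (y : Measure K)) := by
      refine StronglyMeasurable.integral_prod_right (f := fun r (p : K × K) =>
        TopologicalSpace.denseSeq C(K, ℝ) n (m r p.1 p.2)) ?_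
      exact ((ContinuousMap.continuous _).measurable.comp h.measurable).stronglyMeasurable
    simp only [h.integral_conv]
    exact (stronglyMeasurable_const.mul h1).smul_const _
  refine stronglyMeasurable_of_tendsto atTop
    (f := fun N r => ∑ n ∈ Finset.range N, (testWeight K n *
      ∫ q, TopologicalSpace.denseSeq C(K, ℝ) n q ∂(h.conv r x y : Measure K)) • unitSeq n)
    (fun N => Finset.stronglyMeasurable_fun_sum _ fun n _ => key n) ?_
  rw [tendsto_pi_nhds]
  intro r
  exact (summable_coeff (K := K) (h.conv r x y : Measure K) id).hasSum.tendsto_sum_nat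

/-- A compact cut system has an element which is idempotent at almost every cut time. -/
theorem exists_ae_idempotent [Nonempty K] (h : CutSystem m) : ∃ V, ∀ᵐ r, m r V V = V := by
  let emb : ProbabilityMeasure K → BoundedContinuousFunction ℕ ℝ := fun ν =>
    measureEmb (ν : Measure K)
  have hne : Nonempty (ProbabilityMeasure K) :=
    ⟨⟨Measure.dirac (Classical.arbitrary K), inferInstance⟩⟩
  have hemb : Continuous emb := continuous_measureEmb
  have hinj : Function.Injective emb := measureEmb_injective
  have hcl : Topology.IsClosedEmbedding emb := hemb.isClosedEmbedding hinj
  let P := range emb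
  let J := Function.invFun emb
  have hJ : ∀ ν, J (emb ν) = ν := Function.leftInverse_invFun hinj
  have hJc : ContinuousOn J P := by
    rw [continuousOn_iff_continuous_restrict, hcl.isInducing.continuous_iff]
    refine continuous_subtype_val.congr ?_
    rintro ⟨_, ν, rfl⟩
    exact congrArg emb (hJ ν).symm
  have hcombo : ∀ ν ν' s t (hs : 0 ≤ s) (ht : 0 ≤ t) (hst : s + t = 1),
      s • emb ν + t • emb ν' = emb (convexCombo ν ν' s t hs ht hst) :=
    fun ν ν' s t hs ht hst => (measureEmb_convexCombo ν ν' hs ht hst).symm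
  have halg : CutAlgebra P fun r x y => emb (h.conv r (J x) (J y)) := by
    constructor
    · exact isCompact_range hemb
    · rintro _ ⟨ν, rfl⟩ _ ⟨ν', rfl⟩ s t hs ht hst
      exact ⟨_, (hcombo ν ν' s t hs ht hst).symm⟩
    · exact range_nonempty _
    · exact fun r x _ y _ => mem_range_self _
    · rintro r _ ⟨y, rfl⟩ _ ⟨x, rfl⟩ _ ⟨x', rfl⟩ s t hs ht hst
      simp only [hJ, hcombo _ _ s t hs ht hst, h.conv_convexCombo_left]
    · rintro r _ ⟨y, rfl⟩ _ ⟨x, rfl⟩ _ ⟨x', rfl⟩ s t hs ht hst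
      simp only [hJ, hcombo _ _ s t hs ht hst, h.conv_convexCombo_right]
    · exact fun r y _ => hemb.comp_continuousOn
        ((h.continuous_conv_left r (J y)).comp_continuousOn hJc)
    · exact fun r x _ => hemb.comp_continuousOn
        ((h.continuous_conv_right r (J x)).comp_continuousOn hJc)
    · exact fun x _ y _ => h.stronglyMeasurable_measureEmb_conv (J x) (J y)
    · intro r r' hr x _ y _ z _
      simp only [hJ, h.conv_assoc hr]
    · intro r r' hr x _ y _ z _
      simp only [hJ, h.conv_absorb_left hr]
    · intro r r' hr x _ y _ z _
      simp only [hJ, h.conv_absorb_right hr]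
  obtain ⟨_, ⟨ν, rfl⟩, hν⟩ := halg.exists_ae_idempotent
  simp only [hJ] at hν
  have h1 : ∀ᵐ r, ∀ᵐ V ∂(ν : Measure K), m r V V = V := by
    filter_upwards [hν] with r hr
    exact h.ae_idem_of_conv_eq (hinj hr)
  rw [Measure.ae_ae_comm (p := fun r V => m r V V = V)] at h1
  · exact h1.exists
  · exact measurableSet_eq_fun (h.measurable.comp
      (measurable_fst.prodMk (measurable_snd.prodMk measurable_snd))) measurable_snd

end CutSystem

section LinearEvolution

variable {X : Type*} [NormedAddCommGroup X] [NormedSpace ℝ X]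

theorem continuousWithinAt_apply_of_norm_le {α E F : Type*} [TopologicalSpace α] [NormedAddCommGroup E]
    [NormedSpace ℝ E] [NormedAddCommGroup F] [NormedSpace ℝ F] {S : Set α} {P : α → E →L[ℝ] F}
    {C : ℝ} {t : α} {g : α → E} (hP : ContinuousWithinAt (fun τ => P τ (g t)) S t)
    (hC : ∀ τ ∈ S, ‖P τ‖ ≤ C) (hg : ContinuousWithinAt g S t) :
    ContinuousWithinAt (fun τ => P τ (g τ)) S t := by
  have h1 : Tendsto (fun τ => P τ (g τ - g t)) (𝓝[S] t) (𝓝 0) := by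
    have h2 : Tendsto (fun τ => C * ‖g τ - g t‖) (𝓝[S] t) (𝓝 0) := by
      have : Tendsto (fun τ => g τ - g t) (𝓝[S] t) (𝓝 (g t - g t)) := hg.sub_const (g t)
      rw [sub_self] at this
      simpa using this.norm.const_mul C
    refine squeeze_zero_norm' ?_ h2
    filter_upwards [self_mem_nhdsWithin] with τ hτ
    exact (P τ).le_of_opNorm_le (hC τ hτ) _
  have h3 := h1.add hP
  simpa [ContinuousWithinAt] using h3

theorem continuousOn_apply_of_norm_le {α E F : Type*} [TopologicalSpace α] [NormedAddCommGroup E]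
    [NormedSpace ℝ E] [NormedAddCommGroup F] [NormedSpace ℝ F] {S : Set α} {P : α → E →L[ℝ] F}
    {C : ℝ} {g : α → E} (hP : ∀ x, ContinuousOn (fun τ => P τ x) S)
    (hC : ∀ τ ∈ S, ‖P τ‖ ≤ C) (hg : ContinuousOn g S) :
    ContinuousOn (fun τ => P τ (g τ)) S := fun t ht =>
  continuousWithinAt_apply_of_norm_le (hP (g t) t ht) hC (hg t ht)

/-- A decreasing family of uniformly bounded sets of operators, thought of as the decreasing family
of equivalent norms `x ↦ sup {‖Q x‖ | Q ∈ Fam t}`. -/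
structure IsNormFamily (Fam : ℝ → Set (X →L[ℝ] X)) (M : ℝ) : Prop where
  one_mem : ∀ t, 1 ∈ Fam t
  anti : ∀ s t, s ≤ t → Fam t ⊆ Fam s
  norm_le : ∀ t, ∀ Q ∈ Fam t, ‖Q‖ ≤ M

/-- The bounded operators `B t` are strongly continuous on `(a, b]` and `ω'`-dissipative for the
norms given by `Fam t`. -/
structure IsDissipative (a b : ℝ) (Fam : ℝ → Set (X →L[ℝ] X)) (ω' : ℝ)
    (B : ℝ → X →L[ℝ] X) : Prop where
  cont : ∀ x, ContinuousOn (fun t => B t x) (Ioc a b)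
  diss : ∃ Λ : ℝ, 0 ≤ Λ ∧ 0 ≤ Λ + ω' ∧ ∀ t ∈ Ioc a b, ∀ z ρ, (∀ Q ∈ Fam t, ‖Q z‖ ≤ ρ) →
    ∀ Q ∈ Fam t, ‖Q (B t z + Λ • z)‖ ≤ (Λ + ω') * ρ

/-- `U` is the evolution family generated on `(a, b]` by `B`, and it is exponentially bounded for
the norms given by `Fam t`. -/
structure Evolves (a b : ℝ) (Fam : ℝ → Set (X →L[ℝ] X)) (ω' : ℝ) (B : ℝ → X →L[ℝ] X)
    (U : ℝ → ℝ → X →L[ℝ] X) : Prop where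
  zero_off : ∀ t s, ¬ (a < s ∧ s ≤ t ∧ t ≤ b) → U t s = 0
  refl : ∀ s ∈ Ioc a b, U s s = 1
  cont : ∀ s ∈ Ioc a b, ∀ x, ContinuousOn (fun t => U t s x) (Icc s b)
  deriv : ∀ s ∈ Ioc a b, ∀ x, ∀ t ∈ Ico s b,
    HasDerivWithinAt (fun τ => U τ s x) (B t (U t s x)) (Ici t) t
  comp : ∀ s r t, a < s → s ≤ r → r ≤ t → t ≤ b → (U t r).comp (U r s) = U t s
  norm_le : ∀ s t, a < s → s ≤ t → t ≤ b → ∀ z ρ, (∀ Q ∈ Fam s, ‖Q z‖ ≤ ρ) →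
    ∀ Q ∈ Fam t, ‖Q (U t s z)‖ ≤ ρ * exp (ω' * (t - s))

/-- The terms of the Dyson series with value `x` at the initial time `s`. -/
noncomputable def dyson (P : ℝ → X →L[ℝ] X) (s : ℝ) (x : X) : ℕ → ℝ → X
  | 0 => fun _ => x
  | n + 1 => fun t => ∫ τ in s..t, P τ (dyson P s x n τ)

variable {a b M ω' p : ℝ} {Fam : ℝ → Set (X →L[ℝ] X)} {P B B' : ℝ → X →L[ℝ] X}

theorem intervalIntegrable_of_continuousOn_Icc {E : Type*} [NormedAddCommGroup E] {s t c : ℝ}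
    {f : ℝ → E} (hf : ContinuousOn f (Icc s c)) (ht : t ∈ Icc s c) :
    IntervalIntegrable f volume s t := by
  apply ContinuousOn.intervalIntegrable
  rw [uIcc_of_le ht.1]
  exact hf.mono (Icc_subset_Icc_right ht.2)

theorem hasDerivWithinAt_integral_Ici [CompleteSpace X] {s t c : ℝ} {f : ℝ → X}
    (hf : ContinuousOn f (Icc s c)) (ht : t ∈ Ico s c) :
    HasDerivWithinAt (fun τ => ∫ r in s..τ, f r) (f t) (Ici t) t := by
  have h1 : ContinuousWithinAt f (Ioi t) t := by
    refine ((hf t ⟨ht.1, ht.2.le⟩).mono_of_mem_nhdsWithin ?_)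
    filter_upwards [Ioo_mem_nhdsGT ht.2] with r hr
    exact ⟨ht.1.trans hr.1.le, hr.2.le⟩
  refine intervalIntegral.integral_hasDerivWithinAt_right
    (intervalIntegrable_of_continuousOn_Icc hf ⟨ht.1, ht.2.le⟩) ?_ h1
  refine ⟨Icc s c, ?_, hf.aestronglyMeasurable measurableSet_Icc⟩
  filter_upwards [Ioo_mem_nhdsGT ht.2] with r hr
  exact ⟨ht.1.trans hr.1.le, hr.2.le⟩

theorem continuousOn_integral_Icc [CompleteSpace X] {s c : ℝ} {f : ℝ → X} (hsc : s ≤ c)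
    (hf : ContinuousOn f (Icc s c)) : ContinuousOn (fun t => ∫ r in s..t, f r) (Icc s c) := by
  have := intervalIntegral.continuousOn_primitive_interval (a := s) (b := c) (μ := volume)
    (f := f) (by rw [uIcc_of_le hsc]; exact hf.integrableOn_Icc)
  rwa [uIcc_of_le hsc] at this

section Dyson

theorem dyson_smul {s t : ℝ} (c : ℝ) (x : X) (n : ℕ) :
    dyson P s (c • x) n t = c • dyson P s x n t := by
  induction n generalizing t with
  | zero => rfl
  | succ n ih =>
    simp only [dyson, ih, map_smul, intervalIntegral.integral_smul]

variable [CompleteSpace X] (hP : ∀ x, ContinuousOn (fun t => P t x) (Ioc a b)) {K : ℝ}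
  (hK : ∀ t ∈ Ioc a b, ‖P t‖ ≤ K)

include hP hK

theorem continuousOn_dyson {s : ℝ} (hs : s ∈ Ioc a b) (x : X) (n : ℕ) :
    ContinuousOn (dyson P s x n) (Icc s b) := by
  have hI : Icc s b ⊆ Ioc a b := fun t ht => ⟨hs.1.trans_le ht.1, ht.2⟩
  induction n with
  | zero => exact continuousOn_const
  | succ n ih =>
    exact continuousOn_integral_Icc hs.2 (continuousOn_apply_of_norm_le (fun x => (hP x).mono hI)
      (fun t ht => hK t (hI ht)) ih)

theorem continuousOn_apply_dyson {s : ℝ} (hs : s ∈ Ioc a b) (x : X) (n : ℕ) :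
    ContinuousOn (fun τ => P τ (dyson P s x n τ)) (Icc s b) := by
  have hI : Icc s b ⊆ Ioc a b := fun t ht => ⟨hs.1.trans_le ht.1, ht.2⟩
  exact continuousOn_apply_of_norm_le (fun x => (hP x).mono hI)
      (fun t ht => hK t (hI ht)) (continuousOn_dyson hP hK hs x n)

theorem dyson_add {s t : ℝ} (hs : s ∈ Ioc a b) (ht : t ∈ Icc s b) (x y : X) (n : ℕ) :
    dyson P s (x + y) n t = dyson P s x n t + dyson P s y n t := by
  induction n generalizing t with
  | zero => rfl
  | succ n ih =>
    have h (x : X) := intervalIntegrable_of_continuousOn_Icc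
      (continuousOn_apply_dyson hP hK hs x n) ht
    simp only [dyson]
    rw [← intervalIntegral.integral_add (h x) (h y)]
    refine intervalIntegral.integral_congr fun τ hτ => ?_
    rw [uIcc_of_le ht.1] at hτ
    simp only [ih ⟨hτ.1, hτ.2.trans ht.2⟩, map_add]

theorem norm_dyson_le (hF : IsNormFamily Fam M) (hp : 0 ≤ p)
    (hd : ∀ t ∈ Ioc a b, ∀ z ρ, (∀ Q ∈ Fam t, ‖Q z‖ ≤ ρ) → ∀ Q ∈ Fam t, ‖Q (P t z)‖ ≤ p * ρ)
    {s t : ℝ} (hs : s ∈ Ioc a b) (ht : t ∈ Icc s b) (x : X) {ρ : ℝ}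
    (hx : ∀ Q ∈ Fam s, ‖Q x‖ ≤ ρ) (n : ℕ) {Q : X →L[ℝ] X} (hQ : Q ∈ Fam t) :
    ‖Q (dyson P s x n t)‖ ≤ ρ * ((p * (t - s)) ^ n / n.factorial) := by
  induction n generalizing t Q with
  | zero => simpa [dyson] using hx Q (hF.anti _ _ ht.1 hQ)
  | succ n ih =>
    have h := intervalIntegrable_of_continuousOn_Icc (continuousOn_apply_dyson hP hK hs x n) ht
    simp only [dyson]
    rw [← ContinuousLinearMap.intervalIntegral_comp_comm Q h]
    have h1 : ∀ τ ∈ Ioc s t, ‖Q (P τ (dyson P s x n τ))‖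
        ≤ (p * ρ * p ^ n / n.factorial) * (τ - s) ^ n := by
      intro τ hτ
      have h2 := hd τ ⟨hs.1.trans hτ.1, hτ.2.trans ht.2⟩ _ _
        (fun R hR => ih ⟨hτ.1.le, hτ.2.trans ht.2⟩ hR) Q (hF.anti _ _ hτ.2 hQ)
      refine h2.trans (le_of_eq ?_)
      rw [mul_pow]; ring
    have h3 : ∫ τ in s..t, (p * ρ * p ^ n / n.factorial) * (τ - s) ^ n
        = ρ * ((p * (t - s)) ^ (n + 1) / (n + 1).factorial) := by
      rw [intervalIntegral.integral_const_mul, intervalIntegral.integral_comp_sub_right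
        (fun r => r ^ n), integral_pow, sub_self, Nat.factorial_succ]
      push_cast
      have := Nat.cast_ne_zero (R := ℝ).2 n.factorial_ne_zero
      have : (n : ℝ) + 1 ≠ 0 := by positivity
      rw [mul_pow]
      field_simp
      ring
    rw [← h3]
    refine intervalIntegral.norm_integral_le_of_norm_le ht.1 ?_ ?_
    · exact ae_of_all _ h1
    · exact (Continuous.intervalIntegrable (by fun_prop) _ _)

end Dyson

theorem exists_series_solution [CompleteSpace X] (hF : IsNormFamily Fam M) (hp : 0 ≤ p)
    (hP : ∀ x, ContinuousOn (fun t => P t x) (Ioc a b)) {K : ℝ}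
    (hK : ∀ t ∈ Ioc a b, ‖P t‖ ≤ K)
    (hd : ∀ t ∈ Ioc a b, ∀ z ρ, (∀ Q ∈ Fam t, ‖Q z‖ ≤ ρ) → ∀ Q ∈ Fam t, ‖Q (P t z)‖ ≤ p * ρ)
    {s : ℝ} (hs : s ∈ Ioc a b) :
    ∃ V : ℝ → X →ₗ[ℝ] X, (∀ x, ContinuousOn (fun t => V t x) (Icc s b)) ∧
      (∀ x, V s x = x) ∧
      (∀ x, ∀ t ∈ Ico s b, HasDerivWithinAt (fun τ => V τ x) (P t (V t x)) (Ici t) t) ∧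
      ∀ t ∈ Icc s b, ∀ x ρ, (∀ Q ∈ Fam s, ‖Q x‖ ≤ ρ) →
        ∀ Q ∈ Fam t, ‖Q (V t x)‖ ≤ ρ * exp (p * (t - s)) := by
  have hbd : ∀ t ∈ Icc s b, ∀ x ρ, (∀ Q ∈ Fam s, ‖Q x‖ ≤ ρ) → ∀ n,
      ∀ Q ∈ Fam t, ‖Q (dyson P s x n t)‖ ≤ ρ * ((p * (t - s)) ^ n / n.factorial) :=
    fun t ht x ρ hx n Q hQ => norm_dyson_le hP hK hF hp hd hs ht x hx n hQ
  have hM (x : X) : ∀ Q ∈ Fam s, ‖Q x‖ ≤ M * ‖x‖ :=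
    fun Q hQ => Q.le_of_opNorm_le (hF.norm_le s Q hQ) x
  have hM0 : 0 ≤ M := (norm_nonneg _).trans (hF.norm_le s 1 (hF.one_mem s))
  have hub : ∀ x n, ∀ t ∈ Icc s b,
      ‖dyson P s x n t‖ ≤ M * ‖x‖ * ((p * (b - s)) ^ n / n.factorial) := by
    intro x n t ht
    have h := hbd t ht x _ (hM x) n 1 (hF.one_mem t)
    refine h.trans ?_
    have : 0 ≤ t - s := sub_nonneg.2 ht.1
    gcongr
    exact ht.2
  have hsum0 (r x : ℝ) : Summable fun n : ℕ => r * (x ^ n / n.factorial) :=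
    (Real.summable_pow_div_factorial x).mul_left r
  have hsum : ∀ x, ∀ t ∈ Icc s b, Summable fun n => dyson P s x n t := fun x t ht =>
    Summable.of_norm_bounded (hsum0 (M * ‖x‖) (p * (b - s))) fun n => hub x n t ht
  have hcont : ∀ x, ContinuousOn (fun t => ∑' n, dyson P s x n t) (Icc s b) := fun x =>
    continuousOn_tsum (fun n => continuousOn_dyson hP hK hs x n)
      (hsum0 (M * ‖x‖) (p * (b - s))) (hub x)
  have hI : Icc s b ⊆ Ioc a b := fun t ht => ⟨hs.1.trans_le ht.1, ht.2⟩
  have h_int : ∀ x, ∀ t ∈ Icc s b, ∑' n, dyson P s x n t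
      = x + ∫ τ in s..t, P τ (∑' n, dyson P s x n τ) := by
    intro x t ht
    have h1 : HasSum (fun n => dyson P s x (n + 1) t)
        (∫ τ in s..t, P τ (∑' n, dyson P s x n τ)) := by
      refine intervalIntegral.hasSum_integral_of_dominated_convergence
        (fun n _ => K * (M * ‖x‖ * ((p * (b - s)) ^ n / n.factorial))) ?_ ?_ ?_ ?_ ?_
      · intro n
        rw [uIoc_of_le ht.1]
        refine ((continuousOn_apply_dyson hP hK hs x n).mono ?_).aestronglyMeasurable
          measurableSet_Ioc
        exact fun r hr => ⟨hr.1.le, hr.2.trans ht.2⟩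
      · intro n
        refine ae_of_all _ fun τ hτ => ?_
        rw [uIoc_of_le ht.1] at hτ
        have hτ' : τ ∈ Icc s b := ⟨hτ.1.le, hτ.2.trans ht.2⟩
        have hK0 : 0 ≤ K := (norm_nonneg _).trans (hK τ (hI hτ'))
        exact ((P τ).le_of_opNorm_le (hK τ (hI hτ')) _).trans
          (mul_le_mul_of_nonneg_left (hub x n τ hτ') hK0)
      · exact ae_of_all _ fun τ _ => (hsum0 _ _).mul_left K
      · exact intervalIntegrable_const
      · refine ae_of_all _ fun τ hτ => ?_
        rw [uIoc_of_le ht.1] at hτ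
        exact (P τ).hasSum (hsum x τ ⟨hτ.1.le, hτ.2.trans ht.2⟩).hasSum
    rw [(hsum x t ht).tsum_eq_zero_add, h1.tsum_eq]
    rfl
  have hPV (x : X) : ContinuousOn (fun τ => P τ (∑' n, dyson P s x n τ)) (Icc s b) :=
    continuousOn_apply_of_norm_le (fun x => (hP x).mono hI) (fun t ht => hK t (hI ht)) (hcont x)
  have hV : ∃ V : ℝ → X →ₗ[ℝ] X, ∀ t ∈ Icc s b, ∀ x, V t x = ∑' n, dyson P s x n t := by
    refine ⟨fun t => if ht : t ∈ Icc s b then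
      { toFun := fun x => ∑' n, dyson P s x n t
        map_add' := fun x y => by
          rw [← (hsum x t ht).tsum_add (hsum y t ht)]
          exact tsum_congr fun n => dyson_add hP hK hs ht x y n
        map_smul' := fun c x => by
          simp only [dyson_smul, RingHom.id_apply]
          exact (hsum x t ht).tsum_const_smul c } else 0, fun t ht x => ?_⟩
    simp only [dif_pos ht]
    rfl
  obtain ⟨V, hV⟩ := hV
  refine ⟨V, fun x => (hcont x).congr fun t ht => hV t ht x, fun x => ?_, fun x t ht => ?_, ?_⟩
  · rw [hV s ⟨le_rfl, hs.2⟩, h_int x s ⟨le_rfl, hs.2⟩]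
    simp
  · have htt : t ∈ Icc s b := ⟨ht.1, ht.2.le⟩
    have h1 := (hasDerivWithinAt_integral_Ici (hPV x) ht).const_add x
    rw [hV t htt]
    refine h1.congr_of_eventuallyEq ?_ (by rw [hV t htt, h_int x t htt])
    filter_upwards [Icc_mem_nhdsGE ht.2] with τ hτ
    have hτ' : τ ∈ Icc s b := ⟨ht.1.trans hτ.1, hτ.2⟩
    rw [hV τ hτ', h_int x τ hτ']
  · intro t ht x ρ hx Q hQ
    rw [hV t ht]
    rw [Q.map_tsum (hsum x t ht)]
    refine tsum_of_norm_bounded ?_ fun n => hbd t ht x ρ hx n Q hQ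
    refine HasSum.mul_left ρ ?_
    rw [Real.exp_eq_exp_ℝ]
    exact NormedSpace.expSeries_div_hasSum_exp _

end LinearEvolution

section EvolutionFamilies

variable {X : Type*} [NormedAddCommGroup X] [NormedSpace ℝ X]
  {a b M ω' : ℝ} {Fam : ℝ → Set (X →L[ℝ] X)} {B B' : ℝ → X →L[ℝ] X} {U U' : ℝ → ℝ → X →L[ℝ] X}

theorem eq_of_hasDerivWithinAt_apply {K r t : ℝ} {f g : ℝ → X} (hrt : r ≤ t)
    (hK : ∀ τ ∈ Ico r t, ‖B τ‖ ≤ K)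
    (hf : ContinuousOn f (Icc r t))
    (hf' : ∀ τ ∈ Ico r t, HasDerivWithinAt f (B τ (f τ)) (Ici τ) τ)
    (hg : ContinuousOn g (Icc r t))
    (hg' : ∀ τ ∈ Ico r t, HasDerivWithinAt g (B τ (g τ)) (Ici τ) τ) (h : f r = g r) :
    f t = g t := by
  have hv : ∀ τ ∈ Ico r t, LipschitzOnWith K.toNNReal (fun x => B τ x) univ := by
    intro τ hτ
    refine ((B τ).lipschitz.weaken ?_).lipschitzOnWith
    rw [← NNReal.coe_le_coe, coe_nnnorm, Real.coe_toNNReal']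
    exact (hK τ hτ).trans (le_max_left _ _)
  exact ODE_solution_unique_of_mem_Icc_right hv hf hf' (fun _ _ => mem_univ _) hg hg'
    (fun _ _ => mem_univ _) h ⟨hrt, le_rfl⟩

theorem IsDissipative.exists_norm_le (hF : IsNormFamily Fam M)
    (hB : IsDissipative a b Fam ω' B) : ∃ K, 0 ≤ K ∧ ∀ t ∈ Ioc a b, ‖B t‖ ≤ K := by
  obtain ⟨Λ, hΛ, hp, hd⟩ := hB.diss
  have hM0 : 0 ≤ M := (norm_nonneg _).trans (hF.norm_le 0 1 (hF.one_mem 0))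
  refine ⟨(Λ + ω') * M + Λ, by positivity, fun t ht => ?_⟩
  refine ContinuousLinearMap.opNorm_le_bound _ (by positivity) fun x => ?_
  have h1 := hd t ht x (M * ‖x‖) (fun Q hQ => Q.le_of_opNorm_le (hF.norm_le t Q hQ) x) 1
    (hF.one_mem t)
  have h2 : B t x = (1 : X →L[ℝ] X) (B t x + Λ • x) - Λ • x := by simp
  rw [h2]
  refine (norm_sub_le _ _).trans ?_
  rw [norm_smul, Real.norm_of_nonneg hΛ]
  linarith

theorem IsDissipative.exists_evolves [CompleteSpace X] (hF : IsNormFamily Fam M)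
    (hB : IsDissipative a b Fam ω' B) : ∃ U, Evolves a b Fam ω' B U := by
  obtain ⟨K, hK0, hK⟩ := hB.exists_norm_le hF
  obtain ⟨Λ, hΛ, hp, hd⟩ := hB.diss
  have hM0 : 0 ≤ M := (norm_nonneg _).trans (hF.norm_le 0 1 (hF.one_mem 0))
  have hPc : ∀ x, ContinuousOn (fun t => (B t + Λ • (1 : X →L[ℝ] X)) x) (Ioc a b) := fun x => by
    exact (hB.cont x).add (continuousOn_const (c := Λ • x))
  have hPK : ∀ t ∈ Ioc a b, ‖B t + Λ • (1 : X →L[ℝ] X)‖ ≤ K + Λ * 1 := fun t ht => by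
    refine (norm_add_le _ _).trans (add_le_add (hK t ht) ?_)
    rw [norm_smul, Real.norm_of_nonneg hΛ]
    exact mul_le_mul_of_nonneg_left ContinuousLinearMap.norm_id_le hΛ
  have hPd : ∀ t ∈ Ioc a b, ∀ z ρ, (∀ Q ∈ Fam t, ‖Q z‖ ≤ ρ) → ∀ Q ∈ Fam t,
      ‖Q ((B t + Λ • (1 : X →L[ℝ] X)) z)‖ ≤ (Λ + ω') * ρ := fun t ht z ρ hz Q hQ => by
    simpa using hd t ht z ρ hz Q hQ
  have hex := fun (s : ℝ) (hs : s ∈ Ioc a b) => exists_series_solution hF hp hPc hPK hPd hs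
  choose! V hVc hV0 hV' hVn using hex
  have hVM : ∀ s ∈ Ioc a b, ∀ t ∈ Icc s b, ∀ x,
      ‖(exp (-Λ * (t - s)) • V s t) x‖
        ≤ (exp (-Λ * (t - s)) * (M * exp ((Λ + ω') * (t - s)))) * ‖x‖ := by
    intro s hs t ht x
    have := hVn s hs t ht x (M * ‖x‖) (fun Q hQ => Q.le_of_opNorm_le (hF.norm_le s Q hQ) x) 1
      (hF.one_mem t)
    rw [LinearMap.smul_apply, norm_smul, Real.norm_of_nonneg (exp_pos _).le, mul_assoc]
    refine mul_le_mul_of_nonneg_left ?_ (exp_pos _).le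
    rw [ContinuousLinearMap.one_apply] at this
    linarith
  have hU : ∃ U : ℝ → ℝ → X →L[ℝ] X, (∀ s ∈ Ioc a b, ∀ t ∈ Icc s b, ∀ x,
      U t s x = exp (-Λ * (t - s)) • V s t x) ∧
      ∀ t s, ¬ (a < s ∧ s ≤ t ∧ t ≤ b) → U t s = 0 := by
    refine ⟨fun t s => if h : a < s ∧ s ≤ t ∧ t ≤ b then
      (exp (-Λ * (t - s)) • V s t).mkContinuous _
        (hVM s (mem_Ioc.2 ⟨h.1, h.2.1.trans h.2.2⟩) t (mem_Icc.2 h.2)) else 0, fun s hs t ht x => ?_, fun t s h => ?_⟩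
    · have h : a < s ∧ s ≤ t ∧ t ≤ b := ⟨hs.1, ht⟩
      simp only [dif_pos h]
      rfl
    · exact dif_neg h
  obtain ⟨U, hU, hU0⟩ := hU
  have hexp (s t : ℝ) : HasDerivAt (fun τ => exp (-Λ * (τ - s))) (-Λ * exp (-Λ * (t - s))) t := by
    have h1 : HasDerivAt (fun τ => -Λ * (τ - s)) (-Λ * 1) t :=
      ((hasDerivAt_id t).sub_const s).const_mul (-Λ)
    simpa [mul_comm] using h1.exp
  have hcont : ∀ s ∈ Ioc a b, ∀ x, ContinuousOn (fun t => U t s x) (Icc s b) := fun s hs x => by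
    refine ContinuousOn.congr (f := fun t => exp (-Λ * (t - s)) • V s t x) ?_
      fun t ht => hU s hs t ht x
    exact ContinuousOn.smul (by fun_prop) (hVc s hs x)
  have hrefl : ∀ s ∈ Ioc a b, U s s = 1 := fun s hs => by
    ext x
    rw [hU s hs s ⟨le_rfl, hs.2⟩, hV0 s hs]
    simp
  have hderiv : ∀ s ∈ Ioc a b, ∀ x, ∀ t ∈ Ico s b,
      HasDerivWithinAt (fun τ => U τ s x) (B t (U t s x)) (Ici t) t := by
    intro s hs x t ht
    have h1 := (hexp s t).hasDerivWithinAt (s := Ici t) |>.smul (hV' s hs x t ht)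
    have h2 : exp (-Λ * (t - s)) • (B t + Λ • (1 : X →L[ℝ] X)) (V s t x)
        + (-Λ * exp (-Λ * (t - s))) • V s t x = B t (U t s x) := by
      rw [hU s hs t ⟨ht.1, ht.2.le⟩]
      simp only [ContinuousLinearMap.add_apply, ContinuousLinearMap.smul_apply,
        ContinuousLinearMap.one_apply, map_smul]
      module
    rw [h2] at h1
    refine h1.congr_of_eventuallyEq ?_ (hU s hs t ⟨ht.1, ht.2.le⟩ x)
    filter_upwards [Icc_mem_nhdsGE ht.2] with τ hτ
    exact hU s hs τ ⟨ht.1.trans hτ.1, hτ.2⟩ x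
  refine ⟨U, hU0, hrefl, hcont, hderiv, ?_, ?_⟩
  · intro s r t hs hsr hrt htb
    ext x
    have hr : r ∈ Ioc a b := ⟨hs.trans_le hsr, hrt.trans htb⟩
    have hs' : s ∈ Ioc a b := ⟨hs, hsr.trans hr.2⟩
    refine (eq_of_hasDerivWithinAt_apply (B := B) hrt
      (fun τ hτ => hK τ ⟨hr.1.trans_le hτ.1, hτ.2.le.trans htb⟩)
      ((hcont s hs' x).mono (Icc_subset_Icc hsr htb))
      (fun τ hτ => hderiv s hs' x τ ⟨hsr.trans hτ.1, hτ.2.trans_le htb⟩)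
      ((hcont r hr (U r s x)).mono (Icc_subset_Icc le_rfl htb))
      (fun τ hτ => hderiv r hr (U r s x) τ ⟨hτ.1, hτ.2.trans_le htb⟩) ?_).symm
    rw [hrefl r hr]; rfl
  · intro s t hs hst htb z ρ hz Q hQ
    have := hVn s ⟨hs, hst.trans htb⟩ t ⟨hst, htb⟩ z ρ hz Q hQ
    rw [hU s ⟨hs, hst.trans htb⟩ t ⟨hst, htb⟩, map_smul, norm_smul,
      Real.norm_of_nonneg (exp_pos _).le]
    refine (mul_le_mul_of_nonneg_left this (exp_pos _).le).trans (le_of_eq ?_)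
    rw [mul_left_comm, ← exp_add]
    ring_nf

namespace Evolves

theorem opNorm_le (hF : IsNormFamily Fam M) (hU : Evolves a b Fam ω' B U) {s t : ℝ} (hs : a < s)
    (hst : s ≤ t) (ht : t ≤ b) : ‖U t s‖ ≤ M * exp (ω' * (t - s)) := by
  have hM0 : 0 ≤ M := (norm_nonneg _).trans (hF.norm_le 0 1 (hF.one_mem 0))
  refine ContinuousLinearMap.opNorm_le_bound _ (by positivity) fun x => ?_
  have := hU.norm_le s t hs hst ht x (M * ‖x‖)
    (fun Q hQ => Q.le_of_opNorm_le (hF.norm_le s Q hQ) x) 1 (hF.one_mem t)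
  rw [ContinuousLinearMap.one_apply] at this
  linarith

theorem opNorm_le_of_le (hF : IsNormFamily Fam M) (hU : Evolves a b Fam ω' B U) {w : ℝ}
    (hw : 0 ≤ w) (hω : ω' ≤ w) (t s : ℝ) : ‖U t s‖ ≤ M * exp (w * (b - a)) := by
  have hM0 : 0 ≤ M := (norm_nonneg _).trans (hF.norm_le 0 1 (hF.one_mem 0))
  by_cases h : a < s ∧ s ≤ t ∧ t ≤ b
  · refine (hU.opNorm_le hF h.1 h.2.1 h.2.2).trans ?_
    have h1 : 0 ≤ t - s := by linarith
    have h2 : t - s ≤ b - a := by linarith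
    gcongr
  · rw [hU.zero_off t s h, norm_zero]
    positivity

theorem eq_of_eqOn (hF : IsNormFamily Fam M) (hB : IsDissipative a b Fam ω' B)
    (hU : Evolves a b Fam ω' B U) (hU' : Evolves a b Fam ω' B' U') {s t : ℝ} (hs : a < s)
    (hst : s ≤ t) (ht : t ≤ b) (h : ∀ τ ∈ Ico s t, B' τ = B τ) : U' t s = U t s := by
  obtain ⟨K, -, hK⟩ := hB.exists_norm_le hF
  ext x
  have hs' : s ∈ Ioc a b := ⟨hs, hst.trans ht⟩
  refine (eq_of_hasDerivWithinAt_apply (B := B) hst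
      (fun τ hτ => hK τ ⟨hs.trans_le hτ.1, hτ.2.le.trans ht⟩)
      ((hU'.cont s hs' x).mono (Icc_subset_Icc le_rfl ht))
      (fun τ hτ => ?_)
      ((hU.cont s hs' x).mono (Icc_subset_Icc le_rfl ht))
      (fun τ hτ => hU.deriv s hs' x τ ⟨hτ.1, hτ.2.trans_le ht⟩) ?_)
  · rw [← h τ hτ]
    exact hU'.deriv s hs' x τ ⟨hτ.1, hτ.2.trans_le ht⟩
  · rw [hU.refl s hs', hU'.refl s hs']

theorem integral_eq [CompleteSpace X] (hF : IsNormFamily Fam M) (hB : IsDissipative a b Fam ω' B)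
    (hU : Evolves a b Fam ω' B U) {s t : ℝ} (hs : a < s) (hst : s ≤ t) (ht : t ≤ b) (x : X) :
    U t s x = x + ∫ τ in s..t, B τ (U τ s x) := by
  obtain ⟨K, -, hK⟩ := hB.exists_norm_le hF
  have hs' : s ∈ Ioc a b := ⟨hs, hst.trans ht⟩
  have hI : Icc s b ⊆ Ioc a b := fun t ht => ⟨hs.trans_le ht.1, ht.2⟩
  have h1 : ContinuousOn (fun τ => B τ (U τ s x)) (Icc s b) :=
    continuousOn_apply_of_norm_le (fun x => (hB.cont x).mono hI) (fun τ hτ => hK τ (hI hτ))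
      (hU.cont s hs' x)
  rw [intervalIntegral.integral_eq_sub_of_hasDeriv_right_of_le hst
    ((hU.cont s hs' x).mono (Icc_subset_Icc le_rfl ht))
    (fun τ hτ => (hU.deriv s hs' x τ ⟨hτ.1.le, hτ.2.trans_le ht⟩).mono Ioi_subset_Ici_self)
    (intervalIntegrable_of_continuousOn_Icc h1 ⟨hst, ht⟩), hU.refl s hs']
  simp

variable {C : ℝ}

theorem norm_sub_self_le (hU : Evolves a b Fam ω' B U) (hC : ∀ t s, ‖U t s‖ ≤ C) {K : ℝ}
    (hK : ∀ t ∈ Ioc a b, ‖B t‖ ≤ K) (hK0 : 0 ≤ K) {s t : ℝ} (hs : a < s) (hst : s ≤ t)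
    (ht : t ≤ b) (x : X) : ‖U t s x - x‖ ≤ K * (C * ‖x‖) * (t - s) := by
  have hs' : s ∈ Ioc a b := ⟨hs, hst.trans ht⟩
  have := norm_image_sub_le_of_norm_deriv_right_le_segment (C := K * (C * ‖x‖))
    ((hU.cont s hs' x).mono (Icc_subset_Icc le_rfl ht))
    (fun τ hτ => hU.deriv s hs' x τ ⟨hτ.1, hτ.2.trans_le ht⟩) (fun τ hτ => ?_) t ⟨hst, le_rfl⟩
  · simpa [hU.refl s hs'] using this
  · exact ((B τ).le_of_opNorm_le (hK τ ⟨hs.trans_le hτ.1, hτ.2.le.trans ht⟩) _).trans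
      (mul_le_mul_of_nonneg_left ((U τ s).le_of_opNorm_le (hC τ s) x) hK0)

theorem continuousOn_left_arg (hU : Evolves a b Fam ω' B U) (hC : ∀ t s, ‖U t s‖ ≤ C)
    (hF : IsNormFamily Fam M) (hB : IsDissipative a b Fam ω' B) {s t : ℝ} (hs : a < s)
    (ht : t ≤ b) (x : X) : ContinuousOn (fun σ => U t σ x) (Icc s t) := by
  obtain ⟨K, hK0, hK⟩ := hB.exists_norm_le hF
  have key : ∀ σ ∈ Icc s t, ∀ σ' ∈ Icc s t, σ ≤ σ' →
      ‖U t σ x - U t σ' x‖ ≤ C * (K * (C * ‖x‖)) * (σ' - σ) := by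
    intro σ hσ σ' hσ' h
    rw [← hU.comp σ σ' t (hs.trans_le hσ.1) h hσ'.2 ht, ContinuousLinearMap.comp_apply, ← map_sub]
    refine ((U t σ').le_of_opNorm_le (hC t σ') _).trans ?_
    rw [mul_assoc]
    exact mul_le_mul_of_nonneg_left (hU.norm_sub_self_le hC hK hK0 (hs.trans_le hσ.1) h
      (hσ'.2.trans ht) x) ((norm_nonneg _).trans (hC t t))
  have hL : LipschitzOnWith (C * (K * (C * ‖x‖))).toNNReal (fun σ => U t σ x) (Icc s t) := by
    refine LipschitzOnWith.of_dist_le_mul fun σ hσ σ' hσ' => ?_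
    have hC0 : 0 ≤ C := (norm_nonneg _).trans (hC t t)
    rw [Real.coe_toNNReal _ (by positivity), dist_eq_norm, Real.dist_eq]
    rcases le_total σ σ' with h | h
    · rw [abs_sub_comm, abs_of_nonneg (sub_nonneg.2 h)]
      exact key σ hσ σ' hσ' h
    · rw [norm_sub_rev, abs_of_nonneg (sub_nonneg.2 h)]
      exact key σ' hσ' σ hσ h
  exact hL.continuousOn

theorem hasDerivWithinAt_left_arg (hU : Evolves a b Fam ω' B U) (hC : ∀ t s, ‖U t s‖ ≤ C)
    (hF : IsNormFamily Fam M) (hB : IsDissipative a b Fam ω' B) {s t : ℝ} (hs : a < s)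
    (hst : s < t) (ht : t ≤ b) (x : X) :
    HasDerivWithinAt (fun σ => U t σ x) (-(U t s (B s x))) (Ici s) s := by
  have hs' : s ∈ Ioc a b := ⟨hs, hst.le.trans ht⟩
  have h1 : Tendsto (slope (fun τ => U τ s x) s) (𝓝[>] s) (𝓝 (B s x)) := by
    have := hU.deriv s hs' x s ⟨le_rfl, hst.trans_le ht⟩
    rw [hU.refl s hs', ContinuousLinearMap.one_apply, hasDerivWithinAt_iff_tendsto_slope,
      Ici_sdiff_left] at this
    exact this
  have h2 : ContinuousWithinAt (fun σ => U t σ (Function.update (slope (fun τ => U τ s x) s) s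
      (B s x) σ)) (Ici s) s := by
    refine continuousWithinAt_apply_of_norm_le (P := fun σ => U t σ) ?_ (fun σ _ => hC t σ) ?_
    · exact (hU.continuousOn_left_arg hC hF hB hs ht _ s ⟨le_rfl, hst.le⟩).mono_of_mem_nhdsWithin
        (Icc_mem_nhdsGE hst)
    · rw [continuousWithinAt_update_same, Ici_sdiff_left]
      exact h1
  rw [hasDerivWithinAt_iff_tendsto_slope, Ici_sdiff_left]
  have h3 : Tendsto (fun σ => -U t σ (slope (fun τ => U τ s x) s σ)) (𝓝[>] s)
      (𝓝 (-(U t s (B s x)))) := by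
    have h4 := (h2.mono Ioi_subset_Ici_self).tendsto
    simp only [Function.update_self] at h4
    refine h4.neg.congr' ?_
    filter_upwards [self_mem_nhdsWithin] with σ hσ
    rw [Function.update_of_ne (ne_of_gt hσ)]
  refine h3.congr' ?_
  filter_upwards [Ioo_mem_nhdsGT hst] with σ hσ
  have h5 := congrArg (fun T : X →L[ℝ] X => T x) (hU.comp s σ t hs hσ.1.le hσ.2.le ht)
  simp only [ContinuousLinearMap.comp_apply] at h5
  simp only [slope_def_module, map_smul, map_sub, h5, hU.refl s hs',
    ContinuousLinearMap.one_apply]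
  rw [← smul_neg, neg_sub]

theorem norm_sub_left_le (hU : Evolves a b Fam ω' B U) (hC : ∀ t s, ‖U t s‖ ≤ C)
    (hF : IsNormFamily Fam M) (hB : IsDissipative a b Fam ω' B) {s s' t : ℝ} (hs : a < s)
    (hss : s ≤ s') (hst : s' ≤ t) (ht : t ≤ b) {x : X} {m : ℝ}
    (hm : ∀ τ ∈ Ioc a b, ‖B τ x‖ ≤ m) : ‖U t s' x - U t s x‖ ≤ C * m * (s' - s) := by
  refine norm_image_sub_le_of_norm_deriv_right_le_segment (C := C * m)
    ((hU.continuousOn_left_arg hC hF hB hs ht x).mono (Icc_subset_Icc_right hst))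
    (fun σ hσ => hU.hasDerivWithinAt_left_arg hC hF hB (hs.trans_le hσ.1) (hσ.2.trans_le hst) ht x)
    (fun σ hσ => ?_) s' ⟨hss, le_rfl⟩
  rw [norm_neg]
  exact ((U t σ).le_of_opNorm_le (hC t σ) _).trans (mul_le_mul_of_nonneg_left
    (hm σ ⟨hs.trans_le hσ.1, (hσ.2.le.trans hst).trans ht⟩) ((norm_nonneg _).trans (hC t t)))

theorem abs_dual_sub_le (hU : Evolves a b Fam ω' B U) (hC : ∀ t s, ‖U t s‖ ≤ C) {s t t' : ℝ}
    (hs : a < s) (hst : s ≤ t) (htt : t ≤ t') (ht : t' ≤ b) {ψ : StrongDual ℝ X} {m : ℝ}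
    (hm0 : 0 ≤ m) (hm : ∀ τ ∈ Ioc a b, ∀ z, |ψ (B τ z)| ≤ m * ‖z‖) (x : X) :
    |ψ (U t' s x) - ψ (U t s x)| ≤ m * (C * ‖x‖) * (t' - t) := by
  have hs' : s ∈ Ioc a b := ⟨hs, (hst.trans htt).trans ht⟩
  refine norm_image_sub_le_of_norm_deriv_right_le_segment (C := m * (C * ‖x‖))
    (f := fun τ => ψ (U τ s x)) (f' := fun τ => ψ (B τ (U τ s x)))
    (ψ.continuous.comp_continuousOn ((hU.cont s hs' x).mono (Icc_subset_Icc hst ht)))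
    (fun τ hτ => ?_) (fun τ hτ => ?_) t' ⟨htt, le_rfl⟩
  · exact ψ.hasFDerivAt.comp_hasDerivWithinAt τ
      (hU.deriv s hs' x τ ⟨hst.trans hτ.1, hτ.2.trans_le ht⟩)
  · exact (hm τ ⟨(hs.trans_le hst).trans_le hτ.1, hτ.2.le.trans ht⟩ _).trans
      (mul_le_mul_of_nonneg_left ((U τ s).le_of_opNorm_le (hC τ s) x) hm0)

theorem norm_sub_sub_smul_le (hU : Evolves a b Fam ω' B U) (hC : ∀ t s, ‖U t s‖ ≤ C)
    (hF : IsNormFamily Fam M) (hB : IsDissipative a b Fam ω' B) {s t : ℝ} (hs : a < s)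
    (hst : s ≤ t) (ht : t ≤ b) {x z : X} {m K : ℝ} (hm : ∀ τ ∈ Icc s t, ‖B τ x - z‖ ≤ m)
    (hK : ∀ τ ∈ Ioc a b, ‖B τ z‖ ≤ K) :
    ‖U t s x - x - (t - s) • z‖ ≤ (C * m + C * K * (t - s)) * (t - s) := by
  have hC0 : 0 ≤ C := (norm_nonneg _).trans (hC t t)
  have htI : t ∈ Ioc a b := ⟨hs.trans_le hst, ht⟩
  have hK0 : 0 ≤ K := (norm_nonneg _).trans (hK t htI)
  have := norm_image_sub_le_of_norm_deriv_right_le_segment (C := C * m + C * K * (t - s))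
    (f := fun σ => U t σ x + σ • z) (f' := fun σ => -(U t σ (B σ x)) + (1 : ℝ) • z)
    (((hU.continuousOn_left_arg hC hF hB hs ht x)).add (by fun_prop))
    (fun σ hσ => (hU.hasDerivWithinAt_left_arg hC hF hB (hs.trans_le hσ.1) hσ.2 ht x).add
      ((hasDerivWithinAt_id σ _).smul_const z))
    (fun σ hσ => ?_) t ⟨hst, le_rfl⟩
  · rw [hU.refl t htI] at this
    simp only [ContinuousLinearMap.one_apply] at this
    rw [← norm_neg]
    have h2 : -(U t s x - x - (t - s) • z) = x + t • z - (U t s x + s • z) := by module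
    rw [h2]
    exact this
  · have h1 : -(U t σ (B σ x)) + (1 : ℝ) • z = -(U t σ (B σ x - z)) + (U t t z - U t σ z) := by
      rw [hU.refl t htI]
      simp only [map_sub, ContinuousLinearMap.one_apply]
      module
    rw [h1]
    refine (norm_add_le _ _).trans (add_le_add ?_ ?_)
    · rw [norm_neg]
      exact ((U t σ).le_of_opNorm_le (hC t σ) _).trans
        (mul_le_mul_of_nonneg_left (hm σ ⟨hσ.1, hσ.2.le⟩) hC0)
    · refine (hU.norm_sub_left_le hC hF hB (hs.trans_le hσ.1) hσ.2.le le_rfl ht hK).trans ?_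
      have := hσ.1
      gcongr

end Evolves

end EvolutionFamilies

section KatoStable

variable {X : Type*} [NormedAddCommGroup X] [NormedSpace ℝ X]

/-- `A t`, `t ∈ (a, b]`, is a family of densely defined operators with resolvents `Res lam t`,
`lam > ω`, satisfying Kato's stability condition. -/
structure IsKatoStable (a b : ℝ) (Dom : ℝ → Set X) (A : ℝ → X → X) (M ω : ℝ)
    (Res : ℝ → ℝ → X →L[ℝ] X) : Prop where
  dense : ∀ t ∈ Ioc a b, Dense (Dom t)
  one_le : 1 ≤ M
  res_mem : ∀ t ∈ Ioc a b, ∀ lam : ℝ, ω < lam → ∀ x : X,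
    Res lam t x ∈ Dom t ∧ lam • Res lam t x - A t (Res lam t x) = x
  res_inv : ∀ t ∈ Ioc a b, ∀ lam : ℝ, ω < lam → ∀ y ∈ Dom t,
    Res lam t (lam • y - A t y) = y
  stable : ∀ (k : ℕ) (ts : Fin k → ℝ), (∀ i, ts i ∈ Ioc a b) →
    Monotone ts → ∀ lam : ℝ, ω < lam →
      ‖((List.ofFn fun i => Res lam (ts i)).reverse).prod‖ ≤ M * ((lam - ω) ^ k)⁻¹

/-- Products of normalized resolvents `(μ - ω) R(μ, A τ)`, `μ ∈ S`, at increasing times `τ ≥ t`,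
the operators at later times standing on the left. -/
inductive KatoProd (a b ω : ℝ) (Res : ℝ → ℝ → X →L[ℝ] X) (S : Set ℝ) : ℝ → (X →L[ℝ] X) → Prop
  | one (t : ℝ) : KatoProd a b ω Res S t 1
  | mul {t τ μ : ℝ} {Q : X →L[ℝ] X} : KatoProd a b ω Res S τ Q → τ ∈ Ioc a b → t ≤ τ → μ ∈ S →
      KatoProd a b ω Res S t (Q * ((μ - ω) • Res μ τ))

/-- The operators defining Kato's norms. -/
def katoFam (a b ω : ℝ) (Res : ℝ → ℝ → X →L[ℝ] X) (t : ℝ) : Set (X →L[ℝ] X) :=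
  {Q | KatoProd a b ω Res (Ioi ω) t Q}

variable {a b M ω : ℝ} {Dom : ℝ → Set X} {A : ℝ → X → X} {Res : ℝ → ℝ → X →L[ℝ] X}

theorem KatoProd.anti {S : Set ℝ} {s t : ℝ} {Q : X →L[ℝ] X} (h : KatoProd a b ω Res S t Q)
    (hst : s ≤ t) : KatoProd a b ω Res S s Q := by
  cases h with
  | one => exact .one s
  | mul hQ hτ ht hμ => exact .mul hQ hτ (hst.trans ht) hμ

theorem KatoProd.exists_eq_prod {Λ t : ℝ} {Q : X →L[ℝ] X} (h : KatoProd a b ω Res {Λ} t Q) :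
    ∃ (k : ℕ) (ts : Fin k → ℝ), (∀ i, ts i ∈ Ioc a b) ∧ (∀ i, t ≤ ts i) ∧ Monotone ts ∧
      Q = (Λ - ω) ^ k • ((List.ofFn fun i => Res Λ (ts i)).reverse).prod := by
  induction h with
  | one t => exact ⟨0, Fin.elim0, fun i => i.elim0, fun i => i.elim0, fun i => i.elim0, by simp⟩
  | @mul t τ μ Q hQ hτ ht hμ ih =>
    obtain ⟨k, ts, h1, h2, h3, h4⟩ := ih
    obtain rfl : μ = Λ := hμ
    refine ⟨k + 1, Fin.cons τ ts, ?_, ?_, ?_, ?_⟩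
    · exact Fin.cases hτ h1
    · exact Fin.cases ht fun i => ht.trans (h2 i)
    · intro i j hij
      induction i using Fin.cases with
      | zero => exact Fin.cases le_rfl h2 j
      | succ i =>
        induction j using Fin.cases with
        | zero => exact absurd hij (by simp [Fin.le_def])
        | succ j => exact h3 (Fin.succ_le_succ_iff.1 hij)
    · rw [h4, List.ofFn_succ]
      simp only [Fin.cons_zero, Fin.cons_succ, List.reverse_cons, List.prod_append,
        List.prod_singleton]
      rw [smul_mul_smul_comm, pow_succ]

namespace IsKatoStable

theorem res_eq (h : IsKatoStable a b Dom A M ω Res) {t lam μ : ℝ} (ht : t ∈ Ioc a b)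
    (hl : ω < lam) (hμ : ω < μ) (x : X) :
    Res lam t (x + (lam - μ) • Res μ t x) = Res μ t x := by
  obtain ⟨h1, h2⟩ := h.res_mem t ht μ hμ x
  have h3 := h.res_inv t ht lam hl _ h1
  have h4 : lam • Res μ t x - A t (Res μ t x) = x + (lam - μ) • Res μ t x := by
    nth_rw 3 [← h2]
    module
  rwa [h4] at h3

theorem norm_katoProd_singleton_le (h : IsKatoStable a b Dom A M ω Res) {Λ t : ℝ} (hΛ : ω < Λ)
    {Q : X →L[ℝ] X} (hQ : KatoProd a b ω Res {Λ} t Q) : ‖Q‖ ≤ M := by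
  obtain ⟨k, ts, h1, -, h3, rfl⟩ := hQ.exists_eq_prod
  have hpos : 0 < Λ - ω := sub_pos.2 hΛ
  rw [norm_smul, norm_pow, Real.norm_of_nonneg hpos.le]
  refine (mul_le_mul_of_nonneg_left (h.stable k ts h1 h3 Λ hΛ) (by positivity)).trans
    (le_of_eq ?_)
  field_simp

theorem exists_forall_norm_katoProd_le (h : IsKatoStable a b Dom A M ω Res) {t : ℝ}
    {Q : X →L[ℝ] X} (hQ : KatoProd a b ω Res (Ioi ω) t Q) :
    ∃ Λ₀, ∀ Λ, Λ₀ ≤ Λ → ω < Λ → ∀ x ρ, (∀ P, KatoProd a b ω Res {Λ} t P → ‖P x‖ ≤ ρ) →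
      ‖Q x‖ ≤ ρ := by
  induction hQ with
  | one t => exact ⟨0, fun Λ _ _ x ρ hx => hx 1 (.one t)⟩
  | @mul t τ μ Q hQ hτ ht hμ ih =>
    obtain ⟨Λ₀, ih⟩ := ih
    refine ⟨max Λ₀ μ, fun Λ hΛ hΛω x ρ hx => ?_⟩
    have hμ' : 0 < μ - ω := sub_pos.2 hμ
    have hΛ' : 0 < Λ - ω := sub_pos.2 hΛω
    refine ih Λ ((le_max_left _ _).trans hΛ) hΛω ((μ - ω) • Res μ τ x) ρ fun P hP => ?_
    set z := Res μ τ x with hz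
    set T : Set ℝ := {r | ∃ P, KatoProd a b ω Res {Λ} τ P ∧ r = ‖P z‖} with hT
    have hTb : BddAbove T := by
      refine ⟨M * ‖z‖, ?_⟩
      rintro r ⟨P, hP, rfl⟩
      exact P.le_of_opNorm_le (h.norm_katoProd_singleton_le hΛω hP) z
    have hle : ∀ P, KatoProd a b ω Res {Λ} τ P → ‖P z‖ ≤ sSup T :=
      fun P hP => le_csSup hTb ⟨P, hP, rfl⟩
    have hS : sSup T ≤ (ρ + (Λ - μ) * sSup T) / (Λ - ω) := by
      refine csSup_le ⟨_, 1, .one τ, rfl⟩ ?_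
      rintro r ⟨P, hP, rfl⟩
      have hP' := KatoProd.mul hP hτ le_rfl (mem_singleton Λ)
      rw [le_div_iff₀ hΛ']
      have h1 : ‖P z‖ * (Λ - ω) = ‖(P * ((Λ - ω) • Res Λ τ)) (x + (Λ - μ) • z)‖ := by
        simp only [ContinuousLinearMap.mul_apply, ContinuousLinearMap.smul_apply]
        rw [hz, h.res_eq hτ hΛω hμ, map_smul, norm_smul, Real.norm_of_nonneg hΛ'.le, mul_comm]
      rw [h1, map_add, map_smul]
      refine (norm_add_le _ _).trans (add_le_add (hx _ (hP'.anti ht)) ?_)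
      have h2 : 0 ≤ Λ - μ := sub_nonneg.2 ((le_max_right _ _).trans hΛ)
      rw [norm_smul, Real.norm_of_nonneg h2]
      exact mul_le_mul_of_nonneg_left (hle _ hP') h2
    rw [le_div_iff₀ hΛ'] at hS
    rw [map_smul, norm_smul, Real.norm_of_nonneg hμ'.le]
    have := mul_le_mul_of_nonneg_left (hle P hP) hμ'.le
    nlinarith

theorem isNormFamily (h : IsKatoStable a b Dom A M ω Res) :
    IsNormFamily (katoFam a b ω Res) M where
  one_mem t := .one t
  anti _ _ hst _ hQ := KatoProd.anti hQ hst
  norm_le t Q hQ := by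
    obtain ⟨Λ₀, hΛ⟩ := h.exists_forall_norm_katoProd_le hQ
    refine ContinuousLinearMap.opNorm_le_bound _ (zero_le_one.trans h.one_le) fun x => ?_
    have hm : ω < max Λ₀ (ω + 1) := (lt_add_one ω).trans_le (le_max_right _ _)
    exact hΛ (max Λ₀ (ω + 1)) (le_max_left _ _) hm x _ fun P hP =>
      P.le_of_opNorm_le (h.norm_katoProd_singleton_le hm hP) x

theorem norm_res_apply_le {t μ : ℝ} (ht : t ∈ Ioc a b) (hμ : ω < μ) {z : X} {ρ : ℝ}
    (hz : ∀ Q ∈ katoFam a b ω Res t, ‖Q z‖ ≤ ρ) {Q : X →L[ℝ] X} (hQ : Q ∈ katoFam a b ω Res t) :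
    ‖Q (Res μ t z)‖ ≤ ρ / (μ - ω) := by
  have hμ' : 0 < μ - ω := sub_pos.2 hμ
  have := hz _ (KatoProd.mul hQ ht le_rfl hμ)
  rw [ContinuousLinearMap.mul_apply, ContinuousLinearMap.smul_apply, map_smul, norm_smul,
    Real.norm_of_nonneg hμ'.le] at this
  rw [le_div_iff₀ hμ']
  linarith

theorem norm_res_le (h : IsKatoStable a b Dom A M ω Res) {t μ : ℝ} (ht : t ∈ Ioc a b)
    (hμ : ω < μ) : ‖Res μ t‖ ≤ M / (μ - ω) := by
  have := h.stable 1 (fun _ => t) (fun _ => ht) (fun _ _ _ => le_rfl) μ hμ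
  simpa [div_eq_mul_inv] using this

theorem continuousOn_res (h : IsKatoStable a b Dom A M ω Res) {lam μ : ℝ} (hl : ω < lam)
    (hc : ∀ x, ContinuousOn (fun t => Res lam t x) (Ioc a b)) (hμ : ω < μ) (x : X) :
    ContinuousOn (fun t => Res μ t x) (Ioc a b) := by
  intro s hs
  set w := x + (lam - μ) • Res μ s x with hw
  have key : ∀ t ∈ Ioc a b, Res μ t x - Res μ s x
      = (Res lam t w - Res lam s w) + (lam - μ) • Res μ t (Res lam t w - Res lam s w) := by
    intro t ht
    have h1 (v : X) : Res μ t v = Res lam t v + (lam - μ) • Res μ t (Res lam t v) := by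
      have := h.res_eq ht hμ hl v
      rw [map_add, map_smul] at this
      linear_combination (norm := module) this
    have h2 : Res lam s w = Res μ s x := h.res_eq hs hl hμ x
    have h3 := h1 w
    rw [h2, map_sub, smul_sub, sub_add_sub_comm, ← h3, hw, map_add, map_smul]
    module
  have h0 : Tendsto (fun t => Res lam t w - Res lam s w) (𝓝[Ioc a b] s) (𝓝 0) := by
    have : Tendsto (fun t => Res lam t w - Res lam s w) (𝓝[Ioc a b] s)
      (𝓝 (Res lam s w - Res lam s w)) := (hc w s hs).sub_const (Res lam s w)
    rwa [sub_self] at this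
  have h1 : Tendsto (fun t => Res μ t x - Res μ s x) (𝓝[Ioc a b] s) (𝓝 0) := by
    have h2 : Tendsto (fun t => (1 + |lam - μ| * (M / (μ - ω))) * ‖Res lam t w - Res lam s w‖)
        (𝓝[Ioc a b] s) (𝓝 0) := by simpa using h0.norm.const_mul (1 + |lam - μ| * (M / (μ - ω)))
    refine squeeze_zero_norm' ?_ h2
    filter_upwards [self_mem_nhdsWithin] with t ht
    rw [key t ht]
    refine (norm_add_le _ _).trans ?_
    rw [norm_smul, Real.norm_eq_abs]
    have := mul_le_mul_of_nonneg_left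
      ((Res μ t).le_of_opNorm_le (h.norm_res_le ht hμ) (Res lam t w - Res lam s w))
      (abs_nonneg (lam - μ))
    linarith
  simpa [ContinuousWithinAt] using h1.add_const (Res μ s x)

end IsKatoStable

/-- The Yosida approximation `n² R(n, A t) - n` of `A t`. -/
noncomputable def yosida (Res : ℝ → ℝ → X →L[ℝ] X) (n t : ℝ) : X →L[ℝ] X :=
  n ^ 2 • Res n t - n • 1

namespace IsKatoStable

theorem yosida_isDissipative (h : IsKatoStable a b Dom A M ω Res) {lam n : ℝ} (hl : ω < lam)
    (hc : ∀ x, ContinuousOn (fun t => Res lam t x) (Ioc a b)) (hn : ω < n) (hn0 : 0 ≤ n) :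
    IsDissipative a b (katoFam a b ω Res) (ω + ω ^ 2 / (n - ω)) (yosida Res n) where
  cont x := by
    exact ((h.continuousOn_res hl hc hn x).const_smul (n ^ 2)).sub
      (continuousOn_const (c := n • x))
  diss := by
    have hn' : 0 < n - ω := sub_pos.2 hn
    have he : n + (ω + ω ^ 2 / (n - ω)) = n ^ 2 / (n - ω) := by
      field_simp
      ring
    refine ⟨n, hn0, by rw [he]; positivity, fun t ht z ρ hz Q hQ => ?_⟩
    have h1 : yosida Res n t z + n • z = n ^ 2 • Res n t z := by simp [yosida]
    rw [h1, map_smul, norm_smul, he, Real.norm_of_nonneg (by positivity), div_mul_eq_mul_div,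
      ← mul_div_assoc']
    exact mul_le_mul_of_nonneg_left (norm_res_apply_le ht hn hz hQ) (by positivity)

theorem yosida_apply_eq (h : IsKatoStable a b Dom A M ω Res) {n t : ℝ} (ht : t ∈ Ioc a b)
    (hn : ω < n) {y : X} (hy : y ∈ Dom t) : yosida Res n t y = n • Res n t (A t y) := by
  have h1 := h.res_inv t ht n hn y hy
  rw [map_sub, map_smul] at h1
  have h2 : yosida Res n t y = n • (n • Res n t y - y) := by
    simp only [yosida, ContinuousLinearMap.sub_apply, ContinuousLinearMap.smul_apply,
      ContinuousLinearMap.one_apply]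
    module
  rw [h2]
  congr 1
  nth_rw 2 [← h1]
  module

theorem smul_res_sub_eq (h : IsKatoStable a b Dom A M ω Res) {n t : ℝ} (ht : t ∈ Ioc a b)
    (hn : ω < n) {y : X} (hy : y ∈ Dom t) : n • Res n t y - y = Res n t (A t y) := by
  have h1 := h.res_inv t ht n hn y hy
  rw [map_sub, map_smul] at h1
  nth_rw 2 [← h1]
  module

theorem dual_yosida_apply_eq (h : IsKatoStable a b Dom A M ω Res) {n t : ℝ} (ht : t ∈ Ioc a b)
    (hn : ω < n) {v w : StrongDual ℝ X} (hvw : ∀ y ∈ Dom t, w y = v (A t y)) (x : X) :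
    v (yosida Res n t x) = n * w (Res n t x) := by
  obtain ⟨h1, h2⟩ := h.res_mem t ht n hn x
  have h3 : yosida Res n t x = n • A t (Res n t x) := by
    simp only [yosida, ContinuousLinearMap.sub_apply, ContinuousLinearMap.smul_apply,
      ContinuousLinearMap.one_apply]
    nth_rw 2 [← h2]
    module
  rw [h3, map_smul, hvw _ h1, smul_eq_mul]

theorem norm_smul_res_le (h : IsKatoStable a b Dom A M ω Res) {n t : ℝ} (ht : t ∈ Ioc a b)
    (hn : ω < n) (hn0 : 0 ≤ n) (hn2 : 2 * ω ≤ n) (x : X) : ‖n • Res n t x‖ ≤ 2 * M * ‖x‖ := by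
  have hn' : 0 < n - ω := sub_pos.2 hn
  have hM : 0 ≤ M := zero_le_one.trans h.one_le
  rw [norm_smul, Real.norm_of_nonneg hn0]
  have h1 := (Res n t).le_of_opNorm_le (h.norm_res_le ht hn) x
  have h2 : n * (M / (n - ω)) ≤ 2 * M := by
    rw [← mul_div_assoc, div_le_iff₀ hn']
    nlinarith
  calc n * ‖Res n t x‖ ≤ n * (M / (n - ω) * ‖x‖) := mul_le_mul_of_nonneg_left h1 hn0
    _ = n * (M / (n - ω)) * ‖x‖ := by ring
    _ ≤ _ := mul_le_mul_of_nonneg_right h2 (norm_nonneg _)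

theorem tendsto_smul_res (h : IsKatoStable a b Dom A M ω Res) {t : ℝ} (ht : t ∈ Ioc a b) (x : X) :
    Tendsto (fun n : ℝ => n • Res n t x) atTop (𝓝 x) := by
  have hM : 0 ≤ M := zero_le_one.trans h.one_le
  rw [Metric.tendsto_nhds]
  intro ε hε
  obtain ⟨y, hy, hxy⟩ := (h.dense t ht).exists_dist_lt x (ε := ε / (2 * (2 * M + 1)))
    (by positivity)
  have h1 : Tendsto (fun n : ℝ => M / (n - ω) * ‖A t y‖) atTop (𝓝 0) := by
    have h2 : Tendsto (fun n : ℝ => n - ω) atTop atTop := tendsto_atTop_add_const_right _ _ tendsto_id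
    simpa using (h2.const_div_atTop M).mul_const ‖A t y‖
  filter_upwards [h1.eventually_lt_const (half_pos hε), eventually_gt_atTop ω,
    eventually_ge_atTop 0, eventually_ge_atTop (2 * ω)] with n h1 h2 h3 h4
  have h5 : n • Res n t x - x = n • Res n t (x - y) + (n • Res n t y - y) - (x - y) := by
    rw [map_sub]
    module
  rw [dist_eq_norm] at hxy ⊢
  rw [h5, h.smul_res_sub_eq ht h2 hy]
  have h6 := h.norm_smul_res_le ht h2 h3 h4 (x - y)
  have h7 := (Res n t).le_of_opNorm_le (h.norm_res_le ht h2) (A t y)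
  have h8 : (2 * M + 1) * ‖x - y‖ < ε / 2 := by
    rw [lt_div_iff₀ (by positivity)] at hxy
    linarith
  have := norm_sub_le (n • Res n t (x - y) + Res n t (A t y)) (x - y)
  have := norm_add_le (n • Res n t (x - y)) (Res n t (A t y))
  linarith

end IsKatoStable

end KatoStable

/-- A Kato-stable family of operators on `(a, b]` with the auxiliary spaces `Y ↪ D(A t)` and
`Y' ↪ D((A t)*)`. -/
structure KatoSetting (X Y Y' : Type*) [NormedAddCommGroup X] [NormedSpace ℝ X]
    [NormedAddCommGroup Y] [NormedSpace ℝ Y] [NormedAddCommGroup Y'] [NormedSpace ℝ Y'] where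
  a : ℝ
  b : ℝ
  hab : a < b
  Dom : ℝ → Set X
  A : ℝ → X → X
  M : ℝ
  ω : ℝ
  Res : ℝ → ℝ → X →L[ℝ] X
  stable : IsKatoStable a b Dom A M ω Res
  lam : ℝ
  lt_lam : ω < lam
  continuousOn_res : ∀ x, ContinuousOn (fun t => Res lam t x) (Ioc a b)
  JY : Y →L[ℝ] X
  JY_dense : DenseRange JY
  JY_mem : ∀ t ∈ Ioc a b, ∀ y, JY y ∈ Dom t
  CY : ℝ
  CY_nonneg : 0 ≤ CY
  norm_A_le : ∀ t ∈ Ioc a b, ∀ y, ‖A t (JY y)‖ ≤ CY * ‖y‖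
  continuousOn_A : ∀ y, ContinuousOn (fun t => A t (JY y)) (Ioc a b)
  JY' : Y' →L[ℝ] StrongDual ℝ X
  JY'_dense : DenseRange JY'
  AS : ℝ → Y' → StrongDual ℝ X
  AS_apply : ∀ t ∈ Ioc a b, ∀ ψ, ∀ x ∈ Dom t, AS t ψ x = JY' ψ (A t x)
  CY' : ℝ
  CY'_nonneg : 0 ≤ CY'
  norm_AS_le : ∀ t ∈ Ioc a b, ∀ ψ, ‖AS t ψ‖ ≤ CY' * ‖ψ‖

namespace KatoSetting

variable {X Y Y' : Type*} [NormedAddCommGroup X] [NormedSpace ℝ X]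
    [NormedAddCommGroup Y] [NormedSpace ℝ Y] [NormedAddCommGroup Y'] [NormedSpace ℝ Y']
    (S : KatoSetting X Y Y')

/-- The parameters of the Yosida approximations. -/
noncomputable def freq (k : ℕ) : ℝ := k + (2 * |S.ω| + 1)

/-- The growth bounds of the Yosida approximations. -/
noncomputable def rate (k : ℕ) : ℝ := S.ω + S.ω ^ 2 / (S.freq k - S.ω)

/-- A common constant for the estimates of the Yosida approximations. -/
def c : ℝ := 2 * S.M * (1 + S.CY + S.CY')

/-- A common bound of the approximating evolution families. -/
noncomputable def C : ℝ := S.M * exp ((|S.ω| + S.ω ^ 2) * (S.b - S.a))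

/-- The sets of operators defining Kato's norms. -/
abbrev Fam : ℝ → Set (X →L[ℝ] X) := katoFam S.a S.b S.ω S.Res

theorem M_nonneg : 0 ≤ S.M := zero_le_one.trans S.stable.one_le

theorem M_pos : 0 < S.M := zero_lt_one.trans_le S.stable.one_le

theorem two_M_le_c : 2 * S.M ≤ S.c := by
  have := mul_nonneg S.M_nonneg S.CY_nonneg
  have := mul_nonneg S.M_nonneg S.CY'_nonneg
  unfold c
  linarith

theorem two_M_mul_CY_le_c : 2 * S.M * S.CY ≤ S.c := by
  have := mul_nonneg S.M_nonneg S.CY_nonneg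
  have := mul_nonneg S.M_nonneg S.CY'_nonneg
  have := S.M_nonneg
  unfold c
  linarith

theorem two_M_mul_CY'_le_c : 2 * S.M * S.CY' ≤ S.c := by
  have := mul_nonneg S.M_nonneg S.CY_nonneg
  have := mul_nonneg S.M_nonneg S.CY'_nonneg
  have := S.M_nonneg
  unfold c
  linarith

theorem c_pos : 0 < S.c := (mul_pos two_pos S.M_pos).trans_le S.two_M_le_c

theorem C_nonneg : 0 ≤ S.C := mul_nonneg S.M_nonneg (exp_pos _).le

theorem one_le_freq (k : ℕ) : 1 ≤ S.freq k := by
  have := abs_nonneg S.ω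
  have : (0 : ℝ) ≤ k := k.cast_nonneg
  unfold freq
  linarith

theorem one_le_freq_sub (k : ℕ) : 1 ≤ S.freq k - S.ω := by
  have := abs_nonneg S.ω
  have := le_abs_self S.ω
  have : (0 : ℝ) ≤ k := k.cast_nonneg
  unfold freq
  linarith

theorem lt_freq (k : ℕ) : S.ω < S.freq k := by linarith [S.one_le_freq_sub k]

theorem two_mul_le_freq (k : ℕ) : 2 * S.ω ≤ S.freq k := by
  have := le_abs_self S.ω
  have : (0 : ℝ) ≤ k := k.cast_nonneg
  unfold freq
  linarith

theorem freq_mono {k l : ℕ} (h : k ≤ l) : S.freq k ≤ S.freq l := by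
  unfold freq
  gcongr

theorem rate_anti {k l : ℕ} (h : k ≤ l) : S.rate l ≤ S.rate k := by
  have h1 := S.one_le_freq_sub k
  have := S.freq_mono h
  unfold rate
  gcongr

theorem rate_le (k : ℕ) : S.rate k ≤ |S.ω| + S.ω ^ 2 :=
  add_le_add (le_abs_self _) (div_le_self (sq_nonneg _) (S.one_le_freq_sub k))

theorem tendsto_freq : Tendsto S.freq atTop atTop :=
  tendsto_atTop_add_const_right _ _ tendsto_natCast_atTop_atTop

theorem tendsto_rate : Tendsto S.rate atTop (𝓝 S.ω) := by
  have h2 : Tendsto (fun k => S.freq k - S.ω) atTop atTop :=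
    tendsto_atTop_add_const_right _ _ S.tendsto_freq
  have h3 := (h2.const_div_atTop (S.ω ^ 2)).const_add S.ω
  rw [add_zero] at h3
  exact h3

theorem tendsto_inv_freq : Tendsto (fun k => (S.freq k)⁻¹) atTop (𝓝 0) :=
  tendsto_inv_atTop_zero.comp S.tendsto_freq

/-- Bounded operators with the properties shared by all Yosida approximations of index at
least `k`. -/
structure Admissible (k : ℕ) (B : ℝ → X →L[ℝ] X) : Prop where
  diss : IsDissipative S.a S.b S.Fam (S.rate k) B
  weak : ∀ t ∈ Ioc S.a S.b, ∀ ψ x, |S.JY' ψ (B t x)| ≤ S.c * ‖ψ‖ * ‖x‖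
  cons : ∀ t ∈ Ioc S.a S.b, ∀ y z,
    ‖B t (S.JY y) - S.JY z‖ ≤ S.c * (‖S.A t (S.JY y) - S.JY z‖ + (S.freq k)⁻¹ * ‖z‖)
  norm_le : ∀ t ∈ Ioc S.a S.b, ∀ x ∈ S.Dom t, ‖B t x‖ ≤ S.c * ‖S.A t x‖
  approx : ∀ t ∈ Ioc S.a S.b, ∀ x ∈ S.Dom t, ∀ ε,
    (∀ j, k ≤ j → ‖yosida S.Res (S.freq j) t x - S.A t x‖ ≤ ε) → ‖B t x - S.A t x‖ ≤ ε

theorem norm_freq_smul_res_le (k : ℕ) {t : ℝ} (ht : t ∈ Ioc S.a S.b) (x : X) :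
    ‖S.freq k • S.Res (S.freq k) t x‖ ≤ 2 * S.M * ‖x‖ :=
  S.stable.norm_smul_res_le ht (S.lt_freq k) (zero_le_one.trans (S.one_le_freq k))
    (S.two_mul_le_freq k) x

theorem admissible_yosida (k : ℕ) : S.Admissible k (yosida S.Res (S.freq k)) where
  diss := S.stable.yosida_isDissipative S.lt_lam S.continuousOn_res (S.lt_freq k)
    (zero_le_one.trans (S.one_le_freq k))
  weak t ht ψ x := by
    rw [S.stable.dual_yosida_apply_eq ht (S.lt_freq k) (S.AS_apply t ht ψ), ← smul_eq_mul,
      ← map_smul, ← Real.norm_eq_abs]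
    calc ‖S.AS t ψ (S.freq k • S.Res (S.freq k) t x)‖
        ≤ S.CY' * ‖ψ‖ * (2 * S.M * ‖x‖) :=
          (S.AS t ψ).le_of_opNorm_le_of_le (S.norm_AS_le t ht ψ) (S.norm_freq_smul_res_le k ht x)
      _ = 2 * S.M * S.CY' * ‖ψ‖ * ‖x‖ := by ring
      _ ≤ S.c * ‖ψ‖ * ‖x‖ := by
        have := S.two_M_mul_CY'_le_c
        gcongr
  cons t ht y z := by
    have hf := zero_lt_one.trans_le (S.one_le_freq k)
    rw [S.stable.yosida_apply_eq ht (S.lt_freq k) (S.JY_mem t ht y)]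
    have h1 : S.freq k • S.Res (S.freq k) t (S.A t (S.JY y)) - S.JY z
        = S.freq k • S.Res (S.freq k) t (S.A t (S.JY y) - S.JY z)
          + (S.freq k)⁻¹ • (S.freq k • S.Res (S.freq k) t (S.A t (S.JY z))) := by
      rw [smul_smul, inv_mul_cancel₀ hf.ne', one_smul,
        ← S.stable.smul_res_sub_eq ht (S.lt_freq k) (S.JY_mem t ht z), map_sub]
      module
    rw [h1, mul_add]
    refine (norm_add_le _ _).trans (add_le_add ?_ ?_)
    · exact (S.norm_freq_smul_res_le k ht _).trans
        (mul_le_mul_of_nonneg_right S.two_M_le_c (norm_nonneg _))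
    · rw [norm_smul, norm_inv, Real.norm_of_nonneg hf.le, mul_left_comm]
      refine mul_le_mul_of_nonneg_left ?_ (inv_nonneg.2 hf.le)
      calc ‖S.freq k • S.Res (S.freq k) t (S.A t (S.JY z))‖
          ≤ 2 * S.M * (S.CY * ‖z‖) := (S.norm_freq_smul_res_le k ht _).trans
            (mul_le_mul_of_nonneg_left (S.norm_A_le t ht z) (by linarith [S.M_nonneg]))
        _ = 2 * S.M * S.CY * ‖z‖ := by ring
        _ ≤ _ := mul_le_mul_of_nonneg_right S.two_M_mul_CY_le_c (norm_nonneg _)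
  norm_le t ht x hx := by
    rw [S.stable.yosida_apply_eq ht (S.lt_freq k) hx]
    exact (S.norm_freq_smul_res_le k ht _).trans
        (mul_le_mul_of_nonneg_right S.two_M_le_c (norm_nonneg _))
  approx _ _ _ _ _ h := h k le_rfl

variable {S}

theorem _root_.IsDissipative.mono {a b ω₁ ω₂ : ℝ} {Fam : ℝ → Set (X →L[ℝ] X)}
    {B : ℝ → X →L[ℝ] X} (hF : ∀ t, 1 ∈ Fam t)
    (h : IsDissipative a b Fam ω₁ B) (hω : ω₁ ≤ ω₂) : IsDissipative a b Fam ω₂ B where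
  cont := h.cont
  diss := by
    obtain ⟨Λ, h1, h2, h3⟩ := h.diss
    refine ⟨Λ, h1, by linarith, fun t ht z ρ hz Q hQ => (h3 t ht z ρ hz Q hQ).trans ?_⟩
    have : 0 ≤ ρ := (norm_nonneg _).trans (hz 1 (hF t))
    gcongr

theorem norm_convexCombo_le {E : Type*} [NormedAddCommGroup E] [NormedSpace ℝ E] {θ r : ℝ}
    (h0 : 0 ≤ θ) (h1 : θ ≤ 1) {x y : E} (hx : ‖x‖ ≤ r) (hy : ‖y‖ ≤ r) :
    ‖(1 - θ) • x + θ • y‖ ≤ r := by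
  have := convex_closedBall (0 : E) r (mem_closedBall_zero_iff.2 hx) (mem_closedBall_zero_iff.2 hy)
    (sub_nonneg.2 h1) h0 (by ring)
  exact mem_closedBall_zero_iff.1 this

theorem _root_.IsDissipative.convexCombo {a b ω' : ℝ} {Fam : ℝ → Set (X →L[ℝ] X)}
    {B B' : ℝ → X →L[ℝ] X} (hF : ∀ t, 1 ∈ Fam t)
    (hB : IsDissipative a b Fam ω' B) (hB' : IsDissipative a b Fam ω' B') {θ : ℝ → ℝ}
    (hθ : Continuous θ) (h0 : ∀ t, 0 ≤ θ t) (h1 : ∀ t, θ t ≤ 1) :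
    IsDissipative a b Fam ω' (fun t => (1 - θ t) • B t + θ t • B' t) where
  cont x := by
    exact ((continuousOn_const.sub hθ.continuousOn).smul (hB.cont x)).add
      (hθ.continuousOn.smul (hB'.cont x))
  diss := by
    obtain ⟨Λ, hΛ, hp, hd⟩ := hB.diss
    obtain ⟨Λ', hΛ', hp', hd'⟩ := hB'.diss
    have key {B : ℝ → X →L[ℝ] X} {Λ Λ₁ : ℝ} (hl : Λ ≤ Λ₁)
        (hd : ∀ t ∈ Ioc a b, ∀ z ρ, (∀ Q ∈ Fam t, ‖Q z‖ ≤ ρ) →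
          ∀ Q ∈ Fam t, ‖Q (B t z + Λ • z)‖ ≤ (Λ + ω') * ρ) :
        ∀ t ∈ Ioc a b, ∀ z ρ, (∀ Q ∈ Fam t, ‖Q z‖ ≤ ρ) →
          ∀ Q ∈ Fam t, ‖Q (B t z + Λ₁ • z)‖ ≤ (Λ₁ + ω') * ρ := by
      intro t ht z ρ hz Q hQ
      have h2 : Q (B t z + Λ₁ • z) = Q (B t z + Λ • z) + (Λ₁ - Λ) • Q z := by
        rw [← map_smul, ← map_add]
        congr 1
        module
      rw [h2]
      refine (norm_add_le _ _).trans ?_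
      rw [norm_smul, Real.norm_of_nonneg (sub_nonneg.2 hl)]
      have h3 := hd t ht z ρ hz Q hQ
      have h4 := mul_le_mul_of_nonneg_left (hz Q hQ) (sub_nonneg.2 hl)
      linarith
    refine ⟨max Λ Λ', hΛ.trans (le_max_left _ _),
      hp.trans (add_le_add_left (le_max_left _ _) _), fun t ht z ρ hz Q hQ => ?_⟩
    have h2 := key (le_max_left Λ Λ') hd t ht z ρ hz Q hQ
    have h3 := key (le_max_right Λ Λ') hd' t ht z ρ hz Q hQ
    have h4 : Q (((1 - θ t) • B t + θ t • B' t) z + max Λ Λ' • z)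
        = (1 - θ t) • Q (B t z + max Λ Λ' • z) + θ t • Q (B' t z + max Λ Λ' • z) := by
      rw [← map_smul, ← map_smul, ← map_add]
      congr 1
      simp only [ContinuousLinearMap.add_apply, ContinuousLinearMap.smul_apply]
      module
    rw [h4]
    exact norm_convexCombo_le (h0 t) (h1 t) h2 h3

namespace Admissible

variable {k l : ℕ} {B B' : ℝ → X →L[ℝ] X}

theorem mono (hB : S.Admissible l B) (h : k ≤ l) : S.Admissible k B where
  diss := hB.diss.mono S.stable.isNormFamily.one_mem (S.rate_anti h)
  weak := hB.weak
  cons t ht y z := (hB.cons t ht y z).trans <| by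
    have := S.freq_mono h
    have := S.one_le_freq k
    have := S.c_pos.le
    gcongr
  norm_le := hB.norm_le
  approx t ht x hx ε hε := hB.approx t ht x hx ε fun j hj => hε j (h.trans hj)

theorem convexCombo (hB : S.Admissible k B) (hB' : S.Admissible k B') {θ : ℝ → ℝ}
    (hθ : Continuous θ) (h0 : ∀ t, 0 ≤ θ t) (h1 : ∀ t, θ t ≤ 1) :
    S.Admissible k (fun t => (1 - θ t) • B t + θ t • B' t) where
  diss := hB.diss.convexCombo S.stable.isNormFamily.one_mem hB'.diss hθ h0 h1
  weak t ht ψ x := by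
    have h2 : S.JY' ψ (((1 - θ t) • B t + θ t • B' t) x)
        = (1 - θ t) • S.JY' ψ (B t x) + θ t • S.JY' ψ (B' t x) := by simp
    rw [h2, ← Real.norm_eq_abs]
    exact norm_convexCombo_le (h0 t) (h1 t) (hB.weak t ht ψ x) (hB'.weak t ht ψ x)
  cons t ht y z := by
    have h2 : ((1 - θ t) • B t + θ t • B' t) (S.JY y) - S.JY z
        = (1 - θ t) • (B t (S.JY y) - S.JY z) + θ t • (B' t (S.JY y) - S.JY z) := by
      simp only [ContinuousLinearMap.add_apply, ContinuousLinearMap.smul_apply]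
      module
    rw [h2]
    exact norm_convexCombo_le (h0 t) (h1 t) (hB.cons t ht y z) (hB'.cons t ht y z)
  norm_le t ht x hx := norm_convexCombo_le (h0 t) (h1 t) (hB.norm_le t ht x hx)
    (hB'.norm_le t ht x hx)
  approx t ht x hx ε hε := by
    have h2 : ((1 - θ t) • B t + θ t • B' t) x - S.A t x
        = (1 - θ t) • (B t x - S.A t x) + θ t • (B' t x - S.A t x) := by
      simp only [ContinuousLinearMap.add_apply, ContinuousLinearMap.smul_apply]
      module
    rw [h2]
    exact norm_convexCombo_le (h0 t) (h1 t) (hB.approx t ht x hx ε hε) (hB'.approx t ht x hx ε hε)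

theorem norm_apply_JY_le (hB : S.Admissible k B) {t : ℝ} (ht : t ∈ Ioc S.a S.b) (y : Y) :
    ‖B t (S.JY y)‖ ≤ S.c * S.CY * ‖y‖ := by
  rw [mul_assoc]
  exact (hB.norm_le t ht _ (S.JY_mem t ht y)).trans
    (mul_le_mul_of_nonneg_left (S.norm_A_le t ht y) S.c_pos.le)

end Admissible

variable (S) in
/-- The properties of the approximating evolution families of index at least `k` which are stable
under weak limits. -/
structure Bounds (k : ℕ) (U : ℝ → ℝ → X →L[ℝ] X) : Prop where
  zero_off : ∀ t s, ¬ (S.a < s ∧ s ≤ t ∧ t ≤ S.b) → U t s = 0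
  refl : ∀ s ∈ Ioc S.a S.b, U s s = 1
  opNorm_le : ∀ s t, S.a < s → s ≤ t → t ≤ S.b → ‖U t s‖ ≤ S.M * exp (S.rate k * (t - s))
  opNorm_le' : ∀ t s, ‖U t s‖ ≤ S.C
  norm_sub_left_le : ∀ s s' t, S.a < s → s ≤ s' → s' ≤ t → t ≤ S.b → ∀ y,
    ‖U t s' (S.JY y) - U t s (S.JY y)‖ ≤ S.C * (S.c * S.CY * ‖y‖) * (s' - s)
  abs_dual_sub_le : ∀ s t t', S.a < s → s ≤ t → t ≤ t' → t' ≤ S.b → ∀ ψ x,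
    |S.JY' ψ (U t' s x) - S.JY' ψ (U t s x)| ≤ S.c * ‖ψ‖ * (S.C * ‖x‖) * (t' - t)
  norm_sub_sub_smul_le : ∀ s t, S.a < s → s ≤ t → t ≤ S.b → ∀ y z m,
    (∀ τ ∈ Icc s t, ‖S.A τ (S.JY y) - S.JY z‖ ≤ m) →
    ‖U t s (S.JY y) - S.JY y - (t - s) • S.JY z‖ ≤
      (S.C * (S.c * (m + (S.freq k)⁻¹ * ‖z‖)) + S.C * (S.c * S.CY * ‖z‖) * (t - s)) * (t - s)

theorem Admissible.bounds {k : ℕ} {B : ℝ → X →L[ℝ] X} {U : ℝ → ℝ → X →L[ℝ] X}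
    (hB : S.Admissible k B) (hU : Evolves S.a S.b S.Fam (S.rate k) B U) : S.Bounds k U where
  zero_off := hU.zero_off
  refl := hU.refl
  opNorm_le s t hs hst ht := hU.opNorm_le S.stable.isNormFamily hs hst ht
  opNorm_le' := hU.opNorm_le_of_le S.stable.isNormFamily (by positivity) (S.rate_le k)
  norm_sub_left_le s s' t hs hss hst ht y := hU.norm_sub_left_le
    (hU.opNorm_le_of_le S.stable.isNormFamily (by positivity) (S.rate_le k))
    S.stable.isNormFamily hB.diss hs hss hst ht fun τ hτ => hB.norm_apply_JY_le hτ y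
  abs_dual_sub_le s t t' hs hst htt ht ψ x := hU.abs_dual_sub_le
    (hU.opNorm_le_of_le S.stable.isNormFamily (by positivity) (S.rate_le k)) hs hst htt ht
    (mul_nonneg S.c_pos.le (norm_nonneg _)) (fun τ hτ z => hB.weak τ hτ ψ z) x
  norm_sub_sub_smul_le s t hs hst ht y z m hm := hU.norm_sub_sub_smul_le
    (hU.opNorm_le_of_le S.stable.isNormFamily (by positivity) (S.rate_le k))
    S.stable.isNormFamily hB.diss hs hst ht (fun τ hτ =>
      (hB.cons τ ⟨hs.trans_le hτ.1, hτ.2.trans ht⟩ y z).trans (mul_le_mul_of_nonneg_left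
        (add_le_add_left (hm τ hτ) _) S.c_pos.le)) fun τ hτ => hB.norm_apply_JY_le hτ z

end KatoSetting

/-- Two-parameter families of bounded operators, with the topology of pointwise convergence in the
weak operator topology. -/
def Evo (X : Type*) [NormedAddCommGroup X] [NormedSpace ℝ X] : Type _ := ℝ → ℝ → X →L[ℝ] X

namespace Evo

variable {X : Type*} [NormedAddCommGroup X] [NormedSpace ℝ X]

/-- The matrix coefficients of a two-parameter family of operators. -/
def coeff (V : Evo X) (p : ℝ × ℝ × X × StrongDual ℝ X) : ℝ := p.2.2.2 (V p.1 p.2.1 p.2.2.1)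

instance : TopologicalSpace (Evo X) := TopologicalSpace.induced coeff inferInstance

theorem isInducing_coeff : Topology.IsInducing (coeff (X := X)) := ⟨rfl⟩

theorem continuous_coeff (t s : ℝ) (x : X) (φ : StrongDual ℝ X) :
    Continuous fun V : Evo X => φ (V t s x) :=
  (continuous_apply (t, s, x, φ)).comp isInducing_coeff.continuous

theorem continuous_iff {α : Type*} [TopologicalSpace α] {f : α → Evo X} :
    Continuous f ↔ ∀ t s x (φ : StrongDual ℝ X), Continuous fun i => φ (f i t s x) := by
  rw [isInducing_coeff.continuous_iff, continuous_pi_iff]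
  exact ⟨fun h t s x φ => h (t, s, x, φ), fun h p => h p.1 p.2.1 p.2.2.1 p.2.2.2⟩

theorem tendsto_iff {α : Type*} {l : Filter α} {f : α → Evo X} {V : Evo X} :
    Tendsto f l (𝓝 V) ↔
      ∀ t s x (φ : StrongDual ℝ X), Tendsto (fun i => φ (f i t s x)) l (𝓝 (φ (V t s x))) := by
  rw [isInducing_coeff.tendsto_nhds_iff, tendsto_pi_nhds]
  exact ⟨fun h t s x φ => h (t, s, x, φ), fun h p => h p.1 p.2.1 p.2.2.1 p.2.2.2⟩

theorem eq_of_forall_dual {V W : Evo X}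
    (h : ∀ t s x (φ : StrongDual ℝ X), φ (V t s x) = φ (W t s x)) : V = W := by
  funext t s
  ext x
  exact (NormedSpace.eq_iff_forall_dual_eq ℝ).2 (h t s x)

instance : T2Space (Evo X) :=
  T2Space.of_injective_continuous
    (fun _ _ h => eq_of_forall_dual fun t s x φ => congrFun h (t, s, x, φ))
    isInducing_coeff.continuous

theorem isClosed_setOf_norm_le {f : Evo X → X}
    (hf : ∀ φ : StrongDual ℝ X, Continuous fun V => φ (f V)) (r : ℝ) :
    IsClosed {V | ‖f V‖ ≤ r} := by
  by_cases hr : 0 ≤ r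
  · have : {V | ‖f V‖ ≤ r} = ⋂ φ : StrongDual ℝ X, {V | ‖φ (f V)‖ ≤ r * ‖φ‖} := by
      ext V
      simp only [mem_setOf_eq, mem_iInter]
      exact ⟨fun h φ => (φ.le_opNorm_of_le h).trans_eq (mul_comm _ _),
        fun h => NormedSpace.norm_le_dual_bound ℝ _ hr h⟩
    rw [this]
    exact isClosed_iInter fun φ => isClosed_le (hf φ).norm continuous_const
  · have : {V | ‖f V‖ ≤ r} = ∅ :=
      eq_empty_iff_forall_notMem.2 fun V hV => hr ((norm_nonneg _).trans hV)
    rw [this]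
    exact isClosed_empty

theorem isCompact_setOf_norm_le
    (hrefl : Function.Surjective (NormedSpace.inclusionInDoubleDual ℝ X)) {C : ℝ} (hC : 0 ≤ C) :
    IsCompact {V : Evo X | ∀ t s, ‖V t s‖ ≤ C} := by
  rw [isInducing_coeff.isCompact_iff]
  set T : Set ((ℝ × ℝ × X × StrongDual ℝ X) → ℝ) :=
    Set.pi univ fun p => Icc (-(C * ‖p.2.2.1‖ * ‖p.2.2.2‖)) (C * ‖p.2.2.1‖ * ‖p.2.2.2‖) with hT
  have hTc : IsCompact T := isCompact_univ_pi fun p => isCompact_Icc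
  set L : Set ((ℝ × ℝ × X × StrongDual ℝ X) → ℝ) :=
    {g | (∀ t s x y φ, g (t, s, x + y, φ) = g (t, s, x, φ) + g (t, s, y, φ)) ∧
      (∀ t s (c : ℝ) x φ, g (t, s, c • x, φ) = c * g (t, s, x, φ)) ∧
      (∀ t s x φ ψ, g (t, s, x, φ + ψ) = g (t, s, x, φ) + g (t, s, x, ψ)) ∧
      (∀ t s (c : ℝ) x φ, g (t, s, x, c • φ) = c * g (t, s, x, φ))} with hL
  have hLc : IsClosed L := by
    simp only [hL, setOf_and, setOf_forall]
    refine IsClosed.inter ?_ (IsClosed.inter ?_ (IsClosed.inter ?_ ?_)) <;>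
    exact isClosed_iInter fun _ => isClosed_iInter fun _ => isClosed_iInter fun _ =>
      isClosed_iInter fun _ => isClosed_iInter fun _ => isClosed_eq (by fun_prop) (by fun_prop)
  have : coeff '' {V : Evo X | ∀ t s, ‖V t s‖ ≤ C} = T ∩ L := by
    apply Subset.antisymm
    · rintro _ ⟨V, hV, rfl⟩
      refine ⟨fun p _ => ?_, ?_, ?_, ?_, ?_⟩
      · refine abs_le.1 ?_
        calc |p.2.2.2 (V p.1 p.2.1 p.2.2.1)| ≤ ‖p.2.2.2‖ * (C * ‖p.2.2.1‖) :=
              p.2.2.2.le_opNorm_of_le ((V p.1 p.2.1).le_of_opNorm_le (hV _ _) _)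
          _ = _ := by ring
      all_goals
        intros
        simp [coeff]
    · rintro g ⟨hgT, h1, h2, h3, h4⟩
      have hgb : ∀ t s x φ, |g (t, s, x, φ)| ≤ C * ‖x‖ * ‖φ‖ := fun t s x φ =>
        abs_le.2 (hgT (t, s, x, φ) (mem_univ _))
      have hex : ∀ t s x, ∃ z : X, ∀ φ : StrongDual ℝ X, φ z = g (t, s, x, φ) := by
        intro t s x
        let ℓ : StrongDual ℝ X →ₗ[ℝ] ℝ :=
          { toFun := fun φ => g (t, s, x, φ)
            map_add' := h3 t s x
            map_smul' := fun c φ => h4 t s c x φ }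
        obtain ⟨z, hz⟩ := hrefl (ℓ.mkContinuous (C * ‖x‖) (hgb t s x))
        exact ⟨z, fun φ => congrArg (fun T : StrongDual ℝ (StrongDual ℝ X) => T φ) hz⟩
      choose Z hZ using hex
      refine ⟨fun t s => LinearMap.mkContinuous
        { toFun := Z t s
          map_add' := fun x y => (NormedSpace.eq_iff_forall_dual_eq ℝ).2 fun φ => by
            rw [map_add, hZ, hZ, hZ, h1]
          map_smul' := fun c x => (NormedSpace.eq_iff_forall_dual_eq ℝ).2 fun φ => by
            rw [RingHom.id_apply, map_smul, hZ, hZ, h2, smul_eq_mul] } C ?_, ?_, ?_⟩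
      · exact fun x => NormedSpace.norm_le_dual_bound ℝ _ (by positivity) fun φ => by
          change ‖φ (Z t s x)‖ ≤ _
          rw [hZ]
          exact hgb t s x φ
      · exact fun t s => LinearMap.mkContinuous_norm_le _ hC _
      · funext p
        exact hZ _ _ _ _
  rw [this]
  exact hTc.inter_right hLc

/-- The concatenation of two evolution families at time `r`. -/
noncomputable def cut (r : ℝ) (V W : Evo X) : Evo X := fun t s =>
  if r ≤ s then W t s else if t ≤ r then V t s else W t r * V r s

theorem cut_of_le {r s : ℝ} (h : r ≤ s) (V W : Evo X) (t : ℝ) : cut r V W t s = W t s :=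
  if_pos h

theorem cut_of_lt_of_le {r s t : ℝ} (h : s < r) (ht : t ≤ r) (V W : Evo X) :
    cut r V W t s = V t s := by
  simp only [cut, if_neg (not_le.2 h), if_pos ht]

theorem cut_of_lt_of_lt {r s t : ℝ} (h : s < r) (ht : r < t) (V W : Evo X) :
    cut r V W t s = W t r * V r s := by
  simp only [cut, if_neg (not_le.2 h), if_neg (not_le.2 ht)]

theorem cut_assoc {r r' : ℝ} (h : r < r') (V W Z : Evo X) :
    cut r' (cut r V W) Z = cut r V (cut r' W Z) := by
  funext t s
  rcases le_or_gt r' s with h1 | h1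
  · rw [cut_of_le h1, cut_of_le (h.le.trans h1), cut_of_le h1]
  rcases le_or_gt t r' with h2 | h2
  · rw [cut_of_lt_of_le h1 h2]
    rcases le_or_gt r s with h3 | h3
    · rw [cut_of_le h3, cut_of_le h3, cut_of_lt_of_le h1 h2]
    rcases le_or_gt t r with h4 | h4
    · rw [cut_of_lt_of_le h3 h4, cut_of_lt_of_le h3 h4]
    · rw [cut_of_lt_of_lt h3 h4, cut_of_lt_of_lt h3 h4, cut_of_lt_of_le h h2]
  · rw [cut_of_lt_of_lt h1 h2]
    rcases le_or_gt r s with h3 | h3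
    · rw [cut_of_le h3, cut_of_le h3, cut_of_lt_of_lt h1 h2]
    · rw [cut_of_lt_of_lt h3 h, cut_of_lt_of_lt h3 (h.trans h2), cut_of_lt_of_lt h h2, mul_assoc]

theorem cut_absorb_left {r r' : ℝ} (h : r' < r) (V W Z : Evo X) :
    cut r' (cut r V W) Z = cut r' V Z := by
  funext t s
  rcases le_or_gt r' s with h1 | h1
  · rw [cut_of_le h1, cut_of_le h1]
  rcases le_or_gt t r' with h2 | h2
  · rw [cut_of_lt_of_le h1 h2, cut_of_lt_of_le h1 h2, cut_of_lt_of_le (h1.trans h) (h2.trans h.le)]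
  · rw [cut_of_lt_of_lt h1 h2, cut_of_lt_of_lt h1 h2, cut_of_lt_of_le (h1.trans h) h.le]

theorem cut_absorb_right {r r' : ℝ} (h : r < r') (V W Z : Evo X) :
    cut r' V (cut r W Z) = cut r' V Z := by
  funext t s
  rcases le_or_gt r' s with h1 | h1
  · rw [cut_of_le h1, cut_of_le h1, cut_of_le (h.le.trans h1)]
  rcases le_or_gt t r' with h2 | h2
  · rw [cut_of_lt_of_le h1 h2, cut_of_lt_of_le h1 h2]
  · rw [cut_of_lt_of_lt h1 h2, cut_of_lt_of_lt h1 h2, cut_of_le h.le]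

theorem cut_idem (r : ℝ) (V W : Evo X) : cut r (cut r V W) (cut r V W) = cut r V W := by
  funext t s
  rcases le_or_gt r s with h1 | h1
  · rw [cut_of_le h1]
  rcases le_or_gt t r with h2 | h2
  · rw [cut_of_lt_of_le h1 h2]
  · rw [cut_of_lt_of_lt h1 h2, cut_of_lt_of_lt h1 h2, cut_of_le le_rfl, cut_of_lt_of_le h1 le_rfl]

theorem continuous_cut_left (r : ℝ) (W : Evo X) : Continuous fun V => cut r V W := by
  refine continuous_iff.2 fun t s x φ => ?_
  rcases le_or_gt r s with h1 | h1
  · simp only [cut_of_le h1]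
    exact continuous_const
  rcases le_or_gt t r with h2 | h2
  · simp only [cut_of_lt_of_le h1 h2]
    exact continuous_coeff t s x φ
  · simp only [cut_of_lt_of_lt h1 h2]
    exact continuous_coeff r s x (φ.comp (W t r))

theorem continuous_cut_right (r : ℝ) (V : Evo X) : Continuous fun W => cut r V W := by
  refine continuous_iff.2 fun t s x φ => ?_
  rcases le_or_gt r s with h1 | h1
  · simp only [cut_of_le h1]
    exact continuous_coeff t s x φ
  rcases le_or_gt t r with h2 | h2
  · simp only [cut_of_lt_of_le h1 h2]
    exact continuous_const
  · simp only [cut_of_lt_of_lt h1 h2]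
    exact continuous_coeff t r (V r s x) φ

end Evo

namespace KatoSetting

variable {X Y Y' : Type*} [NormedAddCommGroup X] [NormedSpace ℝ X]
    [NormedAddCommGroup Y] [NormedSpace ℝ Y] [NormedAddCommGroup Y'] [NormedSpace ℝ Y']
    (S : KatoSetting X Y Y')

/-- The evolution families generated by the admissible approximations of index at least `k`. -/
def members (k : ℕ) : Set (Evo X) :=
  {U | ∃ B, S.Admissible k B ∧ Evolves S.a S.b S.Fam (S.rate k) B U}

theorem _root_.Evolves.mono {a b ω₁ ω₂ : ℝ} {Fam : ℝ → Set (X →L[ℝ] X)} {B : ℝ → X →L[ℝ] X}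
    {U : ℝ → ℝ → X →L[ℝ] X} (hF : ∀ t, 1 ∈ Fam t)
    (h : Evolves a b Fam ω₁ B U) (hω : ω₁ ≤ ω₂) : Evolves a b Fam ω₂ B U where
  zero_off := h.zero_off
  refl := h.refl
  cont := h.cont
  deriv := h.deriv
  comp := h.comp
  norm_le s t hs hst ht z ρ hz Q hQ := (h.norm_le s t hs hst ht z ρ hz Q hQ).trans <| by
    have : 0 ≤ ρ := (norm_nonneg _).trans (hz 1 (hF s))
    have : 0 ≤ t - s := sub_nonneg.2 hst
    gcongr

theorem members_anti {k l : ℕ} (h : k ≤ l) : S.members l ⊆ S.members k := by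
  rintro U ⟨B, hB, hU⟩
  exact ⟨B, hB.mono h, hU.mono S.stable.isNormFamily.one_mem (S.rate_anti h)⟩

theorem members_nonempty [CompleteSpace X] (k : ℕ) : (S.members k).Nonempty := by
  obtain ⟨U, hU⟩ := (S.admissible_yosida k).diss.exists_evolves S.stable.isNormFamily
  exact ⟨U, _, S.admissible_yosida k, hU⟩

variable {S}

theorem bounds_of_mem_closure {k : ℕ} {V : Evo X} (hV : V ∈ closure (S.members k)) :
    S.Bounds k V := by
  have key {P : Evo X → Prop} (hP : IsClosed {V | P V}) (h : ∀ U, S.Bounds k U → P U) : P V := by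
    refine closure_minimal ?_ hP hV
    rintro U ⟨B, hB, hU⟩
    exact h U (hB.bounds hU)
  have hc := Evo.continuous_coeff (X := X)
  refine ⟨fun t s h => ?_, fun s hs => ?_, fun s t hs hst ht => ?_, fun t s => ?_,
    fun s s' t hs hss hst ht y => ?_, fun s t t' hs hst htt ht ψ x => ?_,
    fun s t hs hst ht y z m hm => ?_⟩
  · ext x
    have := key (Evo.isClosed_setOf_norm_le (f := fun V => V t s x) (hc t s x) 0) fun U hU => by
      rw [hU.zero_off t s h]
      simp
    simpa using this
  · ext x
    have := key (Evo.isClosed_setOf_norm_le (f := fun V => V s s x - x) (fun φ => by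
      simp only [map_sub]
      exact (hc s s x φ).sub continuous_const) 0) fun U hU => by
        rw [hU.refl s hs]
        simp
    exact sub_eq_zero.1 (norm_le_zero_iff.1 this)
  · refine ContinuousLinearMap.opNorm_le_bound _ (mul_nonneg S.M_nonneg (exp_pos _).le) fun x => ?_
    exact key (Evo.isClosed_setOf_norm_le (f := fun V => V t s x) (hc t s x) _) fun U hU =>
      (U t s).le_of_opNorm_le (hU.opNorm_le s t hs hst ht) x
  · refine ContinuousLinearMap.opNorm_le_bound _ S.C_nonneg fun x => ?_
    exact key (Evo.isClosed_setOf_norm_le (f := fun V => V t s x) (hc t s x) _) fun U hU =>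
      (U t s).le_of_opNorm_le (hU.opNorm_le' t s) x
  · exact key (Evo.isClosed_setOf_norm_le (f := fun V => V t s' (S.JY y) - V t s (S.JY y))
      (fun φ => by
        simp only [map_sub]
        exact (hc _ _ _ φ).sub (hc _ _ _ φ)) _) fun U hU =>
      hU.norm_sub_left_le s s' t hs hss hst ht y
  · exact key (isClosed_le ((hc _ _ _ _).sub (hc _ _ _ _)).abs continuous_const) fun U hU =>
      hU.abs_dual_sub_le s t t' hs hst htt ht ψ x
  · exact key (Evo.isClosed_setOf_norm_le
      (f := fun V => V t s (S.JY y) - S.JY y - (t - s) • S.JY z)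
      (fun φ => by
        simp only [map_sub]
        exact ((hc _ _ _ φ).sub continuous_const).sub continuous_const) _) fun U hU =>
      hU.norm_sub_sub_smul_le s t hs hst ht y z m hm

variable [CompleteSpace X]

/-- The concatenation of two members is approximated by the evolution families of the operators
obtained by interpolating continuously, on a short time interval, between the generators. -/
theorem cut_mem_closure_of_mem {k : ℕ} {U U' : Evo X} (hU : U ∈ S.members k)
    (hU' : U' ∈ S.members k) (r : ℝ) : Evo.cut r U U' ∈ closure (S.members k) := by
  have hUm := hU
  have hUm' := hU'
  obtain ⟨B, hB, hU⟩ := hU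
  obtain ⟨B', hB', hU'⟩ := hU'
  have hb := hB.bounds hU
  have hb' := hB'.bounds hU'
  have hF := S.stable.isNormFamily
  rcases le_or_gt r S.a with hra | hra
  · have : Evo.cut r U U' = U' := by
      funext t s
      rcases le_or_gt r s with h1 | h1
      · rw [Evo.cut_of_le h1]
      have h0 (U : Evo X) (hb : S.Bounds k U) (t : ℝ) : U t s = 0 :=
        hb.zero_off t s fun h => absurd h.1 (not_lt.2 (h1.le.trans hra))
      rcases le_or_gt t r with h2 | h2
      · rw [Evo.cut_of_lt_of_le h1 h2, h0 U hb, h0 U' hb']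
      · rw [Evo.cut_of_lt_of_lt h1 h2, h0 U hb, h0 U' hb', mul_zero]
    rw [this]
    exact subset_closure hUm'
  rcases le_or_gt S.b r with hrb | hrb
  · have : Evo.cut r U U' = U := by
      funext t s
      rcases le_or_gt r s with h1 | h1
      · rw [Evo.cut_of_le h1]
        by_cases h : S.a < s ∧ s ≤ t ∧ t ≤ S.b
        · have h3 : s = t := le_antisymm h.2.1 (h.2.2.trans (hrb.trans h1))
          subst h3
          rw [hb.refl s ⟨h.1, h.2.2⟩, hb'.refl s ⟨h.1, h.2.2⟩]
        · rw [hb.zero_off t s h, hb'.zero_off t s h]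
      rcases le_or_gt t r with h2 | h2
      · rw [Evo.cut_of_lt_of_le h1 h2]
      · rw [Evo.cut_of_lt_of_lt h1 h2, hb.zero_off t s fun h => absurd (hrb.trans_lt h2)
          (not_lt.2 h.2.2), hb'.zero_off t r fun h => absurd (hrb.trans_lt h2)
          (not_lt.2 h.2.2), zero_mul]
    rw [this]
    exact subset_closure hUm
  set θ : ℝ → ℝ → ℝ := fun ε τ => max 0 (min 1 ((τ - r) / ε)) with hθ
  have hθc (ε : ℝ) : Continuous (θ ε) := by fun_prop
  have hθ0 (ε τ : ℝ) : 0 ≤ θ ε τ := le_max_left _ _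
  have hθ1 (ε τ : ℝ) : θ ε τ ≤ 1 := max_le zero_le_one (min_le_left _ _)
  have hθl {ε τ : ℝ} (hε : 0 < ε) (h : τ ≤ r) : θ ε τ = 0 :=
    max_eq_left ((min_le_right _ _).trans (div_nonpos_of_nonpos_of_nonneg (sub_nonpos.2 h) hε.le))
  have hθr {ε τ : ℝ} (hε : 0 < ε) (h : r + ε ≤ τ) : θ ε τ = 1 := by
    have : 1 ≤ (τ - r) / ε := by
      rw [le_div_iff₀ hε]
      linarith
    simp only [hθ, min_eq_left this]
    exact max_eq_right zero_le_one
  set D : ℝ → ℝ → X →L[ℝ] X := fun ε t => (1 - θ ε t) • B t + θ ε t • B' t with hD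
  have hDa (ε : ℝ) : S.Admissible k (D ε) := hB.convexCombo hB' (hθc ε) (hθ0 ε) (hθ1 ε)
  choose W hW using fun ε => (hDa ε).diss.exists_evolves hF
  have hWb (ε : ℝ) := (hDa ε).bounds (hW ε)
  have hWl {ε s t : ℝ} (hε : 0 < ε) (hs : S.a < s) (hst : s ≤ t) (htr : t ≤ r) :
      W ε t s = U t s :=
    hU.eq_of_eqOn hF hB.diss (hW ε) hs hst (htr.trans hrb.le) fun τ hτ => by
      simp [hD, hθl hε (hτ.2.le.trans htr)]
  have hWr {ε s t : ℝ} (hε : 0 < ε) (hs : r + ε ≤ s) (hst : s ≤ t) (htr : t ≤ S.b) :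
      W ε t s = U' t s :=
    hU'.eq_of_eqOn hF hB'.diss (hW ε) (hra.trans_le (by linarith)) hst htr fun τ hτ => by
      simp [hD, hθr hε (hs.trans hτ.1)]
  have hmain : ∀ t, r ≤ t → t ≤ S.b → ∀ z,
      Tendsto (fun ε => W ε t r z) (𝓝[>] 0) (𝓝 (U' t r z)) := by
    intro t hrt htb z
    rcases hrt.eq_or_lt with rfl | hrt
    · simp only [(hWb _).refl r ⟨hra, htb⟩, hb'.refl r ⟨hra, htb⟩]
      exact tendsto_const_nhds
    obtain ⟨K, hK0, hK⟩ := hB.diss.exists_norm_le hF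
    obtain ⟨K', hK0', hK'⟩ := hB'.diss.exists_norm_le hF
    have hDK (ε τ : ℝ) (hτ : τ ∈ Ioc S.a S.b) : ‖D ε τ‖ ≤ max K K' :=
      norm_convexCombo_le (hθ0 _ _) (hθ1 _ _) ((hK τ hτ).trans (le_max_left _ _))
        ((hK' τ hτ).trans (le_max_right _ _))
    have h1 : Tendsto (fun ε => U' t (r + ε) z) (𝓝[>] 0) (𝓝 (U' t r z)) := by
      have h2 := hU'.continuousOn_left_arg hb'.opNorm_le' hF hB'.diss hra htb z r ⟨le_rfl, hrt.le⟩
      refine h2.tendsto.comp (tendsto_nhdsWithin_iff.2 ⟨?_, ?_⟩)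
      · have : Tendsto (fun ε : ℝ => r + ε) (𝓝 0) (𝓝 (r + 0)) := by
          exact (continuous_const.add continuous_id).tendsto 0
        rw [add_zero] at this
        exact this.mono_left nhdsWithin_le_nhds
      · filter_upwards [Ioo_mem_nhdsGT (sub_pos.2 hrt)] with ε hε
        exact ⟨by linarith [hε.1], by linarith [hε.2]⟩
    have h2 : Tendsto (fun ε => U' t (r + ε) (W ε (r + ε) r z - z)) (𝓝[>] 0) (𝓝 0) := by
      have h3 : Tendsto (fun ε : ℝ => S.C * (max K K' * (S.C * ‖z‖) * ε)) (𝓝[>] 0) (𝓝 0) := by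
        have : Tendsto (fun ε : ℝ => S.C * (max K K' * (S.C * ‖z‖) * ε)) (𝓝 0)
            (𝓝 (S.C * (max K K' * (S.C * ‖z‖) * 0))) := by
          apply Continuous.tendsto
          fun_prop
        rw [mul_zero, mul_zero] at this
        exact this.mono_left nhdsWithin_le_nhds
      refine squeeze_zero_norm' ?_ h3
      filter_upwards [Ioo_mem_nhdsGT (sub_pos.2 hrt)] with ε hε
      refine ((U' t (r + ε)).le_of_opNorm_le (hb'.opNorm_le' _ _) _).trans
        (mul_le_mul_of_nonneg_left ?_ S.C_nonneg)
      have h4 := (hW ε).norm_sub_self_le (hWb ε).opNorm_le' (hDK ε)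
        (hK0.trans (le_max_left _ _)) hra (t := r + ε) (by linarith [hε.1])
        (by linarith [hε.2]) z
      rwa [add_sub_cancel_left] at h4
    have h3 := h2.add h1
    rw [zero_add] at h3
    refine h3.congr' ?_
    filter_upwards [Ioo_mem_nhdsGT (sub_pos.2 hrt)] with ε hε
    have h5 : r + ε ≤ t := by linarith [hε.2]
    rw [← (hW ε).comp r (r + ε) t hra (by linarith [hε.1]) h5 htb, hWr hε.1 le_rfl h5 htb]
    simp
  refine mem_closure_of_tendsto (f := W) (b := 𝓝[>] (0 : ℝ)) ?_
    (Eventually.of_forall fun ε => ⟨D ε, hDa ε, hW ε⟩)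
  refine Evo.tendsto_iff.2 fun t s x φ => (φ.continuous.tendsto _).comp ?_
  by_cases h : S.a < s ∧ s ≤ t ∧ t ≤ S.b
  · rcases lt_trichotomy r s with h1 | h1 | h1
    · rw [Evo.cut_of_le h1.le]
      refine tendsto_const_nhds.congr' ?_
      filter_upwards [Ioo_mem_nhdsGT (sub_pos.2 h1)] with ε hε
      rw [hWr hε.1 (by linarith [hε.2]) h.2.1 h.2.2]
    · subst h1
      rw [Evo.cut_of_le le_rfl]
      exact hmain t h.2.1 h.2.2 x
    rcases le_or_gt t r with h2 | h2
    · rw [Evo.cut_of_lt_of_le h1 h2]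
      refine tendsto_const_nhds.congr' ?_
      filter_upwards [self_mem_nhdsWithin] with ε hε
      rw [hWl hε h.1 h.2.1 h2]
    · rw [Evo.cut_of_lt_of_lt h1 h2]
      refine (hmain t h2.le h.2.2 (U r s x)).congr' ?_
      filter_upwards [self_mem_nhdsWithin] with ε hε
      rw [← (hW ε).comp s r t h.1 h1.le h2.le h.2.2, hWl hε h.1 h1.le le_rfl]
      rfl
  · have h0 : Evo.cut r U U' t s = 0 := by
      rcases le_or_gt r s with h1 | h1
      · rw [Evo.cut_of_le h1, hb'.zero_off t s h]
      rcases le_or_gt t r with h2 | h2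
      · rw [Evo.cut_of_lt_of_le h1 h2, hb.zero_off t s h]
      · rw [Evo.cut_of_lt_of_lt h1 h2]
        by_cases h3 : S.a < s
        · rw [hb'.zero_off t r fun h4 => h ⟨h3, h1.le.trans h2.le, h4.2.2⟩, zero_mul]
        · rw [hb.zero_off r s fun h4 => h3 h4.1, mul_zero]
    rw [h0]
    simp only [(hWb _).zero_off t s h]
    exact tendsto_const_nhds

theorem cut_mem_closure {k : ℕ} {V W : Evo X} (hV : V ∈ closure (S.members k))
    (hW : W ∈ closure (S.members k)) (r : ℝ) : Evo.cut r V W ∈ closure (S.members k) := by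
  have h1 : ∀ U ∈ S.members k, Evo.cut r U W ∈ closure (S.members k) := fun U hU => by
    have := map_mem_closure (Evo.continuous_cut_right r U) hW
      (fun U' hU' => cut_mem_closure_of_mem hU hU' r)
    rwa [closure_closure] at this
  have := map_mem_closure (Evo.continuous_cut_left r W) hV h1
  rwa [closure_closure] at this

end KatoSetting

/-- A separable normed space has a countable separating family of functionals. -/
theorem exists_seq_dual_separating (X : Type*) [NormedAddCommGroup X] [NormedSpace ℝ X]
    [TopologicalSpace.SeparableSpace X] :
    ∃ φ : ℕ → StrongDual ℝ X, ∀ x, (∀ n, φ n x = 0) → x = 0 := by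
  choose φ hφ using fun n => exists_dual_vector'' ℝ (TopologicalSpace.denseSeq X n)
  refine ⟨φ, fun x hx => ?_⟩
  by_contra h
  obtain ⟨n, hn⟩ := (TopologicalSpace.denseRange_denseSeq X).exists_dist_lt x
    (half_pos (norm_pos_iff.2 h))
  set z := TopologicalSpace.denseSeq X n
  have h1 : ‖z‖ ≤ ‖x - z‖ := by
    have h2 : φ n (z - x) = ‖z‖ := by
      rw [map_sub, hx n, sub_zero, (hφ n).2]
      rfl
    calc ‖z‖ = φ n (z - x) := h2.symm
      _ ≤ ‖φ n (z - x)‖ := le_abs_self _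
      _ ≤ 1 * ‖z - x‖ := (φ n).le_of_opNorm_le (hφ n).1 _
      _ = ‖x - z‖ := by rw [one_mul, norm_sub_rev]
  rw [dist_eq_norm] at hn
  have h3 : ‖x‖ ≤ ‖x - z‖ + ‖z‖ := by simpa using norm_add_le (x - z) z
  linarith

/-- A weakly measurable function with values in a separable Banach space is strongly
measurable. -/
theorem stronglyMeasurable_of_forall_dual {X α : Type*} [NormedAddCommGroup X] [NormedSpace ℝ X]
    [CompleteSpace X] [TopologicalSpace.SeparableSpace X] [MeasurableSpace α] {g : α → X}
    (hg : ∀ φ : StrongDual ℝ X, Measurable fun p => φ (g p)) : StronglyMeasurable g := by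
  borelize X
  have := UniformSpace.secondCountable_of_separable X
  obtain ⟨φ, hφ⟩ := exists_seq_dual_separating X
  have hemb : MeasurableEmbedding fun (x : X) (n : ℕ) => φ n x :=
    Continuous.measurableEmbedding (by fun_prop) fun x y h => sub_eq_zero.1 <| hφ _ fun n => by
      rw [map_sub, sub_eq_zero]
      exact congrFun h n
  exact (hemb.measurable_comp_iff.1 (measurable_pi_lambda _ fun n => hg (φ n))).stronglyMeasurable

namespace KatoSetting

variable {X Y Y' : Type*} [NormedAddCommGroup X] [NormedSpace ℝ X]
    [NormedAddCommGroup Y] [NormedSpace ℝ Y] [NormedAddCommGroup Y'] [NormedSpace ℝ Y']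
    (S : KatoSetting X Y Y')

/-- The pairs `(t, s)` of times with `s ≤ t`. -/
def timePairs : Set (ℝ × ℝ) := {q | q.1 ∈ Ioc S.a S.b ∧ q.2 ∈ Ioc S.a S.b ∧ q.2 ≤ q.1}

variable {S}

theorem mem_timePairs {t s : ℝ} : (t, s) ∈ S.timePairs ↔ S.a < s ∧ s ≤ t ∧ t ≤ S.b :=
  ⟨fun h => ⟨h.2.1.1, h.2.2, h.1.2⟩,
    fun h => ⟨⟨h.1.trans_le h.2.1, h.2.2⟩, ⟨h.1, h.2.1.trans h.2.2⟩, h.2.1⟩⟩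

theorem measurableSet_timePairs : MeasurableSet S.timePairs :=
  (measurable_fst measurableSet_Ioc).inter <| (measurable_snd measurableSet_Ioc).inter <|
    measurableSet_le measurable_snd measurable_fst

namespace Bounds

variable {k : ℕ} {U : ℝ → ℝ → X →L[ℝ] X}

theorem norm_apply_le (h : S.Bounds k U) (t s : ℝ) (x : X) : ‖U t s x‖ ≤ S.C * ‖x‖ :=
  (U t s).le_of_opNorm_le (h.opNorm_le' t s) x

theorem abs_dual_sub_le_dist (h : S.Bounds k U) {p q : ℝ × ℝ} (hp : p ∈ S.timePairs)
    (hq : q ∈ S.timePairs) (y : Y) (ψ : Y') :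
    |S.JY' ψ (U p.1 p.2 (S.JY y)) - S.JY' ψ (U q.1 q.2 (S.JY y))| ≤
      (2 * (S.c * ‖ψ‖ * (S.C * ‖S.JY y‖)) + ‖S.JY' ψ‖ * (S.C * (S.c * S.CY * ‖y‖))) *
        dist p q := by
  obtain ⟨t, s⟩ := p
  obtain ⟨t', s'⟩ := q
  have hd1 : |t - t'| ≤ dist (t, s) (t', s') := by
    rw [Prod.dist_eq, ← Real.dist_eq]
    exact le_max_left _ _
  have hd2 : |s - s'| ≤ dist (t, s) (t', s') := by
    rw [Prod.dist_eq, ← Real.dist_eq]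
    exact le_max_right _ _
  set d := dist (t, s) (t', s')
  rw [mem_timePairs] at hp hq
  set K := S.c * ‖ψ‖ * (S.C * ‖S.JY y‖) with hK
  set L := S.C * (S.c * S.CY * ‖y‖) with hL
  have hK0 : 0 ≤ K := by have := S.c_pos; have := S.C_nonneg; positivity
  have hL0 : 0 ≤ L := by have := S.c_pos; have := S.C_nonneg; have := S.CY_nonneg; positivity
  set T := max t t' with hT
  have hTb : T ≤ S.b := max_le hp.2.2 hq.2.2
  have h1 : |S.JY' ψ (U T s (S.JY y)) - S.JY' ψ (U t s (S.JY y))| ≤ K * d :=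
    (h.abs_dual_sub_le s t T hp.1 hp.2.1 (le_max_left _ _) hTb ψ _).trans
      (mul_le_mul_of_nonneg_left (by
        rcases max_choice t t' with h2 | h2 <;> rw [hT, h2]
        · rw [sub_self]
          exact (abs_nonneg _).trans hd1
        · exact (neg_sub t t' ▸ neg_le_abs (t - t')).trans hd1) hK0)
  have h2 : |S.JY' ψ (U T s' (S.JY y)) - S.JY' ψ (U t' s' (S.JY y))| ≤ K * d :=
    (h.abs_dual_sub_le s' t' T hq.1 hq.2.1 (le_max_right _ _) hTb ψ _).trans
      (mul_le_mul_of_nonneg_left (by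
        rcases max_choice t t' with h2 | h2 <;> rw [hT, h2]
        · exact (le_abs_self _).trans hd1
        · rw [sub_self]
          exact (abs_nonneg _).trans hd1) hK0)
  have h3 : ‖U T s (S.JY y) - U T s' (S.JY y)‖ ≤ L * d := by
    rcases le_total s s' with hs | hs
    · rw [norm_sub_rev]
      refine (h.norm_sub_left_le s s' T hp.1 hs (hq.2.1.trans (le_max_right _ _)) hTb y).trans ?_
      exact mul_le_mul_of_nonneg_left ((neg_sub s s' ▸ neg_le_abs (s - s')).trans hd2) hL0
    · refine (h.norm_sub_left_le s' s T hq.1 hs (hp.2.1.trans (le_max_left _ _)) hTb y).trans ?_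
      exact mul_le_mul_of_nonneg_left ((le_abs_self _).trans hd2) hL0
  have h4 : |S.JY' ψ (U T s (S.JY y)) - S.JY' ψ (U T s' (S.JY y))| ≤ ‖S.JY' ψ‖ * (L * d) := by
    rw [← map_sub]
    exact (S.JY' ψ).le_opNorm_of_le h3
  rw [abs_le] at *
  constructor <;> nlinarith [h1.1, h1.2, h2.1, h2.2, h4.1, h4.2]

theorem continuousOn_dual (h : S.Bounds k U) (x : X) (φ : StrongDual ℝ X) :
    ContinuousOn (fun q : ℝ × ℝ => φ (U q.1 q.2 x)) S.timePairs := by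
  refine continuousOn_of_uniform_approx_of_continuousOn fun u hu => ?_
  obtain ⟨ε, hε, hεu⟩ := Metric.mem_uniformity_dist.1 hu
  have hC := S.C_nonneg
  obtain ⟨ψ, hψ⟩ := S.JY'_dense.exists_dist_lt φ
    (show 0 < ε / 2 / (S.C * ‖x‖ + 1) by positivity)
  obtain ⟨y, hy⟩ := S.JY_dense.exists_dist_lt x
    (show 0 < ε / 2 / (‖S.JY' ψ‖ * S.C + 1) by positivity)
  refine ⟨fun q => S.JY' ψ (U q.1 q.2 (S.JY y)), ?_, fun q _ => hεu ?_⟩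
  · have hK : 0 ≤ 2 * (S.c * ‖ψ‖ * (S.C * ‖S.JY y‖)) +
        ‖S.JY' ψ‖ * (S.C * (S.c * S.CY * ‖y‖)) := by
      have := S.c_pos
      have := S.CY_nonneg
      positivity
    refine (LipschitzOnWith.of_dist_le_mul (K := ⟨_, hK⟩) fun p hp q hq => ?_).continuousOn
    exact h.abs_dual_sub_le_dist hp hq y ψ
  · rw [dist_eq_norm] at hψ hy ⊢
    have h1 : φ (U q.1 q.2 x) - S.JY' ψ (U q.1 q.2 (S.JY y)) =
        (φ - S.JY' ψ) (U q.1 q.2 x) + S.JY' ψ (U q.1 q.2 (x - S.JY y)) := by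
      simp only [map_sub, ContinuousLinearMap.sub_apply]
      ring
    rw [h1]
    have h2 : ‖(φ - S.JY' ψ) (U q.1 q.2 x)‖ ≤ ‖φ - S.JY' ψ‖ * (S.C * ‖x‖) :=
      ContinuousLinearMap.le_opNorm_of_le _ (h.norm_apply_le _ _ _)
    have h3 : ‖S.JY' ψ (U q.1 q.2 (x - S.JY y))‖ ≤ ‖S.JY' ψ‖ * (S.C * ‖x - S.JY y‖) :=
      ContinuousLinearMap.le_opNorm_of_le _ (h.norm_apply_le _ _ _)
    rw [lt_div_iff₀ (by positivity)] at hψ hy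
    refine (norm_add_le _ _).trans_lt ?_
    nlinarith [norm_nonneg (φ - S.JY' ψ), norm_nonneg (x - S.JY y)]

theorem measurable_dual (h : S.Bounds k U) (x : X) (φ : StrongDual ℝ X) :
    Measurable fun q : ℝ × ℝ => φ (U q.1 q.2 x) := by
  have h1 := (h.continuousOn_dual x φ).measurable_piecewise
    (continuousOn_const (c := (0 : ℝ))) measurableSet_timePairs
  convert h1 using 1
  funext q
  by_cases hq : q ∈ S.timePairs
  · rw [piecewise_eq_of_mem _ _ _ hq]
  · rw [piecewise_eq_of_notMem _ _ _ hq, h.zero_off q.1 q.2 fun h2 => hq (mem_timePairs.2 h2)]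
    simp

theorem stronglyMeasurable [CompleteSpace X] [TopologicalSpace.SeparableSpace X]
    (h : S.Bounds k U) (x : X) : StronglyMeasurable fun q : ℝ × ℝ => U q.1 q.2 x :=
  stronglyMeasurable_of_forall_dual (h.measurable_dual x)

end Bounds

variable (S) in
/-- Countably many matrix coefficients that determine the evolution families in the closure of
the class of members. -/
theorem exists_coordinates [TopologicalSpace.SeparableSpace X] :
    ∃ p : ℕ × ℕ × ℕ → ℝ × ℝ × X × StrongDual ℝ X,
      InjOn (fun (V : Evo X) n => V.coeff (p n)) (closure (S.members 0)) := by
  obtain ⟨φ, hφ⟩ := exists_seq_dual_separating X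
  have : Nonempty S.timePairs :=
    ⟨⟨(S.b, S.b), mem_timePairs.2 ⟨S.hab, le_rfl, le_rfl⟩⟩⟩
  let d := TopologicalSpace.denseSeq S.timePairs
  refine ⟨fun n => ((d n.1).1.1, (d n.1).1.2, TopologicalSpace.denseSeq X n.2.1, φ n.2.2),
    fun V hV W hW hVW => ?_⟩
  have hV' := bounds_of_mem_closure hV
  have hW' := bounds_of_mem_closure hW
  have h1 (i : ℕ) : V (d i).1.1 (d i).1.2 = W (d i).1.1 (d i).1.2 := by
    have : (⇑(V (d i).1.1 (d i).1.2) : X → X) = W (d i).1.1 (d i).1.2 := by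
      refine Continuous.ext_on (TopologicalSpace.denseRange_denseSeq X)
        (V _ _).continuous (W _ _).continuous ?_
      rintro _ ⟨j, rfl⟩
      refine sub_eq_zero.1 (hφ _ fun m => ?_)
      rw [map_sub, sub_eq_zero]
      exact congrFun hVW (i, j, m)
    exact DFunLike.coe_injective this
  refine Evo.eq_of_forall_dual fun t s x ψ => ?_
  by_cases h : S.a < s ∧ s ≤ t ∧ t ≤ S.b
  · have h2 := Continuous.ext_on (TopologicalSpace.denseRange_denseSeq S.timePairs)
      (continuousOn_iff_continuous_restrict.1 (hV'.continuousOn_dual x ψ))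
      (continuousOn_iff_continuous_restrict.1 (hW'.continuousOn_dual x ψ)) (by
        rintro _ ⟨i, rfl⟩
        change ψ (V (d i).1.1 (d i).1.2 x) = ψ (W (d i).1.1 (d i).1.2 x)
        rw [h1])
    exact congrFun h2 ⟨(t, s), mem_timePairs.2 h⟩
  · rw [hV'.zero_off t s h, hW'.zero_off t s h]

variable (S) in
theorem isCompact_closure_members
    (hrefl : Function.Surjective (NormedSpace.inclusionInDoubleDual ℝ X)) (k : ℕ) :
    IsCompact (closure (S.members k)) :=
  (Evo.isCompact_setOf_norm_le hrefl S.C_nonneg).of_isClosed_subset isClosed_closure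
    fun _ hV => (bounds_of_mem_closure hV).opNorm_le'

theorem continuous_coordinates (p : ℕ × ℕ × ℕ → ℝ × ℝ × X × StrongDual ℝ X) :
    Continuous fun (V : Evo X) n => V.coeff (p n) :=
  continuous_pi fun _ => Evo.continuous_coeff _ _ _ _

theorem metrizableSpace_of_subset [TopologicalSpace.SeparableSpace X] {K : Set (Evo X)}
    (hK : IsCompact K) (h : K ⊆ closure (S.members 0)) : TopologicalSpace.MetrizableSpace K := by
  obtain ⟨p, hp⟩ := S.exists_coordinates
  have : CompactSpace K := isCompact_iff_compactSpace.1 hK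
  exact (Continuous.isClosedEmbedding
    ((continuous_coordinates p).comp continuous_subtype_val)
    (injOn_iff_injective.1 (hp.mono h))).isEmbedding.metrizableSpace

variable [CompleteSpace X] [TopologicalSpace.SeparableSpace X]

theorem Bounds.measurable_cut {V W : Evo X} (hV : S.Bounds 0 V) (hW : S.Bounds 0 W) (t s : ℝ)
    (x : X) (φ : StrongDual ℝ X) : Measurable fun r => φ (Evo.cut r V W t s x) := by
  borelize X
  have := UniformSpace.secondCountable_of_separable X
  have h1 : Measurable fun r => φ (W t r (V r s x)) := by
    have h2 : StronglyMeasurable (Function.uncurry fun (z : X) (r : ℝ) => φ (W t r z)) :=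
      stronglyMeasurable_uncurry_of_continuous_of_stronglyMeasurable (fun r => by fun_prop)
        fun z => ((hW.measurable_dual z φ).comp
          (measurable_const.prodMk measurable_id : Measurable fun r : ℝ => (t, r))
          ).stronglyMeasurable
    have h3 : Measurable fun r => V r s x := ((hV.stronglyMeasurable x).comp_measurable
      (measurable_id.prodMk measurable_const : Measurable fun r : ℝ => (r, s))).measurable
    exact h2.measurable.comp (h3.prodMk measurable_id)
  have h2 : (fun r => φ (Evo.cut r V W t s x)) = fun r =>
      if r ∈ Iic s then φ (W t s x) else if r ∈ Ici t then φ (V t s x) else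
        φ (W t r (V r s x)) := by
    funext r
    simp only [Evo.cut, mem_Iic, mem_Ici]
    split_ifs <;> rfl
  rw [h2]
  exact Measurable.ite measurableSet_Iic measurable_const
    (Measurable.ite measurableSet_Ici measurable_const h1)

variable (S) in
/-- There is a limit of approximating evolution families which is idempotent under concatenation
at almost every time. -/
theorem exists_limit (hrefl : Function.Surjective (NormedSpace.inclusionInDoubleDual ℝ X)) :
    ∃ V : Evo X, (∀ k, V ∈ closure (S.members k)) ∧ ∀ᵐ r : ℝ, Evo.cut r V V = V := by
  set K : Set (Evo X) := ⋂ k, closure (S.members k) with hK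
  have hKsub : K ⊆ closure (S.members 0) := iInter_subset _ 0
  have hKne : K.Nonempty := IsCompact.nonempty_iInter_of_sequence_nonempty_isCompact_isClosed _
    (fun k => closure_mono (S.members_anti k.le_succ)) (fun k => (S.members_nonempty k).closure)
    (S.isCompact_closure_members hrefl 0) fun k => isClosed_closure
  have hKc : IsCompact K := (S.isCompact_closure_members hrefl 0).of_isClosed_subset
    (isClosed_iInter fun _ => isClosed_closure) hKsub
  have hbK (V : K) : S.Bounds 0 V.1 := bounds_of_mem_closure (hKsub V.2)
  have hcut (r : ℝ) (V W : K) : Evo.cut r V.1 W.1 ∈ K := mem_iInter.2 fun k =>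
    cut_mem_closure (mem_iInter.1 V.2 k) (mem_iInter.1 W.2 k) r
  have : CompactSpace K := isCompact_iff_compactSpace.1 hKc
  have : Nonempty K := hKne.to_subtype
  have : TopologicalSpace.MetrizableSpace K := metrizableSpace_of_subset hKc hKsub
  letI : MeasurableSpace K := borel K
  have : BorelSpace K := ⟨rfl⟩
  have : PolishSpace K := by
    letI := TopologicalSpace.metrizableSpaceMetric K
    infer_instance
  let m : ℝ → K → K → K := fun r V W => ⟨Evo.cut r V.1 W.1, hcut r V W⟩
  have hcont_left (r : ℝ) (W : K) : Continuous fun V => m r V W :=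
    ((Evo.continuous_cut_left r W.1).comp continuous_subtype_val).subtype_mk _
  have hcont_right (r : ℝ) (V : K) : Continuous fun W => m r V W :=
    ((Evo.continuous_cut_right r V.1).comp continuous_subtype_val).subtype_mk _
  have hmeas : Measurable fun p : ℝ × K × K => m p.1 p.2.1 p.2.2 := by
    obtain ⟨p, hp⟩ := S.exists_coordinates
    have hemb : MeasurableEmbedding fun (V : K) n => V.1.coeff (p n) :=
      ((continuous_coordinates p).comp continuous_subtype_val).measurableEmbedding
        (injOn_iff_injective.1 (hp.mono hKsub))
    refine hemb.measurable_comp_iff.1 (measurable_pi_lambda _ fun n => ?_)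
    have hcoeff : Continuous fun V : K => V.1.coeff (p n) :=
      (Evo.continuous_coeff _ _ _ _).comp continuous_subtype_val
    have h1 (W : K) : StronglyMeasurable
        (Function.uncurry fun (V : K) (r : ℝ) => (m r V W).1.coeff (p n)) :=
      stronglyMeasurable_uncurry_of_continuous_of_stronglyMeasurable
        (fun r => hcoeff.comp (hcont_left r W))
        fun V => ((hbK V).measurable_cut (hbK W) _ _ _ _).stronglyMeasurable
    have h2 : StronglyMeasurable
        (Function.uncurry fun (W : K) (q : K × ℝ) => (m q.2 q.1 W).1.coeff (p n)) :=
      stronglyMeasurable_uncurry_of_continuous_of_stronglyMeasurable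
        (fun q => hcoeff.comp (hcont_right q.2 q.1)) h1
    exact h2.measurable.comp ((measurable_snd.comp measurable_snd).prodMk
      ((measurable_fst.comp measurable_snd).prodMk measurable_fst))
  have hm : CutSystem m :=
    { measurable := hmeas
      cont_left := hcont_left
      cont_right := hcont_right
      assoc := fun r r' h V W Z => Subtype.ext (Evo.cut_assoc h _ _ _)
      absorb_left := fun r r' h V W Z => Subtype.ext (Evo.cut_absorb_left h _ _ _)
      absorb_right := fun r r' h V W Z => Subtype.ext (Evo.cut_absorb_right h _ _ _)
      idem := fun r V W => Subtype.ext (Evo.cut_idem r _ _) }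
  obtain ⟨V, hV⟩ := hm.exists_ae_idempotent
  refine ⟨V.1, mem_iInter.1 V.2, ?_⟩
  filter_upwards [hV] with r hr
  exact congrArg Subtype.val hr

theorem exists_seq_tendsto
    (hrefl : Function.Surjective (NormedSpace.inclusionInDoubleDual ℝ X)) {V : Evo X}
    (hV : ∀ k, V ∈ closure (S.members k)) :
    ∃ W : ℕ → Evo X, (∀ k, W k ∈ S.members k) ∧ Tendsto W atTop (𝓝 V) := by
  have := metrizableSpace_of_subset (S.isCompact_closure_members hrefl 0) subset_rfl
  have : (𝓝[closure (S.members 0)] V).IsCountablyGenerated := by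
    rw [nhdsWithin_eq_map_subtype_coe (hV 0)]
    infer_instance
  obtain ⟨u, hu⟩ := (𝓝[closure (S.members 0)] V).exists_antitone_basis
  have h1 (k : ℕ) : (u k ∩ S.members k).Nonempty := by
    have h2 := mem_closure_iff_nhdsWithin_neBot.1 (hV k)
    refine Filter.nonempty_of_mem (f := 𝓝[S.members k] V)
      (inter_mem (nhdsWithin_mono _ ?_ (hu.mem k)) self_mem_nhdsWithin)
    exact (S.members_anti k.zero_le).trans subset_closure
  choose W hW using h1
  exact ⟨W, fun k => (hW k).2, (hu.tendsto fun k => (hW k).1).mono_right nhdsWithin_le_nhds⟩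

end KatoSetting

namespace KatoSetting

variable {X Y Y' : Type*} [NormedAddCommGroup X] [NormedSpace ℝ X]
    [NormedAddCommGroup Y] [NormedSpace ℝ Y] [NormedAddCommGroup Y'] [NormedSpace ℝ Y']
    {S : KatoSetting X Y Y'}

variable (S) in
/-- Limits of the approximating evolution families that factorize off a null set. -/
structure AlmostPropagator (U : ℝ → ℝ → X →L[ℝ] X) (N : Set ℝ) : Prop where
  bounds : ∀ k, S.Bounds k U
  subset : N ⊆ Ioc S.a S.b
  null : volume N = 0
  comp : ∀ s r t, S.a < s → s ≤ r → r ≤ t → t ≤ S.b → r ∉ N → ∀ x, U t r (U r s x) = U t s x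

theorem almostPropagator_of_cut_eq {V : Evo X} (hV : ∀ k, V ∈ closure (S.members k))
    (h : ∀ᵐ r : ℝ, Evo.cut r V V = V) :
    S.AlmostPropagator V {r | r ∈ Ioc S.a S.b ∧ Evo.cut r V V ≠ V} where
  bounds k := bounds_of_mem_closure (hV k)
  subset _ hr := hr.1
  null := measure_mono_null (fun _ hr => hr.2) h
  comp s r t hs hsr hrt ht hr x := by
    have hb := bounds_of_mem_closure (hV 0)
    rcases hsr.eq_or_lt with rfl | hsr
    · rw [hb.refl s ⟨hs, hrt.trans ht⟩]
      rfl
    rcases hrt.eq_or_lt with rfl | hrt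
    · rw [hb.refl r ⟨hs.trans hsr, ht⟩]
      rfl
    have h1 : Evo.cut r V V = V := by
      by_contra h2
      exact hr ⟨⟨hs.trans hsr, hrt.le.trans ht⟩, h2⟩
    conv_rhs => rw [← h1, Evo.cut_of_lt_of_lt hsr hrt]
    rfl

theorem Bounds.norm_sub_left_uniform {k : ℕ} {U : ℝ → ℝ → X →L[ℝ] X} (h : S.Bounds k U) (x : X)
    {ε : ℝ} (hε : 0 < ε) : ∃ δ : ℝ, 0 < δ ∧ ∀ t s s', S.a < s → s ≤ t → S.a < s' → s' ≤ t →
      t ≤ S.b → |s - s'| < δ → ‖U t s x - U t s' x‖ ≤ ε := by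
  have hC := S.C_nonneg
  have hc := S.c_pos
  have hCY := S.CY_nonneg
  obtain ⟨y, hy⟩ := S.JY_dense.exists_dist_lt x (show 0 < ε / 3 / (S.C + 1) by positivity)
  rw [dist_eq_norm, lt_div_iff₀ (by positivity)] at hy
  set L := S.C * (S.c * S.CY * ‖y‖) with hL
  have hL0 : 0 ≤ L := by positivity
  refine ⟨ε / 3 / (L + 1), by positivity, fun t s s' hs hst hs' hst' ht hd => ?_⟩
  rw [lt_div_iff₀ (by positivity)] at hd
  have h1 : ‖U t s (S.JY y) - U t s' (S.JY y)‖ ≤ L * |s - s'| := by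
    rcases le_total s s' with h2 | h2
    · rw [norm_sub_rev, abs_sub_comm, abs_of_nonneg (sub_nonneg.2 h2)]
      exact h.norm_sub_left_le s s' t hs h2 hst' ht y
    · rw [abs_of_nonneg (sub_nonneg.2 h2)]
      exact h.norm_sub_left_le s' s t hs' h2 hst ht y
  have h2 := h.norm_apply_le t s (x - S.JY y)
  have h3 := h.norm_apply_le t s' (x - S.JY y)
  have h4 : U t s x - U t s' x = U t s (x - S.JY y) - U t s' (x - S.JY y) +
      (U t s (S.JY y) - U t s' (S.JY y)) := by
    simp only [map_sub]
    abel
  rw [h4]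
  refine (norm_add_le _ _).trans ((add_le_add_left (norm_sub_le _ _) _).trans ?_)
  nlinarith [norm_nonneg (x - S.JY y), abs_nonneg (s - s')]

theorem Bounds.norm_sub_self_uniform {k : ℕ} {U : ℝ → ℝ → X →L[ℝ] X} (h : S.Bounds k U) (x : X)
    {ε : ℝ} (hε : 0 < ε) : ∃ δ : ℝ, 0 < δ ∧ ∀ t s, S.a < s → s ≤ t → t ≤ S.b → t - s < δ →
      ‖U t s x - x‖ ≤ ε := by
  obtain ⟨δ, hδ, h1⟩ := h.norm_sub_left_uniform x hε
  refine ⟨δ, hδ, fun t s hs hst ht hd => ?_⟩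
  have h2 := h1 t s t hs hst (hs.trans_le hst) le_rfl ht (by
    rwa [abs_sub_comm, abs_of_nonneg (sub_nonneg.2 hst)])
  rwa [h.refl t ⟨hs.trans_le hst, ht⟩] at h2

variable (S) in
theorem exists_approx_A (y : Y) {s : ℝ} (hs : s ∈ Ioc S.a S.b) {ε : ℝ} (hε : 0 < ε) :
    ∃ z : Y, ‖S.A s (S.JY y) - S.JY z‖ ≤ ε ∧ ∃ δ : ℝ, 0 < δ ∧
      ∀ τ ∈ Ioc S.a S.b, |τ - s| < δ → ‖S.A τ (S.JY y) - S.JY z‖ ≤ 2 * ε := by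
  obtain ⟨z, hz⟩ := S.JY_dense.exists_dist_lt (S.A s (S.JY y)) hε
  rw [dist_eq_norm] at hz
  obtain ⟨δ, hδ, h⟩ := Metric.continuousWithinAt_iff.1 (S.continuousOn_A y s hs) ε hε
  refine ⟨z, hz.le, δ, hδ, fun τ hτ hd => ?_⟩
  have h1 := h hτ (by rwa [Real.dist_eq])
  rw [dist_eq_norm] at h1
  have h2 := norm_sub_le_norm_sub_add_norm_sub (S.A τ (S.JY y)) (S.A s (S.JY y)) (S.JY z)
  linarith

namespace AlmostPropagator

variable {U : ℝ → ℝ → X →L[ℝ] X} {N : Set ℝ}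

theorem opNorm_le (h : S.AlmostPropagator U N) {s t : ℝ} (hs : S.a < s) (hst : s ≤ t)
    (ht : t ≤ S.b) : ‖U t s‖ ≤ S.M * exp (S.ω * (t - s)) := by
  have h1 : Tendsto (fun k => S.M * exp (S.rate k * (t - s))) atTop
      (𝓝 (S.M * exp (S.ω * (t - s)))) :=
    ((continuous_exp.tendsto _).comp (S.tendsto_rate.mul_const _)).const_mul _
  exact ge_of_tendsto h1 (Eventually.of_forall fun k => (h.bounds k).opNorm_le s t hs hst ht)

theorem norm_sub_sub_smul_le (h : S.AlmostPropagator U N) {s t : ℝ} (hs : S.a < s) (hst : s ≤ t)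
    (ht : t ≤ S.b) {y z : Y} {m : ℝ} (hm : ∀ τ ∈ Icc s t, ‖S.A τ (S.JY y) - S.JY z‖ ≤ m) :
    ‖U t s (S.JY y) - S.JY y - (t - s) • S.JY z‖ ≤
      (S.C * (S.c * m) + S.C * (S.c * S.CY * ‖z‖) * (t - s)) * (t - s) := by
  have h1 : Tendsto (fun k => (S.C * (S.c * (m + (S.freq k)⁻¹ * ‖z‖)) +
      S.C * (S.c * S.CY * ‖z‖) * (t - s)) * (t - s)) atTop
      (𝓝 ((S.C * (S.c * (m + 0 * ‖z‖)) + S.C * (S.c * S.CY * ‖z‖) * (t - s)) * (t - s))) :=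
    (((((S.tendsto_inv_freq.mul_const _).const_add _).const_mul _).const_mul _).add_const
      _).mul_const _
  rw [zero_mul, add_zero] at h1
  exact ge_of_tendsto h1 (Eventually.of_forall fun k =>
    (h.bounds k).norm_sub_sub_smul_le s t hs hst ht y z m hm)

theorem norm_sub_left_sub_smul_le (h : S.AlmostPropagator U N) {s s' t : ℝ} (hs : S.a < s)
    (hss : s ≤ s') (hst : s' ≤ t) (ht : t ≤ S.b) {y z : Y} {m : ℝ}
    (hm : ∀ τ ∈ Icc s s', ‖S.A τ (S.JY y) - S.JY z‖ ≤ m) :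
    ‖U t s (S.JY y) - U t s' (S.JY y) - (s' - s) • U t s' (S.JY z)‖ ≤
      S.C * ((S.C * (S.c * m) + S.C * (S.c * S.CY * ‖z‖) * (s' - s)) * (s' - s)) := by
  rcases hss.eq_or_lt with rfl | hss
  · simp
  have hb := h.bounds 0
  set E : ℝ → ℝ := fun r => S.C * ((S.C * (S.c * m) + S.C * (S.c * S.CY * ‖z‖) * (r - s)) *
    (r - s)) with hE
  have hlim (x : X) : Tendsto (fun r => U t r x) (𝓝[Ioo s s'] s') (𝓝 (U t s' x)) := by
    refine Metric.tendsto_nhds.2 fun ε hε => ?_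
    obtain ⟨δ, hδ, h1⟩ := hb.norm_sub_left_uniform x (half_pos hε)
    filter_upwards [self_mem_nhdsWithin, mem_nhdsWithin_of_mem_nhds (Metric.ball_mem_nhds s' hδ)]
      with r hr hr'
    rw [dist_eq_norm]
    exact (h1 t r s' (hs.trans hr.1) (hr.2.le.trans hst) (hs.trans hss) hst ht
      (by rwa [Metric.mem_ball, Real.dist_eq] at hr')).trans_lt (half_lt_self hε)
  have hne : (𝓝[Ioo s s' \ N] s').NeBot := by
    refine mem_closure_iff_nhdsWithin_neBot.1 (Metric.mem_closure_iff.2 fun ε hε => ?_)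
    have h1 : (Ioo (max s (s' - ε)) s' \ N).Nonempty := by
      by_contra h2
      rw [not_nonempty_iff_eq_empty, sdiff_eq_empty] at h2
      have h3 := measure_mono_null h2 h.null
      rw [Real.volume_Ioo, ENNReal.ofReal_eq_zero, sub_nonpos] at h3
      exact absurd h3 (not_le.2 (max_lt hss (sub_lt_self _ hε)))
    obtain ⟨r, hr, hrN⟩ := h1
    refine ⟨r, ⟨⟨(le_max_left _ _).trans_lt hr.1, hr.2⟩, hrN⟩, ?_⟩
    rw [Real.dist_eq, abs_of_pos (sub_pos.2 hr.2)]
    linarith [(le_max_right _ _).trans_lt hr.1]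
  have hmono : 𝓝[Ioo s s' \ N] s' ≤ 𝓝[Ioo s s'] s' := nhdsWithin_mono _ sdiff_subset
  have hsub : Tendsto (fun r => r - s) (𝓝[Ioo s s' \ N] s') (𝓝 (s' - s)) :=
    ((continuous_id.sub continuous_const).tendsto s').mono_left nhdsWithin_le_nhds
  have hEc : Tendsto E (𝓝[Ioo s s' \ N] s') (𝓝 (E s')) := by
    have : Continuous E := by fun_prop
    exact (this.tendsto s').mono_left nhdsWithin_le_nhds
  refine le_of_tendsto_of_tendsto
    (((tendsto_const_nhds (x := U t s (S.JY y))).sub ((hlim (S.JY y)).mono_left hmono)).sub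
      (hsub.smul ((hlim (S.JY z)).mono_left hmono))).norm hEc ?_
  filter_upwards [self_mem_nhdsWithin] with r hr
  have hrt : r ≤ t := hr.1.2.le.trans hst
  have h1 := h.norm_sub_sub_smul_le hs hr.1.1.le (hrt.trans ht)
    fun τ hτ => hm τ ⟨hτ.1, hτ.2.trans hr.1.2.le⟩
  have h2 : U t s (S.JY y) - U t r (S.JY y) - (r - s) • U t r (S.JY z) =
      U t r (U r s (S.JY y) - S.JY y - (r - s) • S.JY z) := by
    rw [map_sub, map_sub, map_smul, h.comp s r t hs hr.1.1.le hrt ht hr.2]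
  rw [h2]
  exact ((U t r).le_of_opNorm_le (hb.opNorm_le' _ _) _).trans
    (mul_le_mul_of_nonneg_left h1 S.C_nonneg)

theorem hasDerivWithinAt_left (h : S.AlmostPropagator U N) (y : Y) {s t : ℝ} (hs : S.a < s)
    (hst : s ≤ t) (ht : t ≤ S.b) :
    HasDerivWithinAt (fun σ => U t σ (S.JY y)) (-(U t s (S.A s (S.JY y))))
      (Ioc S.a S.b ∩ Iic t) s := by
  have hC := S.C_nonneg
  have hc := S.c_pos
  have hCY := S.CY_nonneg
  have hb := h.bounds 0
  rw [hasDerivWithinAt_iff_isLittleO, Asymptotics.isLittleO_iff]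
  intro ε hε
  set η := ε / (3 * (2 * (S.C * (S.C * S.c)) + S.C + 1)) with hη
  have hη0 : 0 < η := by positivity
  have hη1 : η * (2 * (S.C * (S.C * S.c)) + S.C + 1) = ε / 3 := by
    rw [hη]
    field_simp
  obtain ⟨z, hz, δ₁, hδ₁, hm⟩ := S.exists_approx_A y ⟨hs, hst.trans ht⟩ hη0
  obtain ⟨δ₂, hδ₂, hd⟩ := hb.norm_sub_left_uniform (S.A s (S.JY y)) hη0
  set L := S.C * (S.C * (S.c * S.CY * ‖z‖)) with hL
  have hL0 : 0 ≤ L := by positivity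
  have hδ₃ : 0 < ε / 3 / (L + 1) := by positivity
  filter_upwards [self_mem_nhdsWithin, mem_nhdsWithin_of_mem_nhds (Metric.ball_mem_nhds s
    (lt_min hδ₁ (lt_min hδ₂ hδ₃)))] with r hr hrd
  rw [Metric.mem_ball, Real.dist_eq, lt_min_iff, lt_min_iff, lt_div_iff₀ (by positivity)] at hrd
  obtain ⟨hd1, hd2, hd3⟩ := hrd
  have hrt : r ≤ t := hr.2
  have hra : S.a < r := hr.1.1
  have h5 (v : ℝ) : ‖U t v (S.JY z - S.A s (S.JY y))‖ ≤ S.C * η := by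
    rw [← norm_sub_rev] at hz
    exact (hb.norm_apply_le _ _ _).trans (mul_le_mul_of_nonneg_left hz hC)
  have h6 := hd t r s hra hrt hs hst ht hd2
  rw [Real.norm_eq_abs]
  have fin {R : ℝ} (hR : R ≤ S.C * ((S.C * (S.c * (2 * η)) +
      S.C * (S.c * S.CY * ‖z‖) * |r - s|) * |r - s|) + |r - s| * (S.C * η + η)) :
      R ≤ ε * |r - s| := by
    refine hR.trans ?_
    have h7 : S.C * ((S.C * (S.c * (2 * η)) + S.C * (S.c * S.CY * ‖z‖) * |r - s|) * |r - s|) +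
      |r - s| * (S.C * η + η) =
        (η * (2 * (S.C * (S.C * S.c)) + S.C + 1) + L * |r - s|) * |r - s| := by
      rw [hL]
      ring
    rw [h7, hη1]
    refine mul_le_mul_of_nonneg_right ?_ (abs_nonneg _)
    nlinarith [abs_nonneg (r - s)]
  rcases le_total r s with hrs | hrs
  · have hrs' : |r - s| = s - r := by
      rw [abs_sub_comm, abs_of_nonneg (sub_nonneg.2 hrs)]
    have h1 := h.norm_sub_left_sub_smul_le hra hrs hst ht (y := y) (z := z) (m := 2 * η)
      fun τ hτ => hm τ ⟨hra.trans_le hτ.1, hτ.2.trans (hst.trans ht)⟩ (by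
        rw [abs_sub_comm, abs_of_nonneg (sub_nonneg.2 hτ.2)]
        linarith [hτ.1])
    have h2 : U t r (S.JY y) - U t s (S.JY y) - (r - s) • -(U t s (S.A s (S.JY y))) =
        (U t r (S.JY y) - U t s (S.JY y) - (s - r) • U t s (S.JY z)) +
          (s - r) • (U t s (S.JY z - S.A s (S.JY y))) := by
      rw [map_sub]
      module
    rw [h2]
    refine fin ((norm_add_le _ _).trans ?_)
    rw [norm_smul, Real.norm_eq_abs, abs_of_nonneg (sub_nonneg.2 hrs), hrs']
    have := mul_le_mul_of_nonneg_left ((h5 s).trans (le_add_of_nonneg_right hη0.le))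
      (sub_nonneg.2 hrs)
    linarith
  · have hrs' : |r - s| = r - s := abs_of_nonneg (sub_nonneg.2 hrs)
    have h1 := h.norm_sub_left_sub_smul_le hs hrs hrt ht (y := y) (z := z) (m := 2 * η)
      fun τ hτ => hm τ ⟨hs.trans_le hτ.1, hτ.2.trans (hrt.trans ht)⟩ (by
        rw [abs_of_nonneg (sub_nonneg.2 hτ.1)]
        linarith [hτ.2])
    have h2 : U t r (S.JY y) - U t s (S.JY y) - (r - s) • -(U t s (S.A s (S.JY y))) =
        -(U t s (S.JY y) - U t r (S.JY y) - (r - s) • U t r (S.JY z)) -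
          (r - s) • (U t r (S.JY z - S.A s (S.JY y)) +
            (U t r (S.A s (S.JY y)) - U t s (S.A s (S.JY y)))) := by
      rw [map_sub]
      module
    rw [h2]
    refine fin ((norm_sub_le _ _).trans ?_)
    rw [norm_neg, norm_smul, Real.norm_eq_abs, hrs']
    have := mul_le_mul_of_nonneg_left ((norm_add_le _ _).trans (add_le_add (h5 r) h6))
      (sub_nonneg.2 hrs)
    linarith

theorem hasDerivWithinAt_right (h : S.AlmostPropagator U N) (y : Y) {s : ℝ}
    (hs : s ∈ Ioc S.a S.b) :
    HasDerivWithinAt (fun τ => U τ s (S.JY y)) (S.A s (S.JY y)) (Ioc S.a S.b ∩ Ici s) s := by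
  have hC := S.C_nonneg
  have hc := S.c_pos
  have hCY := S.CY_nonneg
  have hb := h.bounds 0
  rw [hasDerivWithinAt_iff_isLittleO, Asymptotics.isLittleO_iff]
  intro ε hε
  set η := ε / (2 * (2 * (S.C * S.c) + 1)) with hη
  have hη0 : 0 < η := by positivity
  have hη1 : η * (2 * (S.C * S.c) + 1) = ε / 2 := by
    rw [hη]
    field_simp
  obtain ⟨z, hz, δ₁, hδ₁, hm⟩ := S.exists_approx_A y hs hη0
  set L := S.C * (S.c * S.CY * ‖z‖) with hL
  have hL0 : 0 ≤ L := by positivity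
  have hδ₃ : 0 < ε / 2 / (L + 1) := by positivity
  filter_upwards [self_mem_nhdsWithin, mem_nhdsWithin_of_mem_nhds (Metric.ball_mem_nhds s
    (lt_min hδ₁ hδ₃))] with r hr hrd
  have hrs : s ≤ r := hr.2
  have hrs' : |r - s| = r - s := abs_of_nonneg (sub_nonneg.2 hrs)
  rw [Metric.mem_ball, Real.dist_eq, lt_min_iff, lt_div_iff₀ (by positivity), hrs'] at hrd
  have h1 := h.norm_sub_sub_smul_le hs.1 hrs hr.1.2 (y := y) (z := z) (m := 2 * η)
    fun τ hτ => hm τ ⟨hs.1.trans_le hτ.1, hτ.2.trans hr.1.2⟩ (by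
      rw [abs_of_nonneg (sub_nonneg.2 hτ.1)]
      linarith [hτ.2])
  have h2 : U r s (S.JY y) - U s s (S.JY y) - (r - s) • S.A s (S.JY y) =
      (U r s (S.JY y) - S.JY y - (r - s) • S.JY z) - (r - s) • (S.A s (S.JY y) - S.JY z) := by
    rw [hb.refl s hs]
    change U r s (S.JY y) - S.JY y - _ = _
    module
  rw [h2, Real.norm_eq_abs, hrs']
  refine (norm_sub_le _ _).trans ?_
  rw [norm_smul, Real.norm_eq_abs, hrs']
  have h3 := mul_le_mul_of_nonneg_left hz (sub_nonneg.2 hrs)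
  have h4 : (S.C * (S.c * (2 * η)) + L * (r - s)) * (r - s) + (r - s) * η =
      (η * (2 * (S.C * S.c) + 1) + L * (r - s)) * (r - s) := by
    ring
  refine (add_le_add h1 h3).trans (h4.trans_le ?_)
  rw [hη1]
  refine mul_le_mul_of_nonneg_right ?_ (sub_nonneg.2 hrs)
  nlinarith [sub_nonneg.2 hrs]

end AlmostPropagator

end KatoSetting

/-- Operations on functions that induce bounded linear operators between `L²` spaces. -/
structure IsLpBounded {α E F : Type*} [MeasurableSpace α] [NormedAddCommGroup E] [NormedSpace ℝ E]
    [NormedAddCommGroup F] [NormedSpace ℝ F] (μ : Measure α) (K : ℝ)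
    (Φ : (α → E) → α → F) : Prop where
  add : ∀ f g, MemLp f 2 μ → MemLp g 2 μ → Φ (f + g) =ᵐ[μ] Φ f + Φ g
  smul : ∀ (c : ℝ) f, MemLp f 2 μ → Φ (c • f) =ᵐ[μ] c • Φ f
  congr : ∀ f g, f =ᵐ[μ] g → Φ f =ᵐ[μ] Φ g
  aestronglyMeasurable : ∀ f, MemLp f 2 μ → AEStronglyMeasurable (Φ f) μ
  eLpNorm_le : ∀ f, MemLp f 2 μ → eLpNorm (Φ f) 2 μ ≤ ENNReal.ofReal K * eLpNorm f 2 μ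

theorem tendsto_eLpNorm_of_norm_le_const {α ι F : Type*} [MeasurableSpace α]
    [NormedAddCommGroup F] {μ : Measure α} [IsFiniteMeasure μ] {l : Filter ι}
    [l.IsCountablyGenerated] {f : ι → α → F} {B : ℝ}
    (hf : ∀ᶠ i in l, AEStronglyMeasurable (f i) μ) (hB : ∀ᶠ i in l, ∀ᵐ t ∂μ, ‖f i t‖ ≤ B)
    (hlim : ∀ᵐ t ∂μ, Tendsto (fun i => f i t) l (𝓝 0)) :
    Tendsto (fun i => eLpNorm (f i) 2 μ) l (𝓝 0) := by
  have h1 : Tendsto (fun i => ∫ t, ‖f i t‖ ^ (2 : ℝ) ∂μ) l (𝓝 (∫ _ : α, (0 : ℝ) ∂μ)) := by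
    refine tendsto_integral_filter_of_dominated_convergence (fun _ => B ^ (2 : ℝ)) ?_ ?_
      (integrable_const _) ?_
    · filter_upwards [hf] with i hi
      exact (hi.norm.aemeasurable.pow_const _).aestronglyMeasurable
    · filter_upwards [hB] with i hi
      filter_upwards [hi] with t ht
      rw [Real.norm_eq_abs, abs_of_nonneg (by positivity)]
      exact rpow_le_rpow (norm_nonneg _) ht two_pos.le
    · filter_upwards [hlim] with t ht
      have := (ht.norm.rpow_const (p := 2) (Or.inr two_pos.le))
      rwa [norm_zero, zero_rpow two_ne_zero] at this
  rw [integral_zero] at h1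
  have h2 := ENNReal.tendsto_ofReal (h1.rpow_const (p := 2⁻¹) (Or.inr (by norm_num)))
  rw [zero_rpow (by norm_num), ENNReal.ofReal_zero] at h2
  refine h2.congr' ?_
  filter_upwards [hf, hB] with i hi hi'
  have h3 : MemLp (f i) 2 μ := (MemLp.of_bound hi B hi')
  rw [h3.eLpNorm_eq_integral_rpow_norm two_ne_zero ENNReal.ofNat_ne_top]
  simp

namespace IsLpBounded

variable {α E F : Type*} [MeasurableSpace α] [NormedAddCommGroup E] [NormedSpace ℝ E]
  [NormedAddCommGroup F] [NormedSpace ℝ F] {μ : Measure α} {K : ℝ} {Φ : (α → E) → α → F}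

theorem memLp (h : IsLpBounded μ K Φ) {f : α → E} (hf : MemLp f 2 μ) : MemLp (Φ f) 2 μ :=
  ⟨h.aestronglyMeasurable f hf, (h.eLpNorm_le f hf).trans_lt
    (ENNReal.mul_lt_top ENNReal.ofReal_lt_top hf.2)⟩

theorem sub (h : IsLpBounded μ K Φ) {f g : α → E} (hf : MemLp f 2 μ) (hg : MemLp g 2 μ) :
    Φ (f - g) =ᵐ[μ] Φ f - Φ g := by
  have h1 : f - g = f + (-1 : ℝ) • g := by
    rw [neg_one_smul, sub_eq_add_neg]
  rw [h1]
  filter_upwards [h.add f _ hf (hg.const_smul (-1 : ℝ)), h.smul (-1) g hg] with t h2 h3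
  rw [h2, Pi.add_apply, h3, Pi.smul_apply, neg_one_smul, Pi.sub_apply, sub_eq_add_neg]

/-- The operator between `L²` spaces induced by an operation on functions. -/
noncomputable def toCLM (h : IsLpBounded μ K Φ) : Lp E 2 μ →L[ℝ] Lp F 2 μ :=
  LinearMap.mkContinuous
    { toFun := fun f => (h.memLp (Lp.memLp f)).toLp (Φ f)
      map_add' := fun f g => by
        rw [← MemLp.toLp_add, MemLp.toLp_eq_toLp_iff]
        exact (h.congr _ _ (Lp.coeFn_add f g)).trans (h.add _ _ (Lp.memLp f) (Lp.memLp g))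
      map_smul' := fun c f => by
        rw [RingHom.id_apply, ← MemLp.toLp_const_smul, MemLp.toLp_eq_toLp_iff]
        exact (h.congr _ _ (Lp.coeFn_smul c f)).trans (h.smul c _ (Lp.memLp f)) } (max K 0)
    fun f => by
      change ‖(h.memLp (Lp.memLp f)).toLp (Φ f)‖ ≤ _
      rw [Lp.norm_toLp, Lp.norm_def]
      have h1 := ENNReal.toReal_mono (ENNReal.mul_ne_top ENNReal.ofReal_ne_top (Lp.memLp f).2.ne)
        (h.eLpNorm_le f (Lp.memLp f))
      rwa [ENNReal.toReal_mul, ENNReal.toReal_ofReal'] at h1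

theorem coeFn_toCLM (h : IsLpBounded μ K Φ) (f : Lp E 2 μ) : ⇑(h.toCLM f) =ᵐ[μ] Φ f :=
  MemLp.coeFn_toLp (h.memLp (Lp.memLp f))

theorem norm_toCLM_le (h : IsLpBounded μ K Φ) : ‖h.toCLM‖ ≤ max K 0 :=
  LinearMap.mkContinuous_norm_le _ (le_max_right _ _) _

/-- Uniformly bounded operators on `L²` converge strongly if they converge boundedly and pointwise
on bounded continuous functions. -/
theorem tendsto_eLpNorm_sub [TopologicalSpace α] [NormalSpace α] [BorelSpace α]
    [IsFiniteMeasure μ] [μ.WeaklyRegular] {ι : Type*} {l : Filter ι} [l.IsCountablyGenerated]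
    {Ψ : ι → (α → E) → α → F}
    (hΨ : ∀ᶠ i in l, IsLpBounded μ K (Ψ i)) (h : IsLpBounded μ K Φ)
    (hB : ∀ g : α → E, Continuous g → (∃ C, ∀ t, ‖g t‖ ≤ C) → ∃ B : ℝ,
      ∀ᶠ i in l, ∀ᵐ t ∂μ, ‖Ψ i g t - Φ g t‖ ≤ B)
    (hlim : ∀ g : α → E, Continuous g → (∃ C, ∀ t, ‖g t‖ ≤ C) →
      ∀ᵐ t ∂μ, Tendsto (fun i => Ψ i g t) l (𝓝 (Φ g t)))
    {f : α → E} (hf : MemLp f 2 μ) :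
    Tendsto (fun i => eLpNorm (Ψ i f - Φ f) 2 μ) l (𝓝 0) := by
  refine ENNReal.tendsto_nhds_zero.2 fun ε hε => ?_
  rcases eq_or_ne ε ⊤ with rfl | hε'
  · exact Eventually.of_forall fun _ => le_top
  set k : ℝ≥0∞ := ENNReal.ofReal K + 1 with hk
  have hk0 : k ≠ 0 := by simp [hk]
  have hk' : k ≠ ⊤ := by simp [hk]
  have hδ : ε / 3 / k ≠ 0 :=
    (ENNReal.div_pos (ENNReal.div_pos hε.ne' ENNReal.ofNat_ne_top).ne' hk').ne'
  obtain ⟨g, hgc, hgb, hg, hgm⟩ : ∃ g : α → E, Continuous g ∧ (∃ C, ∀ t, ‖g t‖ ≤ C) ∧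
      eLpNorm (f - g) 2 μ ≤ ε / 3 / k ∧ MemLp g 2 μ := by
    obtain ⟨g, hg, hgm⟩ := hf.exists_boundedContinuous_eLpNorm_sub_le ENNReal.ofNat_ne_top hδ
    exact ⟨g, g.continuous, ⟨‖g‖, g.norm_coe_le_norm⟩, hg, hgm⟩
  have hfg := hf.sub hgm
  have key {Θ : (α → E) → α → F} (hΘ : IsLpBounded μ K Θ) :
      eLpNorm (Θ (f - g)) 2 μ ≤ ε / 3 :=
    calc eLpNorm (Θ (f - g)) 2 μ ≤ ENNReal.ofReal K * eLpNorm (f - g) 2 μ := hΘ.eLpNorm_le _ hfg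
      _ ≤ k * (ε / 3 / k) := mul_le_mul' le_self_add hg
      _ = ε / 3 := ENNReal.mul_div_cancel hk0 hk'
  obtain ⟨B, hB⟩ := hB g hgc hgb
  have h1 : Tendsto (fun i => eLpNorm (Ψ i g - Φ g) 2 μ) l (𝓝 0) := by
    refine tendsto_eLpNorm_of_norm_le_const (B := B) ?_ hB ?_
    · filter_upwards [hΨ] with i hi
      exact (hi.aestronglyMeasurable _ hgm).sub (h.aestronglyMeasurable _ hgm)
    · filter_upwards [hlim g hgc hgb] with t ht
      simpa using ht.sub_const (Φ g t)
  have h3 : (0 : ℝ≥0∞) < ε / 3 := ENNReal.div_pos hε.ne' ENNReal.ofNat_ne_top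
  filter_upwards [hΨ, ENNReal.tendsto_nhds_zero.1 h1 _ h3] with i hi hi'
  have h4 : (Ψ i f - Φ f : α → F) =ᵐ[μ] Ψ i (f - g) - Φ (f - g) + (Ψ i g - Φ g) := by
    filter_upwards [hi.sub hf hgm, h.sub hf hgm] with t h5 h6
    simp only [Pi.add_apply, Pi.sub_apply] at h5 h6 ⊢
    rw [h5, h6]
    abel
  rw [eLpNorm_congr_ae h4]
  have m1 := hi.aestronglyMeasurable _ hfg
  have m2 := h.aestronglyMeasurable _ hfg
  have m3 := (hi.aestronglyMeasurable _ hgm).sub (h.aestronglyMeasurable _ hgm)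
  calc _ ≤ eLpNorm (Ψ i (f - g) - Φ (f - g)) 2 μ + eLpNorm (Ψ i g - Φ g) 2 μ :=
        eLpNorm_add_le (m1.sub m2) m3 one_le_two
    _ ≤ (eLpNorm (Ψ i (f - g)) 2 μ + eLpNorm (Φ (f - g)) 2 μ) + eLpNorm (Ψ i g - Φ g) 2 μ := by
        gcongr
        exact eLpNorm_sub_le m1 m2 one_le_two
    _ ≤ (ε / 3 + ε / 3) + ε / 3 := by
        gcongr
        exacts [key hi, key h]
    _ = ε := ENNReal.add_thirds ε

end IsLpBounded

section Shift

variable {E F : Type*} [NormedAddCommGroup E] [NormedSpace ℝ E] [NormedAddCommGroup F]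
  [NormedSpace ℝ F]

theorem ae_comp_sub_of_ae_restrict {p : ℝ → Prop} {I : Set ℝ} (hI : MeasurableSet I)
    (h : ∀ᵐ t ∂volume.restrict I, p t) (σ : ℝ) : ∀ᵐ t : ℝ, t - σ ∈ I → p (t - σ) :=
  (measurePreserving_sub_right volume σ).quasiMeasurePreserving.ae ((ae_restrict_iff' hI).1 h)

theorem stronglyMeasurable_clm_apply {α : Type*} [MeasurableSpace α] {Λ : α → E →L[ℝ] F}
    (hΛ : ∀ x, StronglyMeasurable fun t => Λ t x) {f : α → E} (hf : StronglyMeasurable f) :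
    StronglyMeasurable fun t => Λ t (f t) := by
  have key : ∀ g : SimpleFunc α E, StronglyMeasurable fun t => Λ t (g t) := by
    intro g
    induction g using SimpleFunc.induction with
    | const c hs =>
      convert (hΛ c).indicator hs using 1
      ext t
      by_cases ht : t ∈ ‹Set α› <;> simp [ht]
    | add _ h1 h2 => simpa [Pi.add_def] using h1.add h2
  exact stronglyMeasurable_of_tendsto atTop (fun n => key (hf.approx n))
    (tendsto_pi_nhds.2 fun t => ((Λ t).continuous.tendsto _).comp (hf.tendsto_approx t))

theorem eLpNorm_le_of_norm_le_shift {I : Set ℝ} (hI : MeasurableSet I) {f : ℝ → E}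
    (hf : AEStronglyMeasurable f (volume.restrict I)) {φ : ℝ → F} {K σ : ℝ}
    (h : ∀ t ∈ I, ‖φ t‖ ≤ K * ‖I.indicator f (t - σ)‖) :
    eLpNorm φ 2 (volume.restrict I) ≤ ENNReal.ofReal K * eLpNorm f 2 (volume.restrict I) := by
  calc eLpNorm φ 2 (volume.restrict I)
      ≤ ENNReal.ofReal K * eLpNorm (I.indicator f ∘ fun t => t - σ) 2 (volume.restrict I) :=
        eLpNorm_le_mul_eLpNorm_of_ae_le_mul ((ae_restrict_iff' hI).2 (Eventually.of_forall h)) 2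
    _ ≤ ENNReal.ofReal K * eLpNorm (I.indicator f ∘ fun t => t - σ) 2 volume := by
        gcongr
        exact Measure.restrict_le_self
    _ = _ := by
        rw [eLpNorm_comp_measurePreserving ((aestronglyMeasurable_indicator_iff hI).2 hf)
          (measurePreserving_sub_right volume σ), eLpNorm_indicator_eq_eLpNorm_restrict hI]

theorem isLpBounded_shift {I : Set ℝ} (hI : MeasurableSet I) {Λ : ℝ → E →L[ℝ] F} {K σ : ℝ}
    (hm : ∀ x, StronglyMeasurable fun t => Λ t x)
    (h0 : ∀ t ∈ I, t - σ ∉ I → Λ t = 0)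
    (hK : ∀ t ∈ I, t - σ ∈ I → ∀ x, ‖Λ t x‖ ≤ K * ‖x‖) :
    IsLpBounded (volume.restrict I) K fun (f : ℝ → E) t => Λ t (f (t - σ)) := by
  have hcongr : ∀ f g : ℝ → E, f =ᵐ[volume.restrict I] g →
      (fun t => Λ t (f (t - σ))) =ᵐ[volume.restrict I] fun t => Λ t (g (t - σ)) := by
    intro f g h
    filter_upwards [ae_restrict_mem hI, ae_restrict_of_ae (ae_comp_sub_of_ae_restrict hI h σ)]
      with t ht h1
    by_cases h2 : t - σ ∈ I
    · rw [h1 h2]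
    · simp [h0 t ht h2]
  refine ⟨fun f g _ _ => .of_forall fun t => ?_, fun c f _ => .of_forall fun t => ?_, hcongr,
    fun f hf => ?_, fun f hf => ?_⟩
  · simp
  · simp
  · refine AEStronglyMeasurable.congr ?_ (hcongr _ _ hf.1.ae_eq_mk).symm
    exact (stronglyMeasurable_clm_apply hm
      (hf.1.stronglyMeasurable_mk.comp_measurable
        (measurable_id.sub_const σ))).aestronglyMeasurable
  · refine eLpNorm_le_of_norm_le_shift (σ := σ) hI hf.1 fun t ht => ?_
    by_cases h2 : t - σ ∈ I
    · simpa [h2] using hK t ht h2 _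
    · simp [h2, h0 t ht h2]

theorem IsLpBounded.mono {α : Type*} [MeasurableSpace α] {μ : Measure α} {K K' : ℝ}
    {Φ : (α → E) → α → F} (h : IsLpBounded μ K Φ) (hK : K ≤ K') : IsLpBounded μ K' Φ :=
  { h with
    eLpNorm_le := fun f hf => (h.eLpNorm_le f hf).trans (by gcongr) }

theorem isLpBounded_id {α : Type*} [MeasurableSpace α] (μ : Measure α) :
    IsLpBounded μ 1 fun f : α → E => f :=
  ⟨fun _ _ _ _ => .rfl, fun _ _ _ => .rfl, fun _ _ h => h, fun _ h => h.1, fun _ _ => by simp⟩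

end Shift

section Average

variable {E : Type*} [NormedAddCommGroup E] [NormedSpace ℝ E]

/-- The mean over `(t - σ, t)` of the extension of `g` by zero. -/
noncomputable def slidingAverage (I : Set ℝ) (σ : ℝ) (g : ℝ → E) (t : ℝ) : E :=
  σ⁻¹ • ∫ τ in t - σ..t, I.indicator g τ

theorem intervalIntegrable_indicator {I : Set ℝ} (hI : MeasurableSet I)
    [IsFiniteMeasure (volume.restrict I)] {g : ℝ → E} (hg : MemLp g 2 (volume.restrict I))
    (x y : ℝ) : IntervalIntegrable (I.indicator g) volume x y :=
  ((integrable_indicator_iff hI).2 (hg.integrable one_le_two)).intervalIntegrable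

theorem enorm_slidingAverage_rpow_le {I : Set ℝ} (hI : MeasurableSet I) {g : ℝ → E}
    (hg : StronglyMeasurable g) {σ : ℝ} (hσ : 0 < σ) (t : ℝ) :
    ‖slidingAverage I σ g t‖ₑ ^ (2 : ℝ) ≤
      ENNReal.ofReal σ⁻¹ * ∫⁻ u in Ioc 0 σ, ‖I.indicator g (t - u)‖ₑ ^ (2 : ℝ) := by
  have hm : AEStronglyMeasurable (fun u => I.indicator g (t - u)) (volume.restrict (Ioc 0 σ)) :=
    ((hg.indicator hI).comp_measurable (measurable_const.sub measurable_id)).aestronglyMeasurable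
  have h1 : ‖∫ τ in t - σ..t, I.indicator g τ‖ₑ ≤
      (∫⁻ u in Ioc 0 σ, ‖I.indicator g (t - u)‖ₑ ^ (2 : ℝ)) ^ (1 / 2 : ℝ) *
        ENNReal.ofReal σ ^ (1 / 2 : ℝ) := by
    have h2 := intervalIntegral.integral_comp_sub_left (a := 0) (b := σ) (I.indicator g) t
    rw [sub_zero] at h2
    rw [← h2, intervalIntegral.integral_of_le hσ.le]
    refine (enorm_integral_le_lintegral_enorm _).trans ?_
    rw [← eLpNorm_one_eq_lintegral_enorm]
    refine (eLpNorm_le_eLpNorm_mul_rpow_measure_univ one_le_two hm).trans_eq ?_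
    rw [eLpNorm_eq_lintegral_rpow_enorm_toReal two_ne_zero ENNReal.ofNat_ne_top]
    simp only [ENNReal.toReal_ofNat, ENNReal.toReal_one, Measure.restrict_apply_univ,
      Real.volume_Ioc, sub_zero]
    norm_num
  have hσ' : ENNReal.ofReal σ⁻¹ * ENNReal.ofReal σ = 1 := by
    rw [← ENNReal.ofReal_mul (by positivity), inv_mul_cancel₀ hσ.ne', ENNReal.ofReal_one]
  calc ‖slidingAverage I σ g t‖ₑ ^ (2 : ℝ)
      = ENNReal.ofReal σ⁻¹ ^ (2 : ℝ) * ‖∫ τ in t - σ..t, I.indicator g τ‖ₑ ^ (2 : ℝ) := by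
        rw [slidingAverage, enorm_smul, ENNReal.mul_rpow_of_nonneg _ _ two_pos.le,
          Real.enorm_of_nonneg (by positivity)]
    _ ≤ ENNReal.ofReal σ⁻¹ ^ (2 : ℝ) *
        ((∫⁻ u in Ioc 0 σ, ‖I.indicator g (t - u)‖ₑ ^ (2 : ℝ)) ^ (1 / 2 : ℝ) *
        ENNReal.ofReal σ ^ (1 / 2 : ℝ)) ^ (2 : ℝ) := by gcongr
    _ = (ENNReal.ofReal σ⁻¹ * ENNReal.ofReal σ) * (ENNReal.ofReal σ⁻¹ *
        ∫⁻ u in Ioc 0 σ, ‖I.indicator g (t - u)‖ₑ ^ (2 : ℝ)) := by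
        rw [ENNReal.mul_rpow_of_nonneg _ _ two_pos.le, ← ENNReal.rpow_mul, ← ENNReal.rpow_mul]
        norm_num
        ring
    _ = _ := by rw [hσ', one_mul]

theorem isLpBounded_slidingAverage {I : Set ℝ} (hI : MeasurableSet I)
    [IsFiniteMeasure (volume.restrict I)] {σ : ℝ} (hσ : 0 < σ) :
    IsLpBounded (volume.restrict I) 1 (slidingAverage (E := E) I σ) := by
  have hcongr : ∀ f g : ℝ → E, f =ᵐ[volume.restrict I] g →
      slidingAverage I σ f = slidingAverage I σ g := by
    intro f g h
    have h1 := (ae_restrict_iff' hI).1 h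
    ext t
    simp only [slidingAverage]
    congr 1
    refine intervalIntegral.integral_congr_ae ?_
    filter_upwards [h1] with x hx _
    by_cases hxI : x ∈ I
    · simp [hxI, hx hxI]
    · simp [hxI]
  refine ⟨fun f g hf hg => .of_forall fun t => ?_, fun c f _ => .of_forall fun t => ?_,
    fun f g h => by rw [hcongr f g h], fun f hf => ?_, fun f hf => ?_⟩
  · simp only [slidingAverage, Pi.add_apply]
    rw [← smul_add, ← intervalIntegral.integral_add (intervalIntegrable_indicator hI hf _ _)
      (intervalIntegrable_indicator hI hg _ _)]
    simp [indicator_add']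
  · simp only [slidingAverage, Pi.smul_apply]
    have h1 : I.indicator (c • f) = fun τ => c • I.indicator f τ := by
      funext τ
      by_cases hτ : τ ∈ I <;> simp [hτ]
    rw [h1, intervalIntegral.integral_smul, smul_comm]
  · have h_int := intervalIntegrable_indicator hI hf
    have hc := intervalIntegral.continuous_primitive h_int 0
    have h1 : slidingAverage I σ f = fun t =>
        σ⁻¹ • ((∫ τ in (0 : ℝ)..t, I.indicator f τ) - ∫ τ in (0 : ℝ)..t - σ, I.indicator f τ) := by
      ext t
      rw [slidingAverage, intervalIntegral.integral_interval_sub_left (h_int _ _) (h_int _ _)]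
    rw [h1]
    exact ((hc.sub (hc.comp (continuous_sub_right σ))).const_smul _).aestronglyMeasurable
  · set g := hf.1.mk f with hg
    have hfg : f =ᵐ[volume.restrict I] g := hf.1.ae_eq_mk
    have hgm : StronglyMeasurable g := hf.1.stronglyMeasurable_mk
    rw [hcongr f g hfg, eLpNorm_congr_ae hfg, ENNReal.ofReal_one, one_mul,
      ← eLpNorm_indicator_eq_eLpNorm_restrict hI (f := g)]
    rw [eLpNorm_eq_lintegral_rpow_enorm_toReal two_ne_zero ENNReal.ofNat_ne_top,
      eLpNorm_eq_lintegral_rpow_enorm_toReal two_ne_zero ENNReal.ofNat_ne_top,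
      ENNReal.toReal_ofNat]
    refine ENNReal.rpow_le_rpow ?_ (by norm_num)
    calc ∫⁻ t in I, ‖slidingAverage I σ g t‖ₑ ^ (2 : ℝ)
        ≤ ∫⁻ t, ‖slidingAverage I σ g t‖ₑ ^ (2 : ℝ) := setLIntegral_le_lintegral _ _
      _ ≤ ∫⁻ t, ENNReal.ofReal σ⁻¹ * ∫⁻ u in Ioc 0 σ, ‖I.indicator g (t - u)‖ₑ ^ (2 : ℝ) :=
          lintegral_mono fun t => enorm_slidingAverage_rpow_le hI hgm hσ t
      _ = ENNReal.ofReal σ⁻¹ * ∫⁻ t, ∫⁻ u in Ioc 0 σ, ‖I.indicator g (t - u)‖ₑ ^ (2 : ℝ) :=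
          lintegral_const_mul' _ _ ENNReal.ofReal_ne_top
      _ = ENNReal.ofReal σ⁻¹ * ∫⁻ u in Ioc 0 σ, ∫⁻ t, ‖I.indicator g (t - u)‖ₑ ^ (2 : ℝ) := by
          rw [lintegral_lintegral_swap]
          exact (((hgm.indicator hI).comp_measurable
            (measurable_fst.sub measurable_snd)).enorm.pow_const _).aemeasurable
      _ = ENNReal.ofReal σ⁻¹ * ∫⁻ u in Ioc 0 σ, ∫⁻ t, ‖I.indicator g t‖ₑ ^ (2 : ℝ) := by
          congr 1
          refine lintegral_congr fun u => ?_
          exact lintegral_sub_right_eq_self (fun t => ‖I.indicator g t‖ₑ ^ (2 : ℝ)) u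
      _ = _ := by
          rw [lintegral_const, Measure.restrict_apply_univ, Real.volume_Ioc, sub_zero, mul_comm,
            mul_assoc, ← ENNReal.ofReal_mul hσ.le, mul_inv_cancel₀ hσ.ne', ENNReal.ofReal_one,
            mul_one]

variable [CompleteSpace E]

theorem norm_slidingAverage_sub_le {I : Set ℝ} {g : ℝ → E} (hg : Continuous g) {σ t ε : ℝ}
    (hσ : 0 < σ) (hI : Ioc (t - σ) t ⊆ I) (x : E) (hε : ∀ τ ∈ Ioc (t - σ) t, ‖g τ - x‖ ≤ ε) :
    ‖slidingAverage I σ g t - x‖ ≤ ε := by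
  have h1 : ∫ τ in t - σ..t, I.indicator g τ = ∫ τ in t - σ..t, g τ := by
    refine intervalIntegral.integral_congr_ae (.of_forall fun τ hτ => ?_)
    rw [uIoc_of_le (by linarith)] at hτ
    rw [indicator_of_mem (hI hτ)]
  have h2 : slidingAverage I σ g t - x = σ⁻¹ • ∫ τ in t - σ..t, (g τ - x) := by
    rw [slidingAverage, h1, intervalIntegral.integral_sub (hg.intervalIntegrable _ _)
      (continuous_const.intervalIntegrable _ _), smul_sub, intervalIntegral.integral_const,
      smul_smul, sub_sub_cancel, inv_mul_cancel₀ hσ.ne', one_smul]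
  have h3 := intervalIntegral.norm_integral_le_of_norm_le_const (a := t - σ) (b := t)
    (f := fun τ => g τ - x) (C := ε) (by rwa [uIoc_of_le (by linarith)])
  rw [sub_sub_cancel, abs_of_pos hσ] at h3
  rw [h2, norm_smul, norm_inv, Real.norm_of_nonneg hσ.le, inv_mul_le_iff₀ hσ, mul_comm]
  exact h3

theorem norm_slidingAverage_le {I : Set ℝ} {g : ℝ → E} {σ t B : ℝ}
    (hσ : 0 < σ) (hB : ∀ τ, ‖g τ‖ ≤ B) : ‖slidingAverage I σ g t‖ ≤ B := by
  have h3 := intervalIntegral.norm_integral_le_of_norm_le_const (a := t - σ) (b := t)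
    (f := I.indicator g) (C := B) fun τ _ => (norm_indicator_le_norm_self g τ).trans (hB τ)
  rw [sub_sub_cancel, abs_of_pos hσ] at h3
  rw [slidingAverage, norm_smul, norm_inv, Real.norm_of_nonneg hσ.le, inv_mul_le_iff₀ hσ, mul_comm]
  exact h3

theorem tendsto_eLpNorm_slidingAverage_sub [SecondCountableTopology E] {a b : ℝ} {g : ℝ → E}
    (hg : MemLp g 2 (volume.restrict (Ioc a b))) :
    Tendsto (fun σ => eLpNorm (slidingAverage (Ioc a b) σ g - g) 2 (volume.restrict (Ioc a b)))
      (𝓝[>] 0) (𝓝 0) := by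
  refine IsLpBounded.tendsto_eLpNorm_sub (K := 1) (Φ := fun f : ℝ → E => f) ?_
    (isLpBounded_id _) ?_ ?_ hg
  · filter_upwards [self_mem_nhdsWithin] with σ hσ
    exact isLpBounded_slidingAverage measurableSet_Ioc hσ
  · rintro k hk ⟨B, hB⟩
    refine ⟨B + B, ?_⟩
    filter_upwards [self_mem_nhdsWithin] with σ hσ
    exact .of_forall fun t => (norm_sub_le _ _).trans
      (add_le_add (norm_slidingAverage_le hσ hB) (hB t))
  · intro k hk _
    filter_upwards [ae_restrict_mem measurableSet_Ioc] with t ht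
    refine Metric.tendsto_nhds.2 fun ε hε => ?_
    obtain ⟨δ, hδ, h⟩ := Metric.continuous_iff.1 hk t (ε / 2) (half_pos hε)
    filter_upwards [self_mem_nhdsWithin,
      nhdsWithin_le_nhds (Iio_mem_nhds (lt_min hδ (sub_pos.2 ht.1)))] with σ hσ hσ'
    have h1 := lt_min_iff.1 (mem_Iio.1 hσ')
    rw [dist_eq_norm]
    refine (norm_slidingAverage_sub_le hk hσ ?_ _ fun τ hτ => ?_).trans_lt (half_lt_self hε)
    · exact fun τ hτ => ⟨by linarith [hτ.1], hτ.2.trans ht.2⟩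
    · rw [← dist_eq_norm]
      refine (h τ ?_).le
      rw [Real.dist_eq, abs_lt]
      constructor <;> linarith [hτ.1, hτ.2]

/-- A primitive that vanishes at the left endpoint recovers its increments as averages of the
derivative. -/
theorem smul_sub_eq_slidingAverage {a b : ℝ} {f g : ℝ → E} (hf : Continuous f)
    (h0 : ∀ t ∉ Ioc a b, f t = 0)
    (h : ∀ s ∈ Ioc a b, ∀ t ∈ Ioc a b, f t - f s = ∫ τ in s..t, g τ)
    (hg : MemLp g 2 (volume.restrict (Ioc a b))) {σ t : ℝ} (hσ : 0 < σ) (ht : t ∈ Ioc a b) :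
    σ⁻¹ • (f t - f (t - σ)) = slidingAverage (Ioc a b) σ g t := by
  set p : ℝ → E := fun t => ∫ τ in a..t, (Ioc a b).indicator g τ with hp
  have h_int := intervalIntegrable_indicator measurableSet_Ioc hg
  have hpc : Continuous p := intervalIntegral.continuous_primitive h_int a
  have hsub : ∀ s t, p t - p s = ∫ τ in s..t, (Ioc a b).indicator g τ := fun s t =>
    intervalIntegral.integral_interval_sub_left (h_int _ _) (h_int _ _)
  have hfp : ∀ t ∈ Ioc a b, f t = p t := by
    intro t ht
    have h1 : ∀ᶠ s in 𝓝[>] a, f t - f s = p t - p s := by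
      filter_upwards [Ioc_mem_nhdsGT ht.1] with s hs
      have hs' : s ∈ Ioc a b := ⟨hs.1, hs.2.trans ht.2⟩
      rw [h s hs' t ht, hsub]
      refine intervalIntegral.integral_congr_ae (.of_forall fun τ hτ => ?_)
      rw [uIoc_of_le hs.2] at hτ
      rw [indicator_of_mem (show τ ∈ Ioc a b from ⟨hs.1.trans hτ.1, hτ.2.trans ht.2⟩)]
    have h2 : Tendsto (fun s => f t - f s) (𝓝[>] a) (𝓝 (f t - f a)) :=
      ((hf.tendsto a).mono_left nhdsWithin_le_nhds).const_sub _
    have h3 : Tendsto (fun s => p t - p s) (𝓝[>] a) (𝓝 (p t - p a)) :=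
      ((hpc.tendsto a).mono_left nhdsWithin_le_nhds).const_sub _
    have h4 := tendsto_nhds_unique (h2.congr' h1) h3
    rwa [h0 a (fun h => lt_irrefl _ h.1), show p a = 0 by simp [hp], sub_zero, sub_zero] at h4
  have hfp' : f (t - σ) = p (t - σ) := by
    rcases lt_or_ge a (t - σ) with h1 | h1
    · exact hfp _ ⟨h1, by linarith [ht.2]⟩
    · rw [h0 _ fun h2 => h1.not_gt h2.1, eq_comm]
      refine (intervalIntegral.integral_congr_ae (g := fun _ => 0)
        (.of_forall fun τ hτ => ?_)).trans intervalIntegral.integral_zero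
      rw [uIoc_of_ge h1] at hτ
      exact indicator_of_notMem (fun h2 => hτ.2.not_gt h2.1) _
  rw [slidingAverage, ← hsub, hfp t ht, hfp']

end Average

/-- Translation by `σ` along the family `U`. -/
def evolShift {X : Type*} [NormedAddCommGroup X] [NormedSpace ℝ X] (U : ℝ → ℝ → X →L[ℝ] X)
    (σ : ℝ) (f : ℝ → X) (t : ℝ) : X :=
  U t (t - σ) (f (t - σ))

namespace KatoSetting

variable {X Y Y' : Type*} [NormedAddCommGroup X] [NormedSpace ℝ X]
    [NormedAddCommGroup Y] [NormedSpace ℝ Y] [NormedAddCommGroup Y'] [NormedSpace ℝ Y']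
    {S : KatoSetting X Y Y'}

variable (S) in
/-- The Lebesgue measure on the time interval. -/
noncomputable abbrev vol : Measure ℝ := volume.restrict (Ioc S.a S.b)

variable {U : ℝ → ℝ → X →L[ℝ] X} {k : ℕ}

theorem Bounds.eq_zero_of_sub_notMem (h : S.Bounds k U) {σ t : ℝ} (ht : t ∈ Ioc S.a S.b)
    (hσ : t - σ ∉ Ioc S.a S.b) : U t (t - σ) = 0 :=
  h.zero_off _ _ fun h1 => hσ ⟨h1.1, h1.2.1.trans ht.2⟩

theorem Bounds.isLpBounded_evolShift [CompleteSpace X] [TopologicalSpace.SeparableSpace X]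
    (h : S.Bounds k U) (σ : ℝ) : IsLpBounded S.vol S.C (evolShift U σ) :=
  isLpBounded_shift (Λ := fun t => U t (t - σ)) measurableSet_Ioc
    (fun x => (h.stronglyMeasurable x).comp_measurable
      (measurable_id.prodMk (measurable_id.sub_const σ)))
    (fun _ ht hσ => h.eq_zero_of_sub_notMem ht hσ) fun t _ _ x => h.norm_apply_le _ _ x

theorem Bounds.tendsto_evolShift (h : S.Bounds k U) {g : ℝ → X} (hg : Continuous g) {t : ℝ}
    (ht : t ∈ Ioc S.a S.b) : Tendsto (fun σ => evolShift U σ g t) (𝓝[≥] 0) (𝓝 (g t)) := by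
  have hC := S.C_nonneg
  refine Metric.tendsto_nhds.2 fun ε hε => ?_
  obtain ⟨δ₁, hδ₁, h1⟩ := h.norm_sub_self_uniform (g t) (half_pos hε)
  obtain ⟨δ₂, hδ₂, h2⟩ := Metric.continuous_iff.1 hg t (ε / 2 / (S.C + 1)) (by positivity)
  filter_upwards [self_mem_nhdsWithin, nhdsWithin_le_nhds
    (Iio_mem_nhds (lt_min hδ₁ (lt_min hδ₂ (sub_pos.2 ht.1))))] with σ hσ hσ'
  rw [mem_Iio, lt_min_iff, lt_min_iff] at hσ'
  rw [mem_Ici] at hσ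
  have h3 := h1 t (t - σ) (by linarith) (by linarith) ht.2 (by linarith)
  have h4 := h2 (t - σ) (by rw [Real.dist_eq, abs_lt]; constructor <;> linarith)
  rw [dist_eq_norm, lt_div_iff₀ (by positivity)] at h4
  have h5 : evolShift U σ g t - g t =
      U t (t - σ) (g (t - σ) - g t) + (U t (t - σ) (g t) - g t) := by
    rw [map_sub, evolShift]
    abel
  rw [dist_eq_norm, h5]
  have h6 := h.norm_apply_le t (t - σ) (g (t - σ) - g t)
  nlinarith [norm_add_le (U t (t - σ) (g (t - σ) - g t)) (U t (t - σ) (g t) - g t),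
    norm_nonneg (g (t - σ) - g t)]

theorem Bounds.tendsto_eLpNorm_evolShift_sub [CompleteSpace X]
    [TopologicalSpace.SeparableSpace X] (h : S.Bounds k U) {f : ℝ → X} (hf : MemLp f 2 S.vol) :
    Tendsto (fun σ => eLpNorm (evolShift U σ f - f) 2 S.vol) (𝓝[≥] 0) (𝓝 0) := by
  refine IsLpBounded.tendsto_eLpNorm_sub (K := max S.C 1) (Φ := fun f : ℝ → X => f)
    (.of_forall fun σ => (h.isLpBounded_evolShift σ).mono (le_max_left _ _))
    ((isLpBounded_id _).mono (le_max_right _ _)) ?_ ?_ hf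
  · rintro g - ⟨B, hB⟩
    refine ⟨S.C * B + B, .of_forall fun σ => .of_forall fun t => (norm_sub_le _ _).trans ?_⟩
    exact add_le_add ((h.norm_apply_le _ _ _).trans
      (mul_le_mul_of_nonneg_left (hB _) S.C_nonneg)) (hB t)
  · intro g hg _
    filter_upwards [ae_restrict_mem measurableSet_Ioc] with t ht
    exact h.tendsto_evolShift hg ht

section Generator

theorem tendsto_yosida {t : ℝ} (ht : t ∈ Ioc S.a S.b) {y : X} (hy : y ∈ S.Dom t) :
    Tendsto (fun n : ℝ => yosida S.Res n t y) atTop (𝓝 (S.A t y)) := by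
  refine (S.stable.tendsto_smul_res ht (S.A t y)).congr' ?_
  filter_upwards [eventually_gt_atTop S.ω] with n hn
  exact (S.stable.yosida_apply_eq ht hn hy).symm

variable (S) in
/-- The operators `A t` on `Y`, extended by zero outside the time interval. -/
noncomputable def AY (t : ℝ) : Y →L[ℝ] X :=
  if ht : t ∈ Ioc S.a S.b then
    LinearMap.mkContinuous
      { toFun := fun y => S.A t (S.JY y)
        map_add' := fun y z => by
          refine tendsto_nhds_unique (tendsto_yosida ht (S.JY_mem t ht _)) ?_
          simp only [map_add]
          exact (tendsto_yosida ht (S.JY_mem t ht _)).add (tendsto_yosida ht (S.JY_mem t ht _))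
        map_smul' := fun c y => by
          refine tendsto_nhds_unique (tendsto_yosida ht (S.JY_mem t ht _)) ?_
          simp only [map_smul]
          exact (tendsto_yosida ht (S.JY_mem t ht _)).const_smul c }
      S.CY (S.norm_A_le t ht)
  else 0

theorem AY_apply {t : ℝ} (ht : t ∈ Ioc S.a S.b) (y : Y) : S.AY t y = S.A t (S.JY y) := by
  rw [AY, dif_pos ht]
  rfl

theorem stronglyMeasurable_AY [TopologicalSpace.SeparableSpace X] (y : Y) :
    StronglyMeasurable fun t => S.AY t y := by
  borelize X
  have : SecondCountableTopology X := UniformSpace.secondCountable_of_separable X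
  have h1 : (fun t => S.AY t y) = (Ioc S.a S.b).piecewise (fun t => S.A t (S.JY y)) 0 := by
    ext t
    by_cases ht : t ∈ Ioc S.a S.b
    · rw [piecewise_eq_of_mem _ _ _ ht, AY_apply ht]
    · rw [piecewise_eq_of_notMem _ _ _ ht, AY, dif_neg ht]
      rfl
  rw [h1]
  exact ((S.continuousOn_A y).measurable_piecewise continuousOn_const
    measurableSet_Ioc).stronglyMeasurable

variable (S) in
theorem isLpBounded_AY [TopologicalSpace.SeparableSpace X] :
    IsLpBounded S.vol S.CY fun (f : ℝ → Y) t => S.AY t (f t) := by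
  have h1 := isLpBounded_shift (Λ := S.AY) (σ := 0) (K := S.CY) (I := Ioc S.a S.b)
    measurableSet_Ioc (fun y => stronglyMeasurable_AY y)
    (fun t ht ht' => absurd ht (by rwa [sub_zero] at ht'))
    fun t ht _ y => by rw [AY_apply ht]; exact S.norm_A_le t ht y
  simpa only [sub_zero] using h1

variable (S U) in
/-- The difference quotients of the translation along `U`, as operators on `Y`. -/
noncomputable def shiftSlope (σ t : ℝ) : Y →L[ℝ] X :=
  if t - σ ∈ Ioc S.a S.b then σ⁻¹ • ((U t (t - σ)).comp S.JY - S.JY) else 0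

theorem Bounds.norm_shiftSlope_le (h : S.Bounds k U) {σ t : ℝ} (hσ : 0 < σ)
    (ht : t ∈ Ioc S.a S.b) (y : Y) : ‖S.shiftSlope U σ t y‖ ≤ S.C * (S.c * S.CY) * ‖y‖ := by
  have hC := S.C_nonneg
  have hc := S.c_pos
  have hCY := S.CY_nonneg
  by_cases h1 : t - σ ∈ Ioc S.a S.b
  · have h2 := h.norm_sub_left_le (t - σ) t t h1.1 (by linarith) le_rfl ht.2 y
    rw [h.refl t ht, norm_sub_rev, ContinuousLinearMap.one_apply, sub_sub_cancel] at h2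
    rw [shiftSlope, if_pos h1, ContinuousLinearMap.smul_apply, norm_smul, norm_inv,
      Real.norm_of_nonneg hσ.le, inv_mul_le_iff₀ hσ]
    refine h2.trans_eq ?_
    ring
  · rw [shiftSlope, if_neg h1, ContinuousLinearMap.zero_apply, norm_zero]
    positivity

theorem Bounds.isLpBounded_shiftSlope [CompleteSpace X] [TopologicalSpace.SeparableSpace X]
    (h : S.Bounds k U) {σ : ℝ} (hσ : 0 < σ) :
    IsLpBounded S.vol (S.C * (S.c * S.CY))
      fun (f : ℝ → Y) t => S.shiftSlope U σ t (f (t - σ)) := by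
  refine isLpBounded_shift (Λ := S.shiftSlope U σ) measurableSet_Ioc (fun y => ?_)
    (fun t _ hσ => by rw [shiftSlope, if_neg hσ])
    fun t ht _ y => h.norm_shiftSlope_le hσ ht y
  have h1 : (fun t => S.shiftSlope U σ t y) =
      ((fun t : ℝ => t - σ) ⁻¹' Ioc S.a S.b).indicator
        fun t => σ⁻¹ • (U t (t - σ) (S.JY y) - S.JY y) := by
    ext t
    by_cases ht : t - σ ∈ Ioc S.a S.b
    · rw [indicator_of_mem (show t ∈ (fun t : ℝ => t - σ) ⁻¹' Ioc S.a S.b from ht), shiftSlope,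
        if_pos ht]
      rfl
    · rw [indicator_of_notMem (show t ∉ (fun t : ℝ => t - σ) ⁻¹' Ioc S.a S.b from ht), shiftSlope,
        if_neg ht]
      rfl
  rw [h1]
  refine StronglyMeasurable.indicator ?_ (measurableSet_Ioc.preimage (measurable_id.sub_const σ))
  exact ((((h.stronglyMeasurable (S.JY y)).comp_measurable
    (measurable_id.prodMk (measurable_id.sub_const σ)))).sub
      stronglyMeasurable_const).const_smul σ⁻¹

variable {N : Set ℝ}

theorem AlmostPropagator.tendsto_shiftSlope (h : S.AlmostPropagator U N) {t : ℝ}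
    (ht : t ∈ Ioc S.a S.b) (y : Y) :
    Tendsto (fun σ => S.shiftSlope U σ t y) (𝓝[>] 0) (𝓝 (S.AY t y)) := by
  have h1 := h.hasDerivWithinAt_left y ht.1 le_rfl ht.2
  rw [hasDerivWithinAt_iff_tendsto_slope, (h.bounds 0).refl t ht] at h1
  have h2 : Tendsto (fun σ : ℝ => t - σ) (𝓝[>] 0) (𝓝[(Ioc S.a S.b ∩ Iic t) \ {t}] t) := by
    refine tendsto_nhdsWithin_iff.2 ⟨?_, ?_⟩
    · have : Tendsto (fun σ : ℝ => t - σ) (𝓝 0) (𝓝 (t - 0)) := tendsto_id.const_sub t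
      rw [sub_zero] at this
      exact this.mono_left nhdsWithin_le_nhds
    · filter_upwards [self_mem_nhdsWithin, nhdsWithin_le_nhds
        (Iio_mem_nhds (sub_pos.2 ht.1))] with σ hσ hσ'
      rw [mem_Ioi] at hσ
      rw [mem_Iio] at hσ'
      exact ⟨⟨⟨by linarith, by linarith [ht.2]⟩, show t - σ ≤ t by linarith⟩,
        fun h3 => hσ.ne' (by linarith [show t - σ = t from h3])⟩
  have h3 := (h1.comp h2).neg
  rw [neg_neg] at h3
  rw [AY_apply ht]
  refine h3.congr' ?_
  filter_upwards [self_mem_nhdsWithin, nhdsWithin_le_nhds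
    (Iio_mem_nhds (sub_pos.2 ht.1))] with σ hσ hσ'
  rw [mem_Ioi] at hσ
  rw [mem_Iio] at hσ'
  have h4 : t - σ ∈ Ioc S.a S.b := ⟨by linarith, by linarith [ht.2]⟩
  rw [shiftSlope, if_pos h4, Function.comp_apply, slope_def_module, (h.bounds 0).refl t ht,
    sub_sub_cancel_left, inv_neg, neg_smul, neg_neg]
  rfl

theorem AlmostPropagator.tendsto_eLpNorm_shiftSlope_sub [CompleteSpace X]
    [TopologicalSpace.SeparableSpace X] (h : S.AlmostPropagator U N) {f : ℝ → Y}
    (hf : MemLp f 2 S.vol) :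
    Tendsto (fun σ => eLpNorm ((fun t => S.shiftSlope U σ t (f (t - σ))) - fun t => S.AY t (f t))
      2 S.vol) (𝓝[>] 0) (𝓝 0) := by
  have hb := h.bounds 0
  set L := S.C * (S.c * S.CY) with hL
  have hL0 : 0 ≤ L := by
    have hC := S.C_nonneg
    have hc := S.c_pos
    have hCY := S.CY_nonneg
    positivity
  refine IsLpBounded.tendsto_eLpNorm_sub (K := max L S.CY)
    (Ψ := fun σ (f : ℝ → Y) t => S.shiftSlope U σ t (f (t - σ)))
    (Φ := fun (f : ℝ → Y) t => S.AY t (f t)) ?_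
    (S.isLpBounded_AY.mono (le_max_right _ _)) ?_ ?_ hf
  · filter_upwards [self_mem_nhdsWithin] with σ hσ
    exact (hb.isLpBounded_shiftSlope hσ).mono (le_max_left _ _)
  · rintro g - ⟨B, hB⟩
    refine ⟨L * B + S.CY * B, ?_⟩
    filter_upwards [self_mem_nhdsWithin] with σ hσ
    filter_upwards [ae_restrict_mem measurableSet_Ioc] with t ht
    refine (norm_sub_le _ _).trans (add_le_add ?_ ?_)
    · exact (hb.norm_shiftSlope_le hσ ht _).trans (mul_le_mul_of_nonneg_left (hB _) hL0)
    · rw [AY_apply ht]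
      exact (S.norm_A_le t ht _).trans (mul_le_mul_of_nonneg_left (hB _) S.CY_nonneg)
  · intro g hg _
    filter_upwards [ae_restrict_mem measurableSet_Ioc] with t ht
    have h1 : Tendsto (fun σ => S.shiftSlope U σ t (g (t - σ) - g t)) (𝓝[>] 0) (𝓝 0) := by
      have h2 : Tendsto (fun σ : ℝ => L * ‖g (t - σ) - g t‖) (𝓝[>] 0) (𝓝 0) := by
        have h3 : Continuous fun σ : ℝ => L * ‖g (t - σ) - g t‖ := by fun_prop
        have h4 := (h3.tendsto 0).mono_left (nhdsWithin_le_nhds (s := Ioi 0))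
        simpa using h4
      refine squeeze_zero_norm' ?_ h2
      filter_upwards [self_mem_nhdsWithin] with σ hσ
      exact hb.norm_shiftSlope_le hσ ht _
    simpa using h1.add (h.tendsto_shiftSlope ht (g t))

end Generator

end KatoSetting

namespace KatoSetting

variable {X Y Y' : Type*} [NormedAddCommGroup X] [NormedSpace ℝ X]
    [NormedAddCommGroup Y] [NormedSpace ℝ Y] [NormedAddCommGroup Y'] [NormedSpace ℝ Y']
    {S : KatoSetting X Y Y'} [CompleteSpace X] [TopologicalSpace.SeparableSpace X]
    {U : ℝ → ℝ → X →L[ℝ] X} {N : Set ℝ}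

namespace AlmostPropagator

/-- The evolution semigroup of an almost-propagator on `L²`. -/
noncomputable def semigroup (h : S.AlmostPropagator U N) (σ : ℝ) :
    Lp X 2 S.vol →L[ℝ] Lp X 2 S.vol :=
  ((h.bounds 0).isLpBounded_evolShift σ).toCLM

theorem coeFn_semigroup (h : S.AlmostPropagator U N) (σ : ℝ) (f : Lp X 2 S.vol) :
    ⇑(h.semigroup σ f) =ᵐ[S.vol] evolShift U σ f :=
  IsLpBounded.coeFn_toCLM _ f

theorem norm_semigroup_apply_le (h : S.AlmostPropagator U N) (σ : ℝ) (f : Lp X 2 S.vol) :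
    ‖h.semigroup σ f‖ ≤ S.C * ‖f‖ := by
  have h1 := ((h.bounds 0).isLpBounded_evolShift σ).norm_toCLM_le
  rw [max_eq_left S.C_nonneg] at h1
  exact ContinuousLinearMap.le_of_opNorm_le _ h1 f

theorem coeFn_semigroup_eq_ite (h : S.AlmostPropagator U N) (σ : ℝ) (f : Lp X 2 S.vol) :
    ⇑(h.semigroup σ f) =ᵐ[S.vol]
      fun t => if t - σ ∈ Ioc S.a S.b then U t (t - σ) (f (t - σ)) else 0 := by
  filter_upwards [h.coeFn_semigroup σ f, ae_restrict_mem measurableSet_Ioc] with t h1 ht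
  rw [h1, evolShift]
  split_ifs with h2
  · rfl
  · rw [(h.bounds 0).eq_zero_of_sub_notMem ht h2, ContinuousLinearMap.zero_apply]

theorem semigroup_zero (h : S.AlmostPropagator U N) : h.semigroup 0 = 1 := by
  ext1 f
  refine Lp.ext ?_
  filter_upwards [h.coeFn_semigroup 0 f, ae_restrict_mem measurableSet_Ioc] with t h1 ht
  rw [h1, evolShift, sub_zero, (h.bounds 0).refl t ht]
  rfl

theorem semigroup_add (h : S.AlmostPropagator U N) {σ τ : ℝ} (hσ : 0 ≤ σ) (hτ : 0 ≤ τ) :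
    h.semigroup (σ + τ) = (h.semigroup σ).comp (h.semigroup τ) := by
  have hb := h.bounds 0
  have hN : ∀ᵐ t : ℝ, t - σ ∉ N :=
    (measurePreserving_sub_right volume σ).quasiMeasurePreserving.ae
      (measure_eq_zero_iff_ae_notMem.1 h.null)
  ext1 f
  refine Lp.ext ?_
  filter_upwards [h.coeFn_semigroup (σ + τ) f, h.coeFn_semigroup σ (h.semigroup τ f),
    ae_restrict_of_ae hN, ae_restrict_mem measurableSet_Ioc, ae_restrict_of_ae
      (ae_comp_sub_of_ae_restrict measurableSet_Ioc (h.coeFn_semigroup τ f) σ)] with t h1 h2 h3 ht h4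
  rw [h1, ContinuousLinearMap.comp_apply, h2]
  unfold evolShift at h4 ⊢
  by_cases h5 : t - σ ∈ Ioc S.a S.b
  · rw [h4 h5, ← sub_sub]
    by_cases h6 : t - σ - τ ∈ Ioc S.a S.b
    · rw [h.comp _ _ _ h6.1 (by linarith) (by linarith) ht.2 h3]
    · rw [hb.eq_zero_of_sub_notMem h5 h6, ContinuousLinearMap.zero_apply, map_zero, sub_sub]
      rw [sub_sub] at h6
      rw [hb.eq_zero_of_sub_notMem ht h6, ContinuousLinearMap.zero_apply]
  · have h6 : t - (σ + τ) ∉ Ioc S.a S.b := fun h7 =>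
      h5 ⟨by linarith [h7.1], by linarith [ht.2]⟩
    rw [hb.eq_zero_of_sub_notMem ht h5, hb.eq_zero_of_sub_notMem ht h6,
      ContinuousLinearMap.zero_apply, ContinuousLinearMap.zero_apply]

theorem tendsto_semigroup (h : S.AlmostPropagator U N) (f : Lp X 2 S.vol) :
    Tendsto (fun σ => h.semigroup σ f) (𝓝[≥] 0) (𝓝 f) := by
  rw [Lp.tendsto_Lp_iff_tendsto_eLpNorm']
  refine ((h.bounds 0).tendsto_eLpNorm_evolShift_sub (Lp.memLp f)).congr fun σ => ?_
  refine eLpNorm_congr_ae ?_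
  filter_upwards [h.coeFn_semigroup σ f] with t h1
  rw [Pi.sub_apply, Pi.sub_apply, h1]

theorem norm_semigroup_sub_le (h : S.AlmostPropagator U N) (f : Lp X 2 S.vol) {σ τ : ℝ}
    (hσ : 0 ≤ σ) (hτ : 0 ≤ τ) :
    ‖h.semigroup (σ + τ) f - h.semigroup σ f‖ ≤ S.C * ‖h.semigroup τ f - f‖ := by
  rw [h.semigroup_add hσ hτ, ContinuousLinearMap.comp_apply, ← map_sub]
  exact h.norm_semigroup_apply_le _ _

theorem continuousOn_semigroup (h : S.AlmostPropagator U N) (f : Lp X 2 S.vol) :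
    ContinuousOn (fun σ => h.semigroup σ f) (Ici (0 : ℝ)) := by
  have hC := S.C_nonneg
  refine Metric.continuousOn_iff.2 fun σ hσ ε hε => ?_
  obtain ⟨δ, hδ, h1⟩ := Metric.mem_nhdsWithin_iff.1 (Metric.tendsto_nhds.1
    (h.tendsto_semigroup f) (ε / (S.C + 1)) (by positivity))
  have key : ∀ τ, 0 ≤ τ → τ < δ → S.C * ‖h.semigroup τ f - f‖ < ε := by
    intro τ hτ hτδ
    have h2 := h1 (show τ ∈ Metric.ball 0 δ ∩ Ici 0 from
      ⟨by rwa [Metric.mem_ball, Real.dist_0_eq_abs, abs_of_nonneg hτ], hτ⟩)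
    rw [mem_setOf_eq, dist_eq_norm, lt_div_iff₀ (by positivity)] at h2
    nlinarith [norm_nonneg (h.semigroup τ f - f)]
  refine ⟨δ, hδ, fun σ' hσ' hd => ?_⟩
  rw [Real.dist_eq, abs_lt] at hd
  rw [mem_Ici] at hσ hσ'
  rw [dist_eq_norm]
  rcases le_total σ σ' with hle | hle
  · have h3 := h.norm_semigroup_sub_le f hσ (sub_nonneg.2 hle)
    rw [add_sub_cancel] at h3
    exact h3.trans_lt (key _ (sub_nonneg.2 hle) (by linarith))
  · have h3 := h.norm_semigroup_sub_le f hσ' (sub_nonneg.2 hle)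
    rw [add_sub_cancel, norm_sub_rev] at h3
    exact h3.trans_lt (key _ (sub_nonneg.2 hle) (by linarith))

/-- The generator of the evolution semigroup extends `-d/dt + A(·)`. -/
theorem hasDerivWithinAt_semigroup (h : S.AlmostPropagator U N) (f : Lp X 2 S.vol)
    (gY : ℝ → Y) (g' : ℝ → X) (hf : ⇑f =ᵐ[S.vol] fun t => S.JY (gY t))
    (hc : Continuous fun t => S.JY (gY t)) (h0 : ∀ t ∉ Ioc S.a S.b, S.JY (gY t) = 0)
    (hd : ∀ s ∈ Ioc S.a S.b, ∀ t ∈ Ioc S.a S.b, S.JY (gY t) - S.JY (gY s) = ∫ τ in s..t, g' τ)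
    (hg' : MemLp g' 2 S.vol) (hgY : MemLp gY 2 S.vol) (w : Lp X 2 S.vol)
    (hw : ⇑w =ᵐ[S.vol] fun t => -(g' t) + S.A t (S.JY (gY t))) :
    HasDerivWithinAt (fun σ => h.semigroup σ f) w (Ici (0 : ℝ)) 0 := by
  have hb := h.bounds 0
  have : SecondCountableTopology X := UniformSpace.secondCountable_of_separable X
  rw [hasDerivWithinAt_iff_tendsto_slope, Ici_sdiff_left, Lp.tendsto_Lp_iff_tendsto_eLpNorm']
  have h1 := h.tendsto_eLpNorm_shiftSlope_sub hgY
  have h2 := tendsto_eLpNorm_slidingAverage_sub hg'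
  refine tendsto_of_tendsto_of_tendsto_of_le_of_le' tendsto_const_nhds
    (by simpa using h1.add h2) (.of_forall fun _ => zero_le) ?_
  filter_upwards [self_mem_nhdsWithin] with σ hσ
  rw [mem_Ioi] at hσ
  have m1 : AEStronglyMeasurable ((fun t => S.shiftSlope U σ t (gY (t - σ))) -
      fun t => S.AY t (gY t)) S.vol :=
    ((hb.isLpBounded_shiftSlope hσ).aestronglyMeasurable _ hgY).sub
      (S.isLpBounded_AY.aestronglyMeasurable _ hgY)
  have m2 : AEStronglyMeasurable (slidingAverage (Ioc S.a S.b) σ g' - g') S.vol :=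
    ((isLpBounded_slidingAverage measurableSet_Ioc hσ).aestronglyMeasurable _ hg').sub hg'.1
  refine le_trans (le_of_eq (eLpNorm_congr_ae ?_)) (eLpNorm_sub_le m1 m2 one_le_two)
  have h3 : ⇑(slope (fun τ => h.semigroup τ f) 0 σ) =ᵐ[S.vol]
      fun t => σ⁻¹ • (evolShift U σ f t - f t) := by
    rw [slope_def_module, sub_zero, h.semigroup_zero]
    filter_upwards [Lp.coeFn_smul σ⁻¹ (h.semigroup σ f - f),
      Lp.coeFn_sub (h.semigroup σ f) f, h.coeFn_semigroup σ f] with t e1 e2 e3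
    rw [ContinuousLinearMap.one_apply, e1, Pi.smul_apply, e2, Pi.sub_apply, e3]
  filter_upwards [h3, hw, hf, ae_restrict_mem measurableSet_Ioc,
    ae_restrict_of_ae (ae_comp_sub_of_ae_restrict measurableSet_Ioc hf σ)] with t e1 e2 e3 ht e4
  have h4 := smul_sub_eq_slidingAverage hc h0 hd hg' hσ ht
  simp only [Pi.sub_apply]
  rw [e1, e2, e3, AY_apply ht, ← h4, evolShift, shiftSlope]
  by_cases h5 : t - σ ∈ Ioc S.a S.b
  · rw [if_pos h5, e4 h5]
    simp only [ContinuousLinearMap.smul_apply, ContinuousLinearMap.sub_apply,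
      ContinuousLinearMap.comp_apply, smul_sub]
    abel
  · rw [if_neg h5, h0 _ h5, hb.eq_zero_of_sub_notMem ht h5]
    simp only [ContinuousLinearMap.zero_apply, smul_sub, smul_zero]
    abel

end AlmostPropagator

end KatoSetting

namespace KatoSetting

variable {X Y Y' : Type*} [NormedAddCommGroup X] [NormedSpace ℝ X]
    [NormedAddCommGroup Y] [NormedSpace ℝ Y] [NormedAddCommGroup Y'] [NormedSpace ℝ Y']
    {S : KatoSetting X Y Y'}

theorem tendsto_apply_of_admissible {B : ℕ → ℝ → X →L[ℝ] X} (hB : ∀ k, S.Admissible k (B k))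
    {t : ℝ} (ht : t ∈ Ioc S.a S.b) {y : X} (hy : y ∈ S.Dom t) :
    Tendsto (fun k => B k t y) atTop (𝓝 (S.A t y)) := by
  refine Metric.tendsto_atTop.2 fun ε hε => ?_
  obtain ⟨k₀, hk₀⟩ := Metric.tendsto_atTop.1 ((tendsto_yosida ht hy).comp S.tendsto_freq) (ε / 2)
    (half_pos hε)
  refine ⟨k₀, fun k hk => ?_⟩
  rw [dist_eq_norm]
  refine ((hB k).approx t ht y hy (ε / 2) fun j hj => ?_).trans_lt (half_lt_self hε)
  rw [← dist_eq_norm]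
  exact (hk₀ j (hk.trans hj)).le

variable (S) in
/-- Existence of an almost-propagator that is a weak limit of the propagators of an admissible
bounded approximation. -/
theorem exists_almostPropagator [CompleteSpace X] [TopologicalSpace.SeparableSpace X]
    (hrefl : Function.Surjective (NormedSpace.inclusionInDoubleDual ℝ X)) :
    ∃ (U : ℝ → ℝ → X →L[ℝ] X) (N : Set ℝ), S.AlmostPropagator U N ∧
      ∃ (B : ℕ → ℝ → X →L[ℝ] X) (W : ℕ → ℝ → ℝ → X →L[ℝ] X),
        (∀ k, S.Admissible k (B k)) ∧
        (∀ k, Evolves S.a S.b S.Fam (S.rate k) (B k) (W k)) ∧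
        ∀ t s x (φ : StrongDual ℝ X),
          Tendsto (fun k => φ (W k t s x)) atTop (𝓝 (φ (U t s x))) := by
  obtain ⟨V, hV, hcut⟩ := S.exists_limit hrefl
  obtain ⟨W, hW, hlim⟩ := exists_seq_tendsto hrefl hV
  choose B hB hBW using hW
  exact ⟨V, _, almostPropagator_of_cut_eq hV hcut, B, W, hB, hBW, Evo.tendsto_iff.1 hlim⟩

end KatoSetting

/-- **Existence of almost-propagators for Kato-stable families
(Theorem 3.19).**  Let `I = (a,b]` be bounded, `X` separable and reflexive,
and let `A(t)`, `t ∈ I`, be a Kato-stable family of generators with constants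
`(M,ω)` such that (i) the resolvents of `A(t)` and `A(t)*` are strongly
continuous in `t`, (ii) there are Banach spaces `Y ↪ D(A(t))` and
`Y' ↪ D(A(t)*)` densely embedded in `X` resp. `X*`, uniformly in `t`, and
(iii) `t ↦ A(t)y`, `t ↦ A(t)*y'` are continuous for `y ∈ Y`, `y' ∈ Y'`.
Then there is a family `U(t,s)`, `(t,s) ∈ D_I`, with `‖U(t,s)‖ ≤ Me^{ω(t-s)}`,
`U(s,s) = 1`, satisfying the causal factorization `U(t,r)U(r,s) = U(t,s)`
for `r` outside a null set `N`; `U` is weakly continuous and strongly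
measurable, strongly continuous in `s` uniformly in `t`, `U(t,s) → 1` as
`(t,s) → (r,r)`, differentiable on `Y` (`∂_s U(t,s)y = −U(t,s)A(s)y`,
`∂⁺_t U(t,s)y|_{t=s} = A(s)y`), arises as a weak limit of the propagators of
an admissible bounded approximation, and `G₀ = −d/dt + A(·)` on
`W¹₀(I,X) ∩ L²(I,Y)` has an extension generating the strongly continuous
semigroup `(T(σ)f)(t) = U(t,t−σ)f(t−σ)` on `L²(I,X)`. -/
theorem extension_theorem_kato_stable
    {X : Type*} [NormedAddCommGroup X] [NormedSpace ℝ X] [CompleteSpace X]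
    [TopologicalSpace.SeparableSpace X]
    (hrefl : Function.Surjective (NormedSpace.inclusionInDoubleDual ℝ X))
    (a b : ℝ) (hab : a < b)
    (Dom : ℝ → Set X) (Aop : ℝ → X → X)
    (hdense : ∀ t ∈ Ioc a b, Dense (Dom t))
    (M ω : ℝ) (hM : 1 ≤ M)
    (Res : ℝ → ℝ → X →L[ℝ] X)
    (hRes_mem : ∀ t ∈ Ioc a b, ∀ lam : ℝ, ω < lam → ∀ x : X,
      Res lam t x ∈ Dom t ∧ lam • Res lam t x - Aop t (Res lam t x) = x)
    (hRes_inv : ∀ t ∈ Ioc a b, ∀ lam : ℝ, ω < lam → ∀ y ∈ Dom t,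
      Res lam t (lam • y - Aop t y) = y)
    (hstable : ∀ (k : ℕ) (ts : Fin k → ℝ), (∀ i, ts i ∈ Ioc a b) →
      Monotone ts → ∀ lam : ℝ, ω < lam →
        ‖((List.ofFn fun i => Res lam (ts i)).reverse).prod‖
          ≤ M * ((lam - ω) ^ k)⁻¹)
    -- the adjoint family `A(t)*`
    (DomS : ℝ → Set (StrongDual ℝ X))
    (AS : ℝ → StrongDual ℝ X → StrongDual ℝ X)
    (hadj : ∀ t ∈ Ioc a b, ∀ v ∈ DomS t, ∀ y ∈ Dom t,
      (AS t v) y = v (Aop t y))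
    (hadj_dom : ∀ t ∈ Ioc a b, ∀ v : StrongDual ℝ X,
      (v ∈ DomS t ↔ ∃ w : StrongDual ℝ X, ∀ y ∈ Dom t, w y = v (Aop t y)))
    (ResS : ℝ → ℝ → StrongDual ℝ X →L[ℝ] StrongDual ℝ X)
    (hResS_mem : ∀ t ∈ Ioc a b, ∀ lam : ℝ, ω < lam →
      ∀ v : StrongDual ℝ X,
      ResS lam t v ∈ DomS t ∧ lam • ResS lam t v - AS t (ResS lam t v) = v)
    (hResS_inv : ∀ t ∈ Ioc a b, ∀ lam : ℝ, ω < lam → ∀ w ∈ DomS t,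
      ResS lam t (lam • w - AS t w) = w)
    -- (i) strong continuity of the resolvents at some `λ₀ ≥ 0`
    (lam₀ : ℝ) (hlam₀ : 0 ≤ lam₀) (hlam₀ω : ω < lam₀)
    (hRes_cont : ∀ x : X, ContinuousOn (fun t => Res lam₀ t x) (Ioc a b))
    (hResS_cont : ∀ v : StrongDual ℝ X,
      ContinuousOn (fun t => ResS lam₀ t v) (Ioc a b))
    -- (ii) the densely embedded Banach spaces `Y ↪ D(A(t))`, `Y' ↪ D(A(t)*)`
    {Y : Type*} [NormedAddCommGroup Y] [NormedSpace ℝ Y] [CompleteSpace Y]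
    (JY : Y →L[ℝ] X) (hJY_inj : Function.Injective JY)
    (hJY_dense : DenseRange JY)
    (hYDom : ∀ t ∈ Ioc a b, ∀ y : Y, JY y ∈ Dom t)
    (CY : ℝ) (hYbound : ∀ t ∈ Ioc a b, ∀ y : Y,
      ‖JY y‖ + ‖Aop t (JY y)‖ ≤ CY * ‖y‖)
    {Y' : Type*} [NormedAddCommGroup Y'] [NormedSpace ℝ Y'] [CompleteSpace Y']
    (JY' : Y' →L[ℝ] StrongDual ℝ X) (hJY'_inj : Function.Injective JY')
    (hJY'_dense : DenseRange JY')
    (hY'Dom : ∀ t ∈ Ioc a b, ∀ y : Y', JY' y ∈ DomS t)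
    (CY' : ℝ) (hY'bound : ∀ t ∈ Ioc a b, ∀ y : Y',
      ‖JY' y‖ + ‖AS t (JY' y)‖ ≤ CY' * ‖y‖)
    -- (iii) continuity of `t ↦ A(t)y` and `t ↦ A(t)*y'`
    (hAY_cont : ∀ y : Y, ContinuousOn (fun t => Aop t (JY y)) (Ioc a b))
    (hASY_cont : ∀ y : Y', ContinuousOn (fun t => AS t (JY' y)) (Ioc a b)) :
    ∃ (U : ℝ → ℝ → X →L[ℝ] X) (N : Set ℝ),
      N ⊆ Ioc a b ∧ volume N = 0 ∧
      -- norm bound and initial condition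
      (∀ t ∈ Ioc a b, ∀ s ∈ Ioc a b, s ≤ t →
        ‖U t s‖ ≤ M * exp (ω * (t - s))) ∧
      (∀ s ∈ Ioc a b, U s s = 1) ∧
      -- causal factorization off the null set `N`
      (∀ t ∈ Ioc a b, ∀ s ∈ Ioc a b, s ≤ t → ∀ r ∈ Icc s t, r ∉ N →
        (U t r).comp (U r s) = U t s) ∧
      -- weak continuity and strong measurability
      (∀ x : X, ∀ φ : StrongDual ℝ X,
        ContinuousOn (fun q : ℝ × ℝ => φ (U q.1 q.2 x))
          {q : ℝ × ℝ | q.1 ∈ Ioc a b ∧ q.2 ∈ Ioc a b ∧ q.2 ≤ q.1}) ∧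
      (∀ x : X, StronglyMeasurable fun q : ℝ × ℝ => U q.1 q.2 x) ∧
      -- strong continuity in `s`, uniformly in `t`
      (∀ x : X, ∀ ε : ℝ, 0 < ε → ∃ δ : ℝ, 0 < δ ∧
        ∀ t ∈ Ioc a b, ∀ s ∈ Ioc a b, ∀ s' ∈ Ioc a b, s ≤ t → s' ≤ t →
          |s - s'| < δ → ‖U t s x - U t s' x‖ ≤ ε) ∧
      -- `U(t,s) → 1` as `(t,s) → (r,r)`
      (∀ r ∈ Ioc a b, ∀ x : X,
        Tendsto (fun q : ℝ × ℝ => U q.1 q.2 x)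
          (𝓝[{q : ℝ × ℝ | q.1 ∈ Ioc a b ∧ q.2 ∈ Ioc a b ∧ q.2 ≤ q.1}] (r, r))
          (𝓝 x)) ∧
      -- differentiability on `Y`
      (∀ y : Y, ∀ t ∈ Ioc a b, ∀ s ∈ Ioc a b, s ≤ t →
        HasDerivWithinAt (fun σ => U t σ (JY y)) (-(U t s (Aop s (JY y))))
          (Ioc a b ∩ Iic t) s) ∧
      (∀ y : Y, ∀ s ∈ Ioc a b,
        HasDerivWithinAt (fun τ => U τ s (JY y)) (Aop s (JY y))
          (Ioc a b ∩ Ici s) s) ∧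
      -- `U` is a weak limit of propagators of an admissible bounded
      -- approximation of `A(·)`
      (∃ (An : ℕ → ℝ → X →L[ℝ] X) (Un : ℕ → ℝ → ℝ → X →L[ℝ] X)
          (nl : ℕ → ℕ) (c M₀ ω₀ : ℝ),
        StrictMono nl ∧ 0 < c ∧ 1 ≤ M₀ ∧
        (∀ n : ℕ, ∀ x : X, ContinuousOn (fun t => An n t x) (Ioc a b)) ∧
        (∀ t ∈ Ioc a b, ∀ y ∈ Dom t,
          Tendsto (fun n : ℕ => An n t y) atTop (𝓝 (Aop t y))) ∧
        (∀ n : ℕ, ∀ t ∈ Ioc a b, ∀ y ∈ Dom t,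
          ‖An n t y‖ ≤ c * (‖Aop t y‖ + ‖y‖)) ∧
        (∀ n : ℕ, ∀ s ∈ Ioc a b, ∀ t ∈ Ioc a b, s ≤ t → ∀ x : X,
          Un n t s x = x + ∫ τ in s..t, An n τ (Un n τ s x)) ∧
        (∀ n : ℕ, ∀ s ∈ Ioc a b, ∀ t ∈ Ioc a b, s ≤ t →
          ‖Un n t s‖ ≤ M₀ * exp (ω₀ * (t - s))) ∧
        (∀ t ∈ Ioc a b, ∀ s ∈ Ioc a b, s ≤ t → ∀ x : X,
          ∀ φ : StrongDual ℝ X,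
          Tendsto (fun l : ℕ => φ (Un (nl l) t s x)) atTop
            (𝓝 (φ (U t s x))))) ∧
      -- the semigroup `T` on `L²(I,X)` generated by an extension of `G₀`
      (∃ T : ℝ → (Lp X 2 (volume.restrict (Ioc a b)) →L[ℝ]
          Lp X 2 (volume.restrict (Ioc a b))),
        (∀ σ : ℝ, 0 ≤ σ → ∀ f : Lp X 2 (volume.restrict (Ioc a b)),
          ⇑(T σ f) =ᵐ[volume.restrict (Ioc a b)]
            fun t => if t - σ ∈ Ioc a b then U t (t - σ) (f (t - σ)) else 0) ∧
        T 0 = 1 ∧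
        (∀ σ τ : ℝ, 0 ≤ σ → 0 ≤ τ → T (σ + τ) = (T σ).comp (T τ)) ∧
        (∀ f, ContinuousOn (fun σ => T σ f) (Ici (0:ℝ))) ∧
        -- the generator of `T` extends `G₀ = −d/dt + A(·)` defined on
        -- `F̃ = W¹₀(I,X) ∩ L²(I,Y)`
        (∀ (f : Lp X 2 (volume.restrict (Ioc a b)))
            (gY : ℝ → Y) (g' : ℝ → X),
          (⇑f =ᵐ[volume.restrict (Ioc a b)] fun t => JY (gY t)) →
          Continuous (fun t => JY (gY t)) →
          (∀ t ∉ Ioc a b, JY (gY t) = 0) →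
          (∀ s ∈ Ioc a b, ∀ t ∈ Ioc a b,
            JY (gY t) - JY (gY s) = ∫ τ in s..t, g' τ) →
          MemLp g' 2 (volume.restrict (Ioc a b)) →
          MemLp gY 2 (volume.restrict (Ioc a b)) →
          ∀ h : Lp X 2 (volume.restrict (Ioc a b)),
            (⇑h =ᵐ[volume.restrict (Ioc a b)]
              fun t => -(g' t) + Aop t (JY (gY t))) →
            HasDerivWithinAt (fun σ => T σ f) h (Ici (0:ℝ)) 0)) := by
  let S : KatoSetting X Y Y' :=
    { a := a, b := b, hab := hab, Dom := Dom, A := Aop, M := M, ω := ω, Res := Res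
      stable := ⟨hdense, hM, hRes_mem, hRes_inv, hstable⟩
      lam := lam₀, lt_lam := hlam₀ω, continuousOn_res := hRes_cont
      JY := JY, JY_dense := hJY_dense, JY_mem := hYDom, CY := max CY 0
      CY_nonneg := le_max_right _ _
      norm_A_le := fun t ht y => ((le_add_of_nonneg_left (norm_nonneg _)).trans
        (hYbound t ht y)).trans (mul_le_mul_of_nonneg_right (le_max_left _ _) (norm_nonneg _))
      continuousOn_A := hAY_cont
      JY' := JY', JY'_dense := hJY'_dense, AS := fun t ψ => AS t (JY' ψ)
      AS_apply := fun t ht ψ x hx => hadj t ht _ (hY'Dom t ht ψ) x hx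
      CY' := max CY' 0, CY'_nonneg := le_max_right _ _
      norm_AS_le := fun t ht ψ => ((le_add_of_nonneg_left (norm_nonneg _)).trans
        (hY'bound t ht ψ)).trans (mul_le_mul_of_nonneg_right (le_max_left _ _) (norm_nonneg _)) }
  obtain ⟨U, N, h, B, W, hB, hW, hlim⟩ := S.exists_almostPropagator hrefl
  have hb := h.bounds 0
  have hF := S.stable.isNormFamily
  refine ⟨U, N, h.subset, h.null, fun t ht s hs hst => h.opNorm_le hs.1 hst ht.2, hb.refl,
    fun t ht s hs hst r hr hrN => ContinuousLinearMap.ext fun x =>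
      h.comp s r t hs.1 hr.1 hr.2 ht.2 hrN x,
    hb.continuousOn_dual, hb.stronglyMeasurable, fun x ε hε => ?_, fun r hr x => ?_,
    fun y t ht s hs hst => h.hasDerivWithinAt_left y hs.1 hst ht.2,
    fun y s hs => h.hasDerivWithinAt_right y hs,
    ⟨B, W, id, S.c, M, S.rate 0, strictMono_id, S.c_pos, hM, fun n => (hB n).diss.cont,
      fun t ht y hy => KatoSetting.tendsto_apply_of_admissible hB ht hy, fun n t ht y hy => ?_,
      fun n s hs t ht hst x => (hW n).integral_eq hF (hB n).diss hs.1 hst ht.2 x,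
      fun n s hs t ht hst => ?_, fun t ht s hs hst x φ => hlim t s x φ⟩,
    h.semigroup, fun σ _ f => h.coeFn_semigroup_eq_ite σ f, h.semigroup_zero,
    fun σ τ hσ hτ => h.semigroup_add hσ hτ, h.continuousOn_semigroup,
    fun f gY g' hf hc h0 hd hg' hgY w hw =>
      h.hasDerivWithinAt_semigroup f gY g' hf hc h0 hd hg' hgY w hw⟩
  · obtain ⟨δ, hδ, h1⟩ := hb.norm_sub_left_uniform x hε
    exact ⟨δ, hδ, fun t ht s hs s' hs' hst hst' hd => h1 t s s' hs.1 hst hs'.1 hst' ht.2 hd⟩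
  · refine Metric.tendsto_nhds.2 fun ε hε => ?_
    obtain ⟨δ, hδ, h1⟩ := hb.norm_sub_self_uniform x (half_pos hε)
    have h2 : ∀ᶠ q : ℝ × ℝ in 𝓝 (r, r), q.1 - q.2 < δ := by
      have h3 : Continuous fun q : ℝ × ℝ => q.1 - q.2 := by fun_prop
      exact (h3.tendsto (r, r)).eventually_lt_const (by simpa using hδ)
    filter_upwards [self_mem_nhdsWithin, nhdsWithin_le_nhds h2] with q hq hqδ
    rw [dist_eq_norm]
    exact (h1 q.1 q.2 hq.2.1.1 hq.2.2 hq.1.2 hqδ).trans_lt (half_lt_self hε)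
  · exact ((hB n).norm_le t ht y hy).trans (mul_le_mul_of_nonneg_left
      (le_add_of_nonneg_right (norm_nonneg _)) S.c_pos.le)
  · have h1 : S.rate n * (t - s) ≤ S.rate 0 * (t - s) :=
      mul_le_mul_of_nonneg_right (S.rate_anti n.zero_le) (sub_nonneg.2 hst)
    exact ((hW n).opNorm_le hF hs.1 hst ht.2).trans
      (mul_le_mul_of_nonneg_left (exp_le_exp.2 h1) S.M_nonneg)
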